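/- arXiv:1201.2778 — 6 statements merged into one kernel-verified Lean document; each statement's English description precedes it below -/
import Mathlib

section
/- Let m ≥ 4 and let γ : ℝ → ℝ^m be a C^∞ curve of finite type at 0 with γ'(0) ≠ 0, γ''(0) ∈ span{γ'(0)}, dim span{γ'(0), γ''(0), γ'''(0)} = 2, dim span{γ'(0), …, γ⁽⁴⁾(0)} = 3, dim span{γ'(0), …, γ⁽⁵⁾(0)} = 3, and dim span{γ'(0), …, γ⁽⁶⁾(0)} = 4 (i.e. γ has type (1,3,4,6,a₅,…,a_m) at 0). Then the tangent map-germ Tan(γ)(s,t) = γ(t) + s·γ'(t) at (0,0) is diffeomorphic (right–left equivalent) to the unfurled Mond surface map-germ (u,x) ↦ (u, x³ + ux², (3/4)x⁴ + (2/3)ux³, (1/2)x⁶ + (2/5)ux⁵, 0, …, 0) : (ℝ², 0) → (ℝ^m, 0); in particular the diffeomorphism class of the tangent variety of a curve of type (1,3,4,6,a₅,…,a_m) is unique. -/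
open Filter Topology

/-- Two map-germs `f` at `a` and `g` at `b` are diffeomorphic (right-left equivalent):
there are germs of `C^∞` diffeomorphisms `σ : (E, a) → (E, b)` and
`τ : (F, f a) → (F, g b)` with `g ∘ σ = τ ∘ f` as germs at `a`. -/
def GermEquiv {E F : Type*} [NormedAddCommGroup E] [NormedSpace ℝ E]
    [NormedAddCommGroup F] [NormedSpace ℝ F]
    (f : E → F) (a : E) (g : E → F) (b : E) : Prop :=
  ∃ σ σinv : E → E, ∃ τ τinv : F → F,
    σ a = b ∧ τ (f a) = g b ∧
    ContDiffAt ℝ (⊤ : ℕ∞) σ a ∧ ContDiffAt ℝ (⊤ : ℕ∞) σinv b ∧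
    ContDiffAt ℝ (⊤ : ℕ∞) τ (f a) ∧ ContDiffAt ℝ (⊤ : ℕ∞) τinv (g b) ∧
    (∀ᶠ x in 𝓝 a, σinv (σ x) = x) ∧ (∀ᶠ y in 𝓝 b, σ (σinv y) = y) ∧
    (∀ᶠ z in 𝓝 (f a), τinv (τ z) = z) ∧ (∀ᶠ w in 𝓝 (g b), τ (τinv w) = w) ∧
    (∀ᶠ x in 𝓝 a, g (σ x) = τ (f x))

namespace UM

abbrev Sm {E F : Type} [NormedAddCommGroup E] [NormedSpace ℝ E]
    [NormedAddCommGroup F] [NormedSpace ℝ F] (f : E → F) : Prop := ContDiff ℝ (⊤ : ℕ∞) f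

theorem hasFDerivAt_param {E F : Type} [NormedAddCommGroup E] [NormedSpace ℝ E] [ProperSpace E]
    [NormedAddCommGroup F] [NormedSpace ℝ F] (G : E × ℝ → F) (hG : ContDiff ℝ 1 G) (p : E) :
    HasFDerivAt (fun p => ∫ s in (0:ℝ)..1, G (p, s))
      (∫ s in (0:ℝ)..1, (fderiv ℝ G (p, s)).comp (ContinuousLinearMap.inl ℝ E ℝ)) p := by
  have hc : Continuous (fun z : E × ℝ => (fderiv ℝ G z).comp (ContinuousLinearMap.inl ℝ E ℝ)) := by
    have := hG.continuous_fderiv (by norm_num)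
    exact this.clm_comp continuous_const
  have hK : IsCompact (Metric.closedBall p 1 ×ˢ Set.Icc (0:ℝ) 1) :=
    (isCompact_closedBall p 1).prod isCompact_Icc
  obtain ⟨C, hC⟩ := hK.exists_bound_of_continuousOn hc.continuousOn
  refine intervalIntegral.hasFDerivAt_integral_of_dominated_of_fderiv_le
    (F := fun p s => G (p, s))
    (F' := fun p s => (fderiv ℝ G (p, s)).comp (ContinuousLinearMap.inl ℝ E ℝ))
    (bound := fun _ => C) (s := Metric.closedBall p 1) (Metric.closedBall_mem_nhds p one_pos)
    ?_ ?_ ?_ ?_ ?_ ?_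
  · refine Eventually.of_forall fun x => ?_
    exact (hG.continuous.comp (Continuous.prodMk_right x)).aestronglyMeasurable
  · exact (hG.continuous.comp (Continuous.prodMk_right p)).intervalIntegrable _ _
  · exact (hc.comp (Continuous.prodMk_right p)).aestronglyMeasurable
  · refine Eventually.of_forall fun t ht x hx => ?_
    rw [Set.uIoc_of_le zero_le_one] at ht
    exact hC (x, t) ⟨hx, ht.1.le, ht.2⟩
  · exact intervalIntegrable_const
  · refine Eventually.of_forall fun t _ x _ => ?_
    have h1 : HasFDerivAt G (fderiv ℝ G (x, t)) (x, t) :=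
      (hG.differentiable (by norm_num) (x, t)).hasFDerivAt
    have h2 : HasFDerivAt (fun x : E => (x, t)) (ContinuousLinearMap.inl ℝ E ℝ) x :=
      hasFDerivAt_prodMk_left x t
    exact h1.comp x h2

theorem contDiff_param_nat {E : Type} [NormedAddCommGroup E] [NormedSpace ℝ E] [ProperSpace E]
    (n : ℕ) : ∀ {F : Type} [NormedAddCommGroup F] [NormedSpace ℝ F] (G : E × ℝ → F),
    Sm G → ContDiff ℝ n (fun p => ∫ s in (0:ℝ)..1, G (p, s)) := by
  induction n with
  | zero =>
    intro F _ _ G hG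
    refine contDiff_zero.2 ?_
    exact intervalIntegral.continuous_parametric_intervalIntegral_of_continuous
      (f := fun p s => G (p, s)) (hG.continuous) continuous_const
  | succ n ih =>
    intro F _ _ G hG
    push_cast
    rw [contDiff_succ_iff_hasFDerivAt]
    refine ⟨_, ?_, fun p => hasFDerivAt_param G (hG.of_le (by exact_mod_cast le_top)) p⟩
    refine ih (fun q => (fderiv ℝ G q).comp (ContinuousLinearMap.inl ℝ E ℝ)) ?_
    have := (contDiff_infty_iff_fderiv.1 hG).2
    exact this.clm_comp contDiff_const

theorem sm_param {E : Type} [NormedAddCommGroup E] [NormedSpace ℝ E] [ProperSpace E]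
    {F : Type} [NormedAddCommGroup F] [NormedSpace ℝ F] (G : E × ℝ → F)
    (hG : Sm G) : Sm (fun p => ∫ s in (0:ℝ)..1, G (p, s)) :=
  contDiff_infty.2 fun n => contDiff_param_nat n G hG

/-- directional derivative is smooth -/
theorem sm_dir {E F : Type} [NormedAddCommGroup E] [NormedSpace ℝ E]
    [NormedAddCommGroup F] [NormedSpace ℝ F] {f : E → F} (hf : Sm f) (v : E) :
    Sm (fun z => fderiv ℝ f z v) :=
  (contDiff_infty_iff_fderiv.1 hf).2.clm_apply contDiff_const

theorem Sm.hasFDerivAt {E F : Type} [NormedAddCommGroup E] [NormedSpace ℝ E]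
    [NormedAddCommGroup F] [NormedSpace ℝ F] {f : E → F} (hf : Sm f) (z : E) :
    HasFDerivAt f (fderiv ℝ f z) z :=
  (hf.differentiable (by norm_num) z).hasFDerivAt

/-- difference quotient -/
theorem segment_formula {E : Type} [NormedAddCommGroup E] [NormedSpace ℝ E]
    {f : E → ℝ} (hf : Sm f) (a v : E) (x : ℝ) :
    f (a + x • v) = f a + x * ∫ s in (0:ℝ)..1, fderiv ℝ f (a + (s * x) • v) v := by
  have h : ∀ s ∈ Set.uIcc (0:ℝ) 1, HasDerivAt (fun s : ℝ => f (a + (s * x) • v))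
      (x * fderiv ℝ f (a + (s * x) • v) v) s := by
    intro s _
    have h1 : HasDerivAt (fun s : ℝ => a + (s * x) • v) (x • v) s := by
      have := (((hasDerivAt_id s).mul_const x).smul_const v).const_add a
      simpa using this
    have := (hf.hasFDerivAt (a + (s * x) • v)).comp_hasDerivAt s h1
    simpa [Function.comp_def] using this
  have hc : Continuous (fun s : ℝ => x * fderiv ℝ f (a + (s * x) • v) v) := by
    have := (sm_dir hf v).continuous
    fun_prop
  have := intervalIntegral.integral_eq_sub_of_hasDerivAt h (hc.intervalIntegrable _ _)
  rw [intervalIntegral.integral_const_mul] at this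
  simp at this
  rw [this]; ring

/-- Hadamard lemma along a linear coordinate direction. -/
theorem hadamard {L : Type} [NormedAddCommGroup L] [NormedSpace ℝ L] [ProperSpace L]
    {f : ℝ × L → ℝ} (hf : Sm f) :
    ∃ g : ℝ × L → ℝ, Sm g ∧ (∀ x l, f (x, l) = f (0, l) + x * g (x, l)) ∧
      ∀ x l, g (x, l) = ∫ s in (0:ℝ)..1, fderiv ℝ f (s * x, l) (1, 0) := by
  refine ⟨fun z => ∫ s in (0:ℝ)..1, fderiv ℝ f (s * z.1, z.2) (1, 0), ?_, ?_, fun _ _ => rfl⟩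
  · refine sm_param (fun q : (ℝ × L) × ℝ => fderiv ℝ f (q.2 * q.1.1, q.1.2) (1, 0)) ?_
    exact (sm_dir hf (1, 0)).comp (f := fun q : (ℝ × L) × ℝ => (q.2 * q.1.1, q.1.2))
      (by fun_prop)
  · intro x l
    have := segment_formula hf (0, l) (1, 0) x
    simpa using this

theorem hadamard_zero {L : Type} [NormedAddCommGroup L] [NormedSpace ℝ L] [ProperSpace L]
    {f : ℝ × L → ℝ} (hf : Sm f) (h0 : ∀ l, f (0, l) = 0) :
    ∃ g : ℝ × L → ℝ, Sm g ∧ (∀ x l, f (x, l) = x * g (x, l)) := by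
  obtain ⟨g, hg, h, -⟩ := hadamard hf
  exact ⟨g, hg, fun x l => by rw [h, h0, zero_add]⟩

/-- one-variable Hadamard -/
theorem hadamard1 {f : ℝ → ℝ} (hf : Sm f) :
    ∃ g : ℝ → ℝ, Sm g ∧ (∀ x, f x = f 0 + x * g x) := by
  refine ⟨fun z => ∫ s in (0:ℝ)..1, fderiv ℝ f (s * z) 1, ?_, ?_⟩
  · refine sm_param (fun q : ℝ × ℝ => fderiv ℝ f (q.2 * q.1) 1) ?_
    exact (sm_dir hf 1).comp (f := fun q : ℝ × ℝ => q.2 * q.1) (by fun_prop)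
  · intro x
    have := segment_formula hf 0 1 x
    simpa using this

end UM

namespace UM
open MeasureTheory FourierTransform

theorem iteratedDeriv_cexp2pi (n : ℕ) :
    iteratedDeriv n (fun x : ℝ => Complex.exp (2 * Real.pi * x)) =
      fun x : ℝ => (2 * Real.pi : ℂ) ^ n * Complex.exp (2 * Real.pi * x) := by
  induction n with
  | zero => simp
  | succ n ih =>
    rw [iteratedDeriv_succ, ih]
    funext x
    have h : HasDerivAt (fun x : ℝ => Complex.exp (2 * Real.pi * x))
        (Complex.exp (2 * Real.pi * x) * (2 * Real.pi)) x := by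
      have h1 : HasDerivAt (fun x : ℝ => (2 * Real.pi * x : ℂ)) (2 * Real.pi) x := by
        simpa using (Complex.ofRealCLM.hasDerivAt (x := x)).const_mul (2 * Real.pi : ℂ)
      exact h1.cexp
    rw [(h.const_mul _).deriv]
    ring

theorem exists_psi : ∃ ψ : ℝ → ℝ, Continuous ψ ∧ (∀ k : ℕ, Integrable (fun s => s ^ k * ψ s)) ∧
    ∀ k : ℕ, ∫ s, s ^ (2 * k) * ψ s = (-1) ^ k := by
  let χ : ContDiffBump (0:ℝ) := ⟨1, 2, one_pos, one_lt_two⟩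
  let φ0 : ℝ → ℂ := fun x => (χ x : ℂ) * Complex.exp (2 * Real.pi * x)
  have hs : ContDiff ℝ (⊤ : ℕ∞) φ0 := by
    have h1 : ContDiff ℝ (⊤ : ℕ∞) (fun x : ℝ => (χ x : ℂ)) :=
      Complex.ofRealCLM.contDiff.comp χ.contDiff
    have h2 : ContDiff ℝ (⊤ : ℕ∞) (fun x : ℝ => Complex.exp (2 * Real.pi * x)) := by
      have : ContDiff ℝ (⊤ : ℕ∞) (fun x : ℝ => (2 * Real.pi * x : ℂ)) :=
        contDiff_const.mul Complex.ofRealCLM.contDiff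
      exact this.cexp
    exact h1.mul h2
  have hcs : HasCompactSupport φ0 := by
    have : HasCompactSupport (fun x : ℝ => (χ x : ℂ)) :=
      χ.hasCompactSupport.comp_left (g := fun x : ℝ => (x : ℂ)) (by simp)
    exact this.mul_right
  let φ : SchwartzMap ℝ ℂ := hcs.toSchwartzMap hs
  have hφ : ∀ x, φ x = φ0 x := fun x => by simp [φ]
  let Ψ : SchwartzMap ℝ ℂ := 𝓕⁻ φ
  have hΨ : 𝓕 (Ψ : ℝ → ℂ) = φ0 := by
    have h1 : 𝓕 Ψ = φ := by simp [Ψ]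
    rw [← SchwartzMap.fourier_coe, h1]
    funext x; exact hφ x
  have hIntg : ∀ k : ℕ, Integrable (fun x : ℝ => x ^ k • Ψ x) := by
    intro k
    have := Ψ.integrable_pow_mul volume k
    refine (this.mono' ?_ ?_)
    · exact ((continuous_id.pow k).smul Ψ.continuous).aestronglyMeasurable
    · refine Eventually.of_forall fun x => ?_
      simp [norm_smul]
  have hev : φ0 =ᶠ[𝓝 0] fun x : ℝ => Complex.exp (2 * Real.pi * x) := by
    filter_upwards [χ.eventuallyEq_one] with x hx
    simp [φ0, hx]
  have hmom : ∀ k : ℕ, ∫ x : ℝ, (x:ℂ) ^ (2 * k) * Ψ x = (-1) ^ k := by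
    intro k
    have h1 := Real.iteratedDeriv_fourier (f := (Ψ : ℝ → ℂ)) (N := ⊤) (n := 2 * k)
      (fun n _ => hIntg n) le_top
    rw [hΨ] at h1
    have h2 := congrFun h1 0
    rw [(hev.iteratedDeriv_eq (2 * k)), iteratedDeriv_cexp2pi] at h2
    rw [Real.fourier_eq] at h2
    simp only [inner_zero_right, neg_zero, AddChar.map_zero_eq_one, one_smul, smul_eq_mul,
      Complex.ofReal_zero, mul_zero, Complex.exp_zero, mul_one] at h2
    have h3 : ∀ x : ℝ, (-2 * (Real.pi:ℂ) * Complex.I * x) ^ (2 * k) * Ψ x =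
        ((2 * Real.pi : ℂ) ^ (2 * k) * (-1) ^ k) * ((x:ℂ) ^ (2 * k) * Ψ x) := by
      intro x
      have : (Complex.I) ^ (2 * k) = (-1) ^ k := by rw [pow_mul, Complex.I_sq]
      rw [← this]
      have h4 : (-1 : ℂ) ^ (2 * k) = 1 := by rw [pow_mul]; simp
      calc _ = (-1 : ℂ) ^ (2 * k) * (((2 * Real.pi : ℂ) * Complex.I * x) ^ (2 * k) * Ψ x) := by
            rw [← mul_assoc, ← mul_pow]; ring_nf
        _ = _ := by rw [h4, mul_pow, mul_pow]; ring
    simp_rw [h3] at h2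
    rw [integral_const_mul] at h2
    have hpi : (2 * Real.pi : ℂ) ^ (2 * k) ≠ 0 := by
      apply pow_ne_zero
      exact_mod_cast (by positivity : (2 * Real.pi : ℝ) ≠ 0)
    have h5 : (1:ℂ) = (-1) ^ k * ∫ x : ℝ, (x:ℂ) ^ (2 * k) * Ψ x := by
      apply mul_left_cancel₀ hpi
      rw [mul_one, ← mul_assoc]
      exact h2
    have h6 : ((-1:ℂ) ^ k) * (-1) ^ k = 1 := by rw [← mul_pow]; simp
    calc ∫ x : ℝ, (x:ℂ) ^ (2 * k) * Ψ x
        = ((-1:ℂ) ^ k * (-1) ^ k) * ∫ x : ℝ, (x:ℂ) ^ (2 * k) * Ψ x := by rw [h6, one_mul]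
      _ = (-1) ^ k := by rw [mul_assoc, ← h5, mul_one]
  have hre : ∀ (k : ℕ) (s : ℝ), s ^ k * (Ψ s).re = Complex.reCLM (s ^ k • Ψ s) := by
    intro k s; rw [map_smul]; rfl
  refine ⟨fun s => (Ψ s).re, Complex.continuous_re.comp Ψ.continuous, ?_, ?_⟩
  · intro k
    simp_rw [hre k]
    exact Complex.reCLM.integrable_comp (hIntg k)
  · intro k
    simp_rw [hre (2 * k)]
    rw [Complex.reCLM.integral_comp_comm (hIntg (2 * k))]
    have : ∀ s : ℝ, s ^ (2 * k) • Ψ s = (s:ℂ) ^ (2 * k) * Ψ s := by intro s; simp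
    simp_rw [this]
    rw [hmom]
    have : ((-1:ℂ)) ^ k = (((-1:ℝ) ^ k : ℝ) : ℂ) := by push_cast; rfl
    rw [this]; exact Complex.ofReal_re _

end UM

namespace UM
open MeasureTheory

abbrev R2 := ℝ × ℝ
abbrev R3 := ℝ × ℝ × ℝ

def e0 : R3 := (1, 0, 0)
def e1 : R3 := (0, 1, 0)
def e2 : R3 := (0, 0, 1)
def p0 : R3 →L[ℝ] ℝ := ContinuousLinearMap.fst ℝ ℝ (ℝ × ℝ)
def p1 : R3 →L[ℝ] ℝ := (ContinuousLinearMap.fst ℝ ℝ ℝ).comp (ContinuousLinearMap.snd ℝ ℝ (ℝ × ℝ))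
def p2 : R3 →L[ℝ] ℝ := (ContinuousLinearMap.snd ℝ ℝ ℝ).comp (ContinuousLinearMap.snd ℝ ℝ (ℝ × ℝ))

theorem clm_decomp (T : R3 →L[ℝ] ℝ) : T = T e0 • p0 + T e1 • p1 + T e2 • p2 := by
  apply ContinuousLinearMap.ext
  rintro ⟨a, b, c⟩
  have : (a, b, c) = a • e0 + b • e1 + c • e2 := by simp [e0, e1, e2]
  rw [this, map_add, map_add, map_smul, map_smul, map_smul]
  simp [e0, e1, e2, p0, p1, p2]; ring

structure EvC (ρ : R2 → ℝ) (g : R3 → ℝ) : Prop where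
  sm : Sm g
  even : ∀ y l, g (-y, l) = g (y, l)
  supp : ∀ y l, ρ l < |y| → g (y, l) = 0

def refl0 : R3 →L[ℝ] R3 :=
  (-(ContinuousLinearMap.fst ℝ ℝ (ℝ × ℝ))).prod (ContinuousLinearMap.snd ℝ ℝ (ℝ × ℝ))

theorem refl0_apply (y : ℝ) (l : R2) : refl0 (y, l) = (-y, l) := rfl

theorem EvC.fderiv_refl {ρ : R2 → ℝ} {g : R3 → ℝ} (hg : EvC ρ g) (y : ℝ) (l : R2) (v : R3) :
    fderiv ℝ g (-y, l) (refl0 v) = fderiv ℝ g (y, l) v := by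
  have h : (fun z => g (refl0 z)) = g := by
    funext ⟨y, l⟩; exact hg.even y l
  have h1 : HasFDerivAt (fun z => g (refl0 z)) ((fderiv ℝ g (-y, l)).comp refl0) (y, l) :=
    (hg.sm.hasFDerivAt (refl0 (y, l))).comp (y, l) refl0.hasFDerivAt
  rw [h] at h1
  rw [h1.fderiv]; rfl

theorem EvC.fderiv_supp {ρ : R2 → ℝ} (hρ : Continuous ρ) {g : R3 → ℝ} (hg : EvC ρ g) (y : ℝ) (l : R2)
    (h : ρ l < |y|) : fderiv ℝ g (y, l) = 0 := by
  have ho : IsOpen {z : R3 | ρ z.2 < |z.1|} := isOpen_lt (by fun_prop) (by fun_prop)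
  have : g =ᶠ[𝓝 (y, l)] fun _ => 0 := by
    filter_upwards [ho.mem_nhds (show (y, l) ∈ {z : R3 | ρ z.2 < |z.1|} from h)] with z hz
    exact hg.supp z.1 z.2 hz
  rw [this.fderiv_eq]; simp

theorem EvC.d1 {ρ : R2 → ℝ} (hρ : Continuous ρ) {g : R3 → ℝ} (hg : EvC ρ g) :
    EvC ρ (fun z => fderiv ℝ g z e1) :=
  ⟨sm_dir hg.sm _, fun y l => by rw [← hg.fderiv_refl y l e1]; simp [e1, refl0_apply],
    fun y l h => by rw [hg.fderiv_supp hρ y l h]; rfl⟩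

theorem EvC.d2 {ρ : R2 → ℝ} (hρ : Continuous ρ) {g : R3 → ℝ} (hg : EvC ρ g) :
    EvC ρ (fun z => fderiv ℝ g z e2) :=
  ⟨sm_dir hg.sm _, fun y l => by rw [← hg.fderiv_refl y l e2]; simp [e2, refl0_apply],
    fun y l h => by rw [hg.fderiv_supp hρ y l h]; rfl⟩

theorem EvC.exN {ρ : R2 → ℝ} (hρ : Continuous ρ) (hpos : ∀ l, 0 < ρ l) {g : R3 → ℝ} (hg : EvC ρ g) :
    ∃ N, EvC ρ N ∧ ∀ z, fderiv ℝ g z e0 = 2 * z.1 * N z := by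
  have hodd : ∀ y l, fderiv ℝ g (-y, l) e0 = - fderiv ℝ g (y, l) e0 := by
    intro y l
    rw [← hg.fderiv_refl y l e0]
    have : refl0 e0 = - e0 := by simp [e0, refl0_apply]
    rw [this, map_neg, neg_neg]
  have h0 : ∀ l, fderiv ℝ g (0, l) e0 = 0 := by
    intro l
    have := hodd 0 l
    rw [neg_zero] at this
    linarith
  obtain ⟨N, hN, h⟩ := hadamard_zero (f := fun z : R3 => (1/2) * fderiv ℝ g z e0)
    (contDiff_const.mul (sm_dir hg.sm e0)) (fun l => by rw [h0]; ring)
  have key : ∀ z : R3, fderiv ℝ g z e0 = 2 * z.1 * N z := by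
    rintro ⟨y, l⟩
    have := h y l
    simp only at this ⊢
    linarith
  refine ⟨N, ⟨hN, ?_, ?_⟩, key⟩
  · intro y l
    by_cases hy : y = 0
    · subst hy; simp
    · have h1 := h y l
      have h2 := h (-y) l
      rw [hodd] at h2
      have : y * N (-y, l) = y * N (y, l) := by linarith
      exact mul_left_cancel₀ hy this
  · intro y l hyl
    have hy : y ≠ 0 := by
      rintro rfl
      simp at hyl
      linarith [hpos l]
    have h1 := h y l
    rw [hg.fderiv_supp hρ y l hyl] at h1
    simp at h1
    tauto

theorem EvC.bound {ρ : R2 → ℝ} (hρ : Continuous ρ) {g : R3 → ℝ} (hg : Continuous g)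
    (hs : ∀ y l, ρ l < |y| → g (y, l) = 0) (l0 : R2) :
    ∃ C, 0 ≤ C ∧ ∀ l ∈ Metric.closedBall l0 1, ∀ y, |g (y, l)| ≤ C := by
  obtain ⟨M, hM⟩ := (isCompact_closedBall l0 1).exists_bound_of_continuousOn hρ.continuousOn
  obtain ⟨C, hC⟩ := ((isCompact_Icc (a := -M) (b := M)).prod
    (isCompact_closedBall l0 1)).exists_bound_of_continuousOn hg.continuousOn
  refine ⟨max C 0, le_max_right _ _, fun l hl y => ?_⟩
  by_cases hy : |y| ≤ M
  · exact (hC (y, l) ⟨abs_le.1 hy, hl⟩).trans (le_max_left _ _)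
  · have : ρ l < |y| := by
      have := hM l hl
      rw [Real.norm_eq_abs] at this
      linarith [le_abs_self (ρ l)]
    rw [hs y l this]; simp

/-- the weights -/
structure Psi (ψ : ℝ → ℝ) : Prop where
  cont : Continuous ψ
  int : ∀ k : ℕ, Integrable (fun s => s ^ k * ψ s)
  mom : ∀ k : ℕ, ∫ s, s ^ (2 * k) * ψ s = (-1) ^ k

noncomputable def BB (ψ : ℝ → ℝ) (k : ℕ) (g : R3 → ℝ) (z : R3) : ℝ :=
  ∫ s, ((-1) ^ k * (s ^ (2 * k) * ψ s)) * g (s * z.1, z.2)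

theorem BB_zero {ψ : ℝ → ℝ} (hψ : Psi ψ) (k : ℕ) (g : R3 → ℝ) (l : R2) :
    BB ψ k g (0, l) = g (0, l) := by
  unfold BB
  simp only [mul_zero]
  rw [integral_mul_const, integral_const_mul, hψ.mom, ← mul_pow]
  simp

theorem BB_cont {ψ : ℝ → ℝ} (hψ : Psi ψ) {ρ : R2 → ℝ} (hρ : Continuous ρ)
    (k : ℕ) {g : R3 → ℝ} (hg : EvC ρ g) : Continuous (BB ψ k g) := by
  rw [continuous_iff_continuousAt]
  rintro ⟨y0, l0⟩
  obtain ⟨C, hC0, hC⟩ := EvC.bound hρ hg.sm.continuous hg.supp l0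
  have hgc := hg.sm.continuous
  have hψc := hψ.cont
  refine continuousAt_of_dominated (bound := fun s => ‖s ^ (2 * k) * ψ s‖ * C) ?_ ?_ ?_ ?_
  · refine Eventually.of_forall fun z => Continuous.aestronglyMeasurable ?_
    fun_prop
  · have : ∀ᶠ z : R3 in 𝓝 (y0, l0), z.2 ∈ Metric.closedBall l0 1 :=
      (continuous_snd.tendsto (y0, l0)).eventually (Metric.closedBall_mem_nhds l0 one_pos)
    filter_upwards [this] with z hz
    refine Eventually.of_forall fun s => ?_
    rw [norm_mul, norm_mul, norm_pow, norm_neg, norm_one, one_pow, one_mul]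
    exact mul_le_mul_of_nonneg_left (hC _ hz _) (norm_nonneg _)
  · exact (hψ.int (2 * k)).norm.mul_const C
  · refine Eventually.of_forall fun s => Continuous.continuousAt ?_
    fun_prop

theorem integral_three {F : Type} [NormedAddCommGroup F] [NormedSpace ℝ F] [CompleteSpace F]
    {a b c : ℝ → ℝ} (ha : Integrable a) (hb : Integrable b) (hc : Integrable c) (x y z : F) :
    ∫ s, (a s • x + b s • y + c s • z) = (∫ s, a s) • x + (∫ s, b s) • y + (∫ s, c s) • z := by
  rw [integral_add (f := fun s => a s • x + b s • y) ((ha.smul_const x).add (hb.smul_const y))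
    (hc.smul_const z), integral_add (ha.smul_const x) (hb.smul_const y), integral_smul_const,
    integral_smul_const, integral_smul_const]

theorem BB_hasFDerivAt {ψ : ℝ → ℝ} (hψ : Psi ψ) {ρ : R2 → ℝ} (hρ : Continuous ρ)
    (k : ℕ) {g N : R3 → ℝ} (hg : EvC ρ g) (hNc : EvC ρ N)
    (hN : ∀ z, fderiv ℝ g z e0 = 2 * z.1 * N z) (z0 : R3) :
    HasFDerivAt (BB ψ k g) ((-(2 * z0.1 * BB ψ (k + 1) N z0)) • p0 +
      BB ψ k (fun z => fderiv ℝ g z e1) z0 • p1 + BB ψ k (fun z => fderiv ℝ g z e2) z0 • p2) z0 := by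
  obtain ⟨y0, l0⟩ := z0
  set g1 := fun z => fderiv ℝ g z e1 with hg1
  set g2 := fun z => fderiv ℝ g z e2 with hg2
  have h1 : EvC ρ g1 := hg.d1 hρ
  have h2 : EvC ρ g2 := hg.d2 hρ
  have h0s : Sm (fun z => fderiv ℝ g z e0) := sm_dir hg.sm e0
  obtain ⟨C0, hC00, hC0⟩ := EvC.bound hρ (g := fun z => fderiv ℝ g z e0) h0s.continuous
    (fun y l h => by rw [hg.fderiv_supp hρ y l h]; rfl) l0
  obtain ⟨C1, hC10, hC1⟩ := EvC.bound hρ h1.sm.continuous h1.supp l0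
  obtain ⟨C2, hC20, hC2⟩ := EvC.bound hρ h2.sm.continuous h2.supp l0
  obtain ⟨C, hC0', hC⟩ := EvC.bound hρ hg.sm.continuous hg.supp l0
  obtain ⟨CN, hCN0, hCN⟩ := EvC.bound hρ hNc.sm.continuous hNc.supp l0
  have hgc := hg.sm.continuous
  have hNcc := hNc.sm.continuous
  have hψc := hψ.cont
  have c0 := h0s.continuous
  have c1 := h1.sm.continuous
  have c2 := h2.sm.continuous
  have hl0 : l0 ∈ Metric.closedBall l0 1 := Metric.mem_closedBall_self zero_le_one
  let w : ℝ → ℝ := fun s => (-1) ^ k * (s ^ (2 * k) * ψ s)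
  have hwc : Continuous w := by unfold w; fun_prop
  have hwn : ∀ s, ‖w s‖ = ‖s ^ (2 * k) * ψ s‖ := by
    intro s; simp only [w]
    rw [norm_mul, norm_pow, norm_neg, norm_one, one_pow, one_mul]
  have hIntg : ∀ (j : ℕ) (f : R3 → ℝ), Continuous f → (∃ C, ∀ y, |f (y, l0)| ≤ C) →
      Integrable (fun s => (s ^ j * w s) * f (s * y0, l0)) := by
    rintro j f hf ⟨C, hC⟩
    have hi : Integrable (fun s => s ^ j * w s) := by
      have := (hψ.int (j + 2 * k)).const_mul ((-1) ^ k)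
      refine this.congr (Eventually.of_forall fun s => ?_)
      simp only [w]; ring
    refine (hi.norm.mul_const C).mono' (by
      refine Continuous.aestronglyMeasurable ?_
      fun_prop) (Eventually.of_forall fun s => ?_)
    rw [norm_mul]
    exact mul_le_mul_of_nonneg_left (hC _) (norm_nonneg _)
  let F' : R3 → ℝ → (R3 →L[ℝ] ℝ) := fun z s =>
    ((s ^ 1 * w s) * fderiv ℝ g (s * z.1, z.2) e0) • p0 +
      ((s ^ 0 * w s) * g1 (s * z.1, z.2)) • p1 + ((s ^ 0 * w s) * g2 (s * z.1, z.2)) • p2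
  have main := hasFDerivAt_integral_of_dominated_of_fderiv_le (μ := volume)
    (F := fun z s => w s * g (s * z.1, z.2)) (F' := F') (x₀ := ((y0, l0) : R3))
    (bound := fun s => ‖s ^ (2 * k + 1) * ψ s‖ * C0 * ‖p0‖ + ‖s ^ (2 * k) * ψ s‖ * C1 * ‖p1‖
      + ‖s ^ (2 * k) * ψ s‖ * C2 * ‖p2‖)
    (s := {z : R3 | z.2 ∈ Metric.closedBall l0 1})
    ((continuous_snd.tendsto ((y0, l0) : R3)).eventually (Metric.closedBall_mem_nhds l0 one_pos))
    (Eventually.of_forall fun z => Continuous.aestronglyMeasurable (by fun_prop))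
    (by simpa using hIntg 0 g hgc ⟨C, hC l0 hl0⟩)
    (Continuous.aestronglyMeasurable (by unfold F'; fun_prop))
    (Eventually.of_forall fun s z hz => by
      refine (norm_add₃_le).trans ?_
      simp only [norm_smul]
      have hw1 : ‖s ^ 1 * w s‖ = ‖s ^ (2 * k + 1) * ψ s‖ := by
        rw [norm_mul, hwn, ← norm_mul]; ring_nf
      have hw0 : ‖s ^ 0 * w s‖ = ‖s ^ (2 * k) * ψ s‖ := by
        rw [pow_zero, one_mul, hwn]
      rw [norm_mul (s ^ 1 * w s), norm_mul (s ^ 0 * w s), norm_mul (s ^ 0 * w s), hw1, hw0]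
      have a0 := hC0 z.2 hz (s * z.1)
      have a1 := hC1 z.2 hz (s * z.1)
      have a2 := hC2 z.2 hz (s * z.1)
      rw [← Real.norm_eq_abs] at a0 a1 a2
      gcongr)
    ((((hψ.int (2 * k + 1)).norm.mul_const _).mul_const _).add
      (((hψ.int (2 * k)).norm.mul_const _).mul_const _) |>.add
      (((hψ.int (2 * k)).norm.mul_const _).mul_const _))
    (Eventually.of_forall fun s z _ => by
      have hlin : HasFDerivAt (fun z : R3 => (s * z.1, z.2))
          ((s • ContinuousLinearMap.fst ℝ ℝ (ℝ × ℝ)).prod (ContinuousLinearMap.snd ℝ ℝ (ℝ × ℝ))) z :=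
        ((s • ContinuousLinearMap.fst ℝ ℝ (ℝ × ℝ)).prod
          (ContinuousLinearMap.snd ℝ ℝ (ℝ × ℝ))).hasFDerivAt
      have hc := ((hg.sm.hasFDerivAt (s * z.1, z.2)).comp z hlin).const_mul (w s)
      refine hc.congr_fderiv ?_
      conv_lhs => rw [clm_decomp (fderiv ℝ g (s * z.1, z.2))]
      apply ContinuousLinearMap.ext
      rintro ⟨a, b, c⟩
      simp [F', p0, p1, p2, hg1, hg2]
      ring)
  refine main.congr_fderiv ?_
  simp only [F']
  have i0 : Integrable (fun s => (s ^ 1 * w s) * fderiv ℝ g (s * y0, l0) e0) :=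
    hIntg 1 _ c0 ⟨C0, hC0 l0 hl0⟩
  have i1 : Integrable (fun s => (s ^ 0 * w s) * g1 (s * y0, l0)) := hIntg 0 _ c1 ⟨C1, hC1 l0 hl0⟩
  have i2 : Integrable (fun s => (s ^ 0 * w s) * g2 (s * y0, l0)) := hIntg 0 _ c2 ⟨C2, hC2 l0 hl0⟩
  rw [integral_three i0 i1 i2]
  have j0 : ∫ s, (s ^ 1 * w s) * fderiv ℝ g (s * y0, l0) e0 = -(2 * y0 * BB ψ (k + 1) N (y0, l0)) := by
    unfold BB
    rw [← integral_const_mul, ← integral_neg]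
    congr 1; funext s
    rw [hN]; simp only [w]; ring
  have j1 : ∫ s, (s ^ 0 * w s) * g1 (s * y0, l0) = BB ψ k g1 (y0, l0) := by simp [BB, w]
  have j2 : ∫ s, (s ^ 0 * w s) * g2 (s * y0, l0) = BB ψ k g2 (y0, l0) := by simp [BB, w]
  rw [j0, j1, j2]

end UM

namespace UM
open MeasureTheory

noncomputable def AA (ψ : ℝ → ℝ) (k : ℕ) (g : R3 → ℝ) (z : R3) : ℝ :=
  if 0 ≤ z.1 then g (√z.1, z.2) else BB ψ k g (√(-z.1), z.2)

theorem AA_cont {ψ : ℝ → ℝ} (hψ : Psi ψ) {ρ : R2 → ℝ} (hρ : Continuous ρ)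
    (k : ℕ) {g : R3 → ℝ} (hg : EvC ρ g) : Continuous (AA ψ k g) := by
  have h1 := hg.sm.continuous
  have h2 := BB_cont hψ hρ k hg
  unfold AA
  refine Continuous.if_le (f' := fun z : R3 => g (√z.1, z.2)) (g' := fun z : R3 => BB ψ k g (√(-z.1), z.2))
    ?_ ?_ continuous_const continuous_fst ?_
  · fun_prop
  · exact h2.comp (by fun_prop)
  · rintro ⟨q, l⟩ hq
    simp only at hq
    subst hq
    simp [BB_zero hψ]

noncomputable def AD (ψ : ℝ → ℝ) (k : ℕ) (g N : R3 → ℝ) (z : R3) : R3 →L[ℝ] ℝ :=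
  AA ψ (k + 1) N z • p0 + AA ψ k (fun z => fderiv ℝ g z e1) z • p1 +
    AA ψ k (fun z => fderiv ℝ g z e2) z • p2

theorem AA_pos {ψ : ℝ → ℝ} 
    (k : ℕ) {g N : R3 → ℝ} (hg : Sm g)
    (hN : ∀ z, fderiv ℝ g z e0 = 2 * z.1 * N z) (z : R3) (hz : 0 < z.1) :
    HasFDerivAt (AA ψ k g) (AD ψ k g N z) z := by
  have hs : HasFDerivAt (fun z : R3 => √z.1) ((1 / (2 * √z.1)) • p0) z :=
    (HasFDerivAt.sqrt (f := fun z : R3 => z.1) (p0.hasFDerivAt) hz.ne')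
  have hc := (hg.hasFDerivAt (√z.1, z.2)).comp z (hs.prodMk
    (ContinuousLinearMap.snd ℝ ℝ (ℝ × ℝ)).hasFDerivAt)
  have hev : AA ψ k g =ᶠ[𝓝 z] (fun z : R3 => g (√z.1, z.2)) := by
    filter_upwards [(isOpen_lt continuous_const continuous_fst).mem_nhds hz] with w hw
    have hw : 0 < w.1 := hw
    simp [AA, hw.le]
  refine (hc.congr_of_eventuallyEq hev).congr_fderiv ?_
  rw [clm_decomp (fderiv ℝ g (√z.1, z.2)), hN]
  have hq : √z.1 ≠ 0 := (Real.sqrt_pos.2 hz).ne'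
  apply ContinuousLinearMap.ext
  rintro ⟨a, b, c⟩
  simp [AD, AA, hz.le, p0, p1, p2]
  field_simp

theorem AA_neg {ψ : ℝ → ℝ} (hψ : Psi ψ) {ρ : R2 → ℝ} (hρ : Continuous ρ)
    (k : ℕ) {g N : R3 → ℝ} (hg : EvC ρ g) (hNc : EvC ρ N)
    (hN : ∀ z, fderiv ℝ g z e0 = 2 * z.1 * N z) (z : R3) (hz : z.1 < 0) :
    HasFDerivAt (AA ψ k g) (AD ψ k g N z) z := by
  have hs : HasFDerivAt (fun z : R3 => √(-z.1)) ((1 / (2 * √(-z.1))) • (-p0)) z :=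
    (HasFDerivAt.sqrt (f := fun z : R3 => -z.1) (p0.hasFDerivAt.neg) (neg_ne_zero.2 hz.ne))
  have hc := (BB_hasFDerivAt hψ hρ k hg hNc hN (√(-z.1), z.2)).comp z (hs.prodMk
    (ContinuousLinearMap.snd ℝ ℝ (ℝ × ℝ)).hasFDerivAt)
  have hev : AA ψ k g =ᶠ[𝓝 z] (fun z : R3 => BB ψ k g (√(-z.1), z.2)) := by
    filter_upwards [(isOpen_lt continuous_fst continuous_const).mem_nhds hz] with w hw
    have hw : w.1 < 0 := hw
    simp [AA, hw.not_ge]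
  refine (hc.congr_of_eventuallyEq hev).congr_fderiv ?_
  have hq : √(-z.1) ≠ 0 := (Real.sqrt_pos.2 (neg_pos.2 hz)).ne'
  apply ContinuousLinearMap.ext
  rintro ⟨a, b, c⟩
  simp [AD, AA, hz.not_ge, p0, p1, p2]
  field_simp

theorem AD_cont {ψ : ℝ → ℝ} (hψ : Psi ψ) {ρ : R2 → ℝ} (hρ : Continuous ρ)
    (k : ℕ) {g N : R3 → ℝ} (hg : EvC ρ g) (hNc : EvC ρ N) : Continuous (AD ψ k g N) := by
  have a := AA_cont hψ hρ (k+1) hNc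
  have b := AA_cont hψ hρ k (hg.d1 hρ)
  have c := AA_cont hψ hρ k (hg.d2 hρ)
  unfold AD
  fun_prop

theorem AA_hasFDerivAt {ψ : ℝ → ℝ} (hψ : Psi ψ) {ρ : R2 → ℝ} (hρ : Continuous ρ)
    (k : ℕ) {g N : R3 → ℝ} (hg : EvC ρ g) (hNc : EvC ρ N)
    (hN : ∀ z, fderiv ℝ g z e0 = 2 * z.1 * N z) (z : R3) :
    HasFDerivAt (AA ψ k g) (AD ψ k g N z) z := by
  rcases lt_trichotomy z.1 0 with hz | hz | hz
  · exact AA_neg hψ hρ k hg hNc hN z hz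
  · have hDc := AD_cont hψ hρ k hg hNc
    have hAc := AA_cont hψ hρ k hg
    have h1 := hasFDerivWithinAt_closure_of_tendsto_fderiv (f := AA ψ k g)
      (s := Set.Ioi (0:ℝ) ×ˢ (Set.univ : Set R2)) (x := z) (f' := AD ψ k g N z)
      (fun w hw => (AA_pos k hg.sm hN w hw.1).differentiableAt.differentiableWithinAt)
      ((convex_Ioi 0).prod convex_univ) (isOpen_Ioi.prod isOpen_univ)
      (fun y _ => hAc.continuousWithinAt)
      (by
        refine (hDc.continuousWithinAt (s := Set.Ioi (0:ℝ) ×ˢ (Set.univ : Set R2))).tendsto.congr' ?_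
        filter_upwards [self_mem_nhdsWithin] with w hw
        exact (AA_pos k hg.sm hN w hw.1).fderiv.symm)
    have h2 := hasFDerivWithinAt_closure_of_tendsto_fderiv (f := AA ψ k g)
      (s := Set.Iio (0:ℝ) ×ˢ (Set.univ : Set R2)) (x := z) (f' := AD ψ k g N z)
      (fun w hw => (AA_neg hψ hρ k hg hNc hN w hw.1).differentiableAt.differentiableWithinAt)
      ((convex_Iio 0).prod convex_univ) (isOpen_Iio.prod isOpen_univ)
      (fun y _ => hAc.continuousWithinAt)
      (by
        refine (hDc.continuousWithinAt (s := Set.Iio (0:ℝ) ×ˢ (Set.univ : Set R2))).tendsto.congr' ?_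
        filter_upwards [self_mem_nhdsWithin] with w hw
        exact (AA_neg hψ hρ k hg hNc hN w hw.1).fderiv.symm)
    have h3 := h1.union h2
    rw [closure_prod_eq, closure_prod_eq, closure_Ioi, closure_Iio, ← Set.union_prod,
      Set.Ici_union_Iic, closure_univ, Set.univ_prod_univ, hasFDerivWithinAt_univ] at h3
    exact h3
  · exact AA_pos k hg.sm hN z hz

theorem AA_contDiff {ψ : ℝ → ℝ} (hψ : Psi ψ) {ρ : R2 → ℝ} (hρ : Continuous ρ)
    (hpos : ∀ l, 0 < ρ l) (n : ℕ) : ∀ (k : ℕ) {g : R3 → ℝ} (_ : EvC ρ g), ContDiff ℝ n (AA ψ k g) := by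
  induction n with
  | zero => intro k g hg; exact contDiff_zero.2 (AA_cont hψ hρ k hg)
  | succ n ih =>
    intro k g hg
    obtain ⟨N, hNc, hN⟩ := hg.exN hρ hpos
    push_cast
    rw [contDiff_succ_iff_hasFDerivAt]
    refine ⟨AD ψ k g N, ?_, AA_hasFDerivAt hψ hρ k hg hNc hN⟩
    have a := ih (k+1) hNc
    have b := ih k (hg.d1 hρ)
    have c := ih k (hg.d2 hρ)
    unfold AD
    fun_prop

/-- Whitney even function theorem with parameters -/
theorem even_thm {ρ : R2 → ℝ} (hρ : Continuous ρ) (hpos : ∀ l, 0 < ρ l) {g : R3 → ℝ} (hg : EvC ρ g) :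
    ∃ a : R3 → ℝ, Sm a ∧ ∀ y l, g (y, l) = a (y ^ 2, l) := by
  obtain ⟨ψ, h1, h2, h3⟩ := exists_psi
  have hψ : Psi ψ := ⟨h1, h2, h3⟩
  refine ⟨AA ψ 0 g, contDiff_infty.2 fun n => AA_contDiff hψ hρ hpos n 0 hg, fun y l => ?_⟩
  simp only [AA, sq_nonneg, if_true, Real.sqrt_sq_eq_abs]
  rcases abs_choice y with h | h <;> rw [h]
  exact (hg.even y l).symm

/-- Division by a quadratic with parameters -/
theorem even_odd {h : R3 → ℝ} (hh : Sm h) :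
    ∃ a b : R3 → ℝ, Sm a ∧ Sm b ∧ ∀ y l, y ^ 2 ≤ 4 * (1 + l.1 ^ 2 + l.2 ^ 2) →
      h (y, l) = a (y ^ 2, l) + y * b (y ^ 2, l) := by
  let χ : ContDiffBump (0 : ℝ) := ⟨4, 8, by norm_num, by norm_num⟩
  let ρ : R2 → ℝ := fun l => √ (9 * (1 + l.1 ^ 2 + l.2 ^ 2))
  have hρ : Continuous ρ := by unfold ρ; fun_prop
  have hpos : ∀ l, 0 < ρ l := fun l => Real.sqrt_pos.2 (by positivity)
  let c : R3 → ℝ := fun z => χ (z.1 ^ 2 / (1 + z.2.1 ^ 2 + z.2.2 ^ 2))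
  have hc : Sm c := by
    refine χ.contDiff.comp ?_
    refine ContDiff.div (by fun_prop) (by fun_prop) (fun z => by positivity)
  have hcs : ∀ y l, ρ l < |y| → c (y, l) = 0 := by
    intro y l hy
    have h1 := (Real.sqrt_lt' (lt_of_lt_of_le (hpos l) hy.le)).1 hy
    rw [sq_abs] at h1
    have h2 : 0 < 1 + l.1 ^ 2 + l.2 ^ 2 := by positivity
    refine χ.zero_of_le_dist ?_
    simp only [Real.dist_eq, sub_zero]
    rw [abs_of_nonneg (by positivity), le_div_iff₀ h2]
    simp only [χ]
    linarith
  have hce : ∀ y l, c (-y, l) = c (y, l) := by intro y l; simp [c]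
  have hc1 : ∀ y l, y ^ 2 ≤ 4 * (1 + l.1 ^ 2 + l.2 ^ 2) → c (y, l) = 1 := by
    intro y l hy
    have h2 : 0 < 1 + l.1 ^ 2 + l.2 ^ 2 := by positivity
    refine χ.one_of_mem_closedBall ?_
    simp only [Metric.mem_closedBall, Real.dist_eq, sub_zero]
    rw [abs_of_nonneg (by positivity), div_le_iff₀ h2]
    exact hy
  let G : R3 → ℝ := fun z => c z * h z
  have hG : Sm G := hc.mul hh
  have hGr : Sm (fun z : R3 => G (-z.1, z.2)) := hG.comp (by fun_prop)
  have hGs : ∀ y l, ρ l < |y| → G (y, l) = 0 := fun y l hy => by simp [G, hcs y l hy]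
  have hev : EvC ρ (fun z => (1/2) * (G z + G (-z.1, z.2))) := by
    refine ⟨contDiff_const.mul (hG.add hGr), fun y l => by simp; ring, fun y l hy => ?_⟩
    have := hGs y l hy
    have := hGs (-y) l (by rwa [abs_neg])
    simp [*]
  obtain ⟨b0, hb0, hb⟩ := hadamard_zero (f := fun z : R3 => (1/2) * (G z - G (-z.1, z.2)))
    (contDiff_const.mul (hG.sub hGr)) (fun l => by simp)
  have hbe : EvC ρ b0 := by
    refine ⟨hb0, fun y l => ?_, fun y l hy => ?_⟩
    · by_cases hy : y = 0
      · simp [hy]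
      · have h1 := hb y l
        have h2 := hb (-y) l
        simp only [neg_neg] at h1 h2
        exact mul_left_cancel₀ hy (by linarith)
    · have h0 : y ≠ 0 := by
        rintro rfl
        simp at hy
        linarith [hpos l]
      have h1 := hb y l
      have := hGs y l hy
      have h2 := hGs (-y) l (by rwa [abs_neg])
      simp [*] at h1
      tauto
  obtain ⟨a, ha, ha'⟩ := even_thm hρ hpos hev
  obtain ⟨b, hb1, hb'⟩ := even_thm hρ hpos hbe
  refine ⟨a, b, ha, hb1, fun y l hy => ?_⟩
  rw [← ha', ← hb', ← hb]
  have : h (y, l) = G (y, l) := by simp [G, hc1 y l hy]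
  rw [this]; ring

end UM

namespace UM

theorem hadamard_graph {f : R2 → ℝ} (hf : Sm f) {φ : ℝ → ℝ} (hφ : Sm φ) :
    ∃ g : R2 → ℝ, Sm g ∧ ∀ u c, f (u, c) = f (u, φ u) + (c - φ u) * g (u, c) := by
  obtain ⟨g, hg, h, -⟩ := hadamard (f := fun z : ℝ × ℝ => f (z.2, z.1 + φ z.2))
    (hf.comp (contDiff_snd.prodMk (contDiff_fst.add (hφ.comp contDiff_snd))))
  refine ⟨fun z => g (z.2 - φ z.1, z.1),
    hg.comp ((contDiff_snd.sub (hφ.comp contDiff_fst)).prodMk contDiff_fst), fun u c => ?_⟩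
  have := h (c - φ u) u
  simpa using this

theorem hadamard_graph_zero {f : R2 → ℝ} (hf : Sm f) {φ : ℝ → ℝ} (hφ : Sm φ)
    (h0 : ∀ u, f (u, φ u) = 0) :
    ∃ g : R2 → ℝ, Sm g ∧ ∀ u c, f (u, c) = (c - φ u) * g (u, c) := by
  obtain ⟨g, hg, h⟩ := hadamard_graph hf hφ
  exact ⟨g, hg, fun u c => by rw [h, h0, zero_add]⟩

/-- continuous functions agreeing near but off a point agree at the point -/
theorem eq_of_punctured {f g : ℝ → ℝ} {a : ℝ} (hf : ContinuousAt f a) (hg : ContinuousAt g a)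
    (h : ∀ᶠ x in 𝓝[≠] a, f x = g x) : f a = g a := by
  have h1 : Tendsto f (𝓝[≠] a) (𝓝 (f a)) := hf.tendsto.mono_left nhdsWithin_le_nhds
  have h2 : Tendsto g (𝓝[≠] a) (𝓝 (g a)) := hg.tendsto.mono_left nhdsWithin_le_nhds
  exact tendsto_nhds_unique (h1.congr' h) h2

theorem punct_ne (a b : ℝ) : ∀ᶠ x in 𝓝[≠] a, x ≠ b := by
  by_cases h : a = b
  · subst h; exact self_mem_nhdsWithin
  · exact (eventually_ne_nhds h).filter_mono nhdsWithin_le_nhds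

def PP (u c : ℝ) : ℝ := c ^ 3 + u * c ^ 2

def FC (r : R2 → ℝ) : Prop := ∀ u c c', PP u c = PP u c' → r (u, c) = r (u, c')

noncomputable def UU (c c' : ℝ) : ℝ := -(c ^ 2 + c * c' + c' ^ 2) / (c + c')

theorem UU_symm (c c' : ℝ) : UU c c' = UU c' c := by unfold UU; ring_nf

theorem PP_UU {c c' : ℝ} (h : c + c' ≠ 0) : PP (UU c c') c = PP (UU c c') c' := by
  unfold PP UU; field_simp; ring

theorem eq_UU {u c c' : ℝ} (h : PP u c = PP u c') (hne : c ≠ c') : c + c' ≠ 0 ∧ u = UU c c' := by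
  have h1 : (c - c') * ((c ^ 2 + c * c' + c' ^ 2) + u * (c + c')) = 0 := by
    unfold PP at h; linear_combination h
  have h2 : (c ^ 2 + c * c' + c' ^ 2) + u * (c + c') = 0 :=
    (mul_eq_zero.1 h1).resolve_left (sub_ne_zero.2 hne)
  have h3 : c + c' ≠ 0 := by
    intro h0
    have : c' = -c := by linarith
    subst this
    have : c ^ 2 = 0 := by linear_combination h2
    have : c = 0 := by simpa using this
    subst this; simp at hne
  refine ⟨h3, ?_⟩
  unfold UU
  rw [eq_div_iff h3]; linarith

theorem UU_hasDerivAt {c c' : ℝ} (h : c + c' ≠ 0) :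
    HasDerivAt (fun c => UU c c') (-(c * (c + 2 * c')) / (c + c') ^ 2) c := by
  have h1 : HasDerivAt (fun c : ℝ => -(c ^ 2 + c * c' + c' ^ 2)) (-(2 * c + c')) c := by
    have := ((((hasDerivAt_id c).pow 2).add ((hasDerivAt_id c).mul_const c')).add_const (c' ^ 2)).neg
    refine this.congr_deriv ?_
    simp
  have h2 : HasDerivAt (fun c : ℝ => c + c') 1 c := (hasDerivAt_id c).add_const c'
  refine (h1.div h2 h).congr_deriv ?_
  field_simp; ring

theorem hasDerivAt_comp2 {r : R2 → ℝ} (hr : Sm r) {a b : ℝ → ℝ} {a' b' c : ℝ}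
    (ha : HasDerivAt a a' c) (hb : HasDerivAt b b' c) :
    HasDerivAt (fun c => r (a c, b c))
      (a' * fderiv ℝ r (a c, b c) (1, 0) + b' * fderiv ℝ r (a c, b c) (0, 1)) c := by
  have h := (hr.hasFDerivAt (a c, b c)).comp_hasDerivAt c (ha.prodMk hb)
  refine h.congr_deriv ?_
  have : (a', b') = a' • ((1:ℝ), (0:ℝ)) + b' • ((0:ℝ), (1:ℝ)) := by simp
  rw [this, map_add, map_smul, map_smul]; rfl

theorem desc_A {r : R2 → ℝ} (hr : Sm r) (hF : FC r) {c c' : ℝ} (h : c + c' ≠ 0) :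
    fderiv ℝ r (UU c c', c) (0, 1) =
      (fderiv ℝ r (UU c c', c') (1, 0) - fderiv ℝ r (UU c c', c) (1, 0)) *
        (-(c * (c + 2 * c')) / (c + c') ^ 2) := by
  have h1 := hasDerivAt_comp2 hr (UU_hasDerivAt h) (hasDerivAt_id c)
  have h2 := hasDerivAt_comp2 hr (UU_hasDerivAt h) (hasDerivAt_const c c')
  have hev : (fun c => r (UU c c', id c)) =ᶠ[𝓝 c] (fun c => r (UU c c', c')) := by
    have : ∀ᶠ x in 𝓝 c, x + c' ≠ 0 :=
      (continuous_id.add continuous_const).continuousAt.eventually_ne h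
    filter_upwards [this] with x hx
    exact hF _ _ _ (PP_UU hx)
  have h3 := h1.unique (h2.congr_of_eventuallyEq hev)
  simp only [id] at h3
  linarith

theorem desc_r1 {r : R2 → ℝ} (hr : Sm r) (hF : FC r) :
    ∃ r1 : R2 → ℝ, Sm r1 ∧ ∀ u c, fderiv ℝ r (u, c) (0, 1) = c * (3 * c + 2 * u) * r1 (u, c) := by
  have hc := sm_dir hr (0, 1)
  have hcc := hc.continuous
  have z1 : ∀ u, fderiv ℝ r (u, 0) (0, 1) = 0 := by
    intro u
    refine eq_of_punctured (f := fun u : ℝ => fderiv ℝ r (u, 0) (0, 1)) (g := fun _ => 0)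
      (hcc.comp (by fun_prop : Continuous fun u : ℝ => (u, (0:ℝ)))).continuousAt continuousAt_const ?_
    filter_upwards [punct_ne u 0] with u hu
    have := desc_A hr hF (c := 0) (c' := -u) (by simpa using hu)
    have e : UU 0 (-u) = u := by
      unfold UU
      rw [zero_add, div_eq_iff (neg_ne_zero.2 hu)]; ring
    rw [e] at this
    simpa using this
  obtain ⟨g, hg, hg'⟩ := hadamard_graph_zero hc (φ := fun _ => 0) contDiff_const z1
  simp only [sub_zero] at hg'
  have hgc := hg.continuous
  have z2 : ∀ u, g (u, -2 / 3 * u) = 0 := by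
    intro u
    refine eq_of_punctured (f := fun u : ℝ => g (u, -2 / 3 * u)) (g := fun _ => 0)
      (by fun_prop) continuousAt_const ?_
    filter_upwards [punct_ne u 0] with u hu
    have := desc_A hr hF (c := -2 / 3 * u) (c' := u / 3) (by
      intro h; apply hu; linarith)
    have e : UU (-2 / 3 * u) (u / 3) = u := by
      unfold UU
      rw [show -2 / 3 * u + u / 3 = -(u/3) by ring]
      field_simp; ring
    rw [e, hg'] at this
    rw [show -2 / 3 * u + 2 * (u / 3) = 0 by ring] at this
    simp at this
    tauto
  obtain ⟨g2, hg2, hg2'⟩ := hadamard_graph_zero hg (φ := fun u => -2 / 3 * u) (contDiff_const.mul contDiff_id) z2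
  refine ⟨fun z => (1 / 3) * g2 z, contDiff_const.mul hg2, fun u c => ?_⟩
  rw [hg', hg2']; ring

theorem desc_r1_eq {r r1 : R2 → ℝ} (hr : Sm r) (hF : FC r) (h1 : Sm r1)
    (h : ∀ u c, fderiv ℝ r (u, c) (0, 1) = c * (3 * c + 2 * u) * r1 (u, c)) {c c' : ℝ} (hc : c + c' ≠ 0) :
    (c ^ 2 - c' ^ 2) * r1 (UU c c', c) =
      fderiv ℝ r (UU c c', c) (1, 0) - fderiv ℝ r (UU c c', c') (1, 0) := by
  have hu := (sm_dir hr (1, 0)).continuous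
  have h1c := h1.continuous
  have hU : ContinuousAt (fun c => UU c c') c := (UU_hasDerivAt hc).continuousAt
  refine eq_of_punctured (f := fun c => (c ^ 2 - c' ^ 2) * r1 (UU c c', c))
    (g := fun c => fderiv ℝ r (UU c c', c) (1, 0) - fderiv ℝ r (UU c c', c') (1, 0)) ?_ ?_ ?_
  · exact (by fun_prop : ContinuousAt (fun c : ℝ => c ^ 2 - c' ^ 2) c).mul
      (h1c.continuousAt.comp (hU.prodMk continuousAt_id))
  · exact (hu.continuousAt.comp (f := fun c => (UU c c', c)) (hU.prodMk continuousAt_id)).sub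
      (hu.continuousAt.comp (f := fun c => (UU c c', c')) (hU.prodMk continuousAt_const))
  · have : ∀ᶠ x in 𝓝[≠] c, x + c' ≠ 0 :=
      ((continuous_id.add continuous_const).continuousAt.eventually_ne hc).filter_mono nhdsWithin_le_nhds
    filter_upwards [this, punct_ne c 0, punct_ne c (-2 * c')] with x hx hx0 hx2
    have hA := desc_A hr hF hx
    rw [h] at hA
    have e : 3 * x + 2 * UU x c' = (x - c') * (x + 2 * c') / (x + c') := by
      unfold UU; field_simp; ring
    have hx2' : x + 2 * c' ≠ 0 := fun h => hx2 (by linarith)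
    rw [e] at hA
    have hk : x * (x + 2 * c') ≠ 0 := mul_ne_zero hx0 hx2'
    refine mul_left_cancel₀ hk ?_
    field_simp at hA
    linear_combination x * hA

theorem desc_step {r : R2 → ℝ} (hr : Sm r) (hF : FC r) :
    ∃ r1 S : R2 → ℝ, Sm r1 ∧ Sm S ∧ FC r1 ∧ FC S ∧
      (∀ u c, fderiv ℝ r (u, c) (0, 1) = c * (3 * c + 2 * u) * r1 (u, c)) ∧
      (∀ u c, fderiv ℝ r (u, c) (1, 0) = S (u, c) + c ^ 2 * r1 (u, c)) := by
  obtain ⟨r1, h1, h⟩ := desc_r1 hr hF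
  have hu := sm_dir hr (1, 0)
  have key : ∀ c c', c ≠ c' → c + c' ≠ 0 → r1 (UU c c', c) = r1 (UU c c', c') := by
    intro c c' hne hc
    have a := desc_r1_eq hr hF h1 h hc
    have b := desc_r1_eq hr hF h1 h (c := c') (c' := c) (by rwa [add_comm])
    rw [UU_symm c' c] at b
    have : (c ^ 2 - c' ^ 2) ≠ 0 := by
      rw [sq_sub_sq]; exact mul_ne_zero hc (sub_ne_zero.2 hne)
    refine mul_left_cancel₀ this ?_
    linear_combination a + b
  refine ⟨r1, fun z => fderiv ℝ r z (1, 0) - z.2 ^ 2 * r1 z, h1,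
    hu.sub ((contDiff_snd.pow 2).mul h1), ?_, ?_, h, fun u c => by simp⟩
  · intro u c c' hP
    by_cases hne : c = c'
    · rw [hne]
    obtain ⟨hc, rfl⟩ := eq_UU hP hne
    exact key c c' hne hc
  · intro u c c' hP
    by_cases hne : c = c'
    · rw [hne]
    obtain ⟨hc, rfl⟩ := eq_UU hP hne
    have a := desc_r1_eq hr hF h1 h hc
    have b := key c c' hne hc
    simp only
    linear_combination (-c' ^ 2) * b - a

theorem exists_pos_root (u v : ℝ) (hv : 0 < v) : ∃ c, 0 < c ∧ PP u c = v := by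
  have hM : (0:ℝ) ≤ 1 + |u| + v := by positivity
  have := intermediate_value_Icc hM (f := fun c => PP u c) (by unfold PP; fun_prop)
  have hmem : v ∈ Set.Icc (PP u 0) (PP u (1 + |u| + v)) := by
    constructor
    · unfold PP; simp; exact hv.le
    · have h1 : 1 + v ≤ 1 + |u| + v + u := by linarith [neg_abs_le u]
      have h2 : 1 ≤ (1 + |u| + v) ^ 2 := by
        have := abs_nonneg u
        nlinarith
      have : PP u (1 + |u| + v) = (1 + |u| + v) ^ 2 * (1 + |u| + v + u) := by unfold PP; ring
      rw [this]; nlinarith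
  obtain ⟨c, hc, hcv⟩ := this hmem
  refine ⟨c, lt_of_le_of_ne hc.1 ?_, hcv⟩
  rintro rfl
  simp [PP] at hcv; linarith

theorem exists_neg_root (u v : ℝ) (hv : v < 0) : ∃ c, c < 0 ∧ PP u c = v := by
  obtain ⟨c, hc, h⟩ := exists_pos_root (-u) (-v) (by linarith)
  refine ⟨-c, by linarith, ?_⟩
  unfold PP at *; linear_combination -h

theorem exists_root (u v : ℝ) : ∃ c, PP u c = v := by
  rcases lt_trichotomy v 0 with h | h | h
  · exact (exists_neg_root u v h).imp fun _ h => h.2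
  · exact ⟨0, by simp [PP, h]⟩
  · exact (exists_pos_root u v h).imp fun _ h => h.2

noncomputable def desc (r : R2 → ℝ) (z : R2) : ℝ := r (z.1, (exists_root z.1 z.2).choose)

theorem desc_eq {r : R2 → ℝ} (hF : FC r) (u c : ℝ) : desc r (u, PP u c) = r (u, c) :=
  hF _ _ _ (exists_root u (PP u c)).choose_spec

def ff (z : R2) : R2 := (z.1, PP z.1 z.2)

theorem ff_cont : Continuous ff := by unfold ff PP; fun_prop

theorem ff_quot : IsQuotientMap ff := by
  have hp : IsProperMap ff := by
    refine isProperMap_iff_isCompact_preimage.2 ⟨ff_cont, fun K hK => ?_⟩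
    refine Metric.isCompact_of_isClosed_isBounded (hK.isClosed.preimage ff_cont) ?_
    obtain ⟨M, hM⟩ := hK.isBounded.exists_norm_le
    refine (Metric.isBounded_iff_subset_closedBall 0).2 ⟨|M| + 1, ?_⟩
    rintro ⟨u, c⟩ h
    have h1 := hM _ h
    have h2 := (norm_fst_le _).trans h1
    have h3 := (norm_snd_le _).trans h1
    simp only [ff, Real.norm_eq_abs] at h2 h3
    rw [mem_closedBall_zero_iff, Prod.norm_def, sup_le_iff]
    simp only [Real.norm_eq_abs]
    have hMM := le_abs_self M
    refine ⟨by linarith, ?_⟩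
    by_contra hlt
    push Not at hlt
    have e : PP u c = c ^ 2 * (c + u) := by unfold PP; ring
    rw [e, abs_mul, abs_pow] at h3
    have h4 : 1 ≤ |c + u| := by
      have : |c| ≤ |c + u| + |u| := by
        have := abs_sub (c + u) u
        simpa using this
      linarith
    have := abs_nonneg M
    nlinarith
  refine hp.isClosedMap.isQuotientMap ff_cont ?_
  rintro ⟨u, v⟩
  obtain ⟨c, hc⟩ := exists_root u v
  exact ⟨(u, c), by simp [ff, hc]⟩

theorem desc_cont {r : R2 → ℝ} (hr : Continuous r) (hF : FC r) : Continuous (desc r) := by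
  rw [ff_quot.continuous_iff]
  have : desc r ∘ ff = r := by
    funext ⟨u, c⟩
    exact desc_eq hF u c
  rwa [this]

theorem PP_hasDerivAt (u c : ℝ) : HasDerivAt (fun c => PP u c) (c * (3 * c + 2 * u)) c := by
  have := ((hasDerivAt_id c).pow 3).add (((hasDerivAt_id c).pow 2).const_mul u)
  refine this.congr_deriv ?_
  simp; ring

theorem FTC' {g : ℝ → ℝ} (hg : Continuous g) (x : ℝ) :
    HasDerivAt (fun x => ∫ t in (0:ℝ)..x, g t) (g x) x :=
  intervalIntegral.integral_hasDerivAt_right (hg.intervalIntegrable _ _)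
    (hg.stronglyMeasurableAtFilter _ _) hg.continuousAt

theorem desc_dv {r r1 : R2 → ℝ} (hr : Sm r) (hF : FC r) (h1 : Sm r1) (hF1 : FC r1)
    (h : ∀ u c, fderiv ℝ r (u, c) (0, 1) = c * (3 * c + 2 * u) * r1 (u, c)) (u v : ℝ) :
    HasDerivAt (fun v => desc r (u, v)) (desc r1 (u, v)) v := by
  have hc1 := desc_cont h1.continuous hF1
  have hcu : Continuous (fun w => desc r1 (u, w)) := by fun_prop
  have hd : ∀ c, HasDerivAt (fun c => r (u, c) - ∫ t in (0:ℝ)..(PP u c), desc r1 (u, t)) 0 c := by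
    intro c
    have a := hasDerivAt_comp2 hr (hasDerivAt_const c u) (hasDerivAt_id c)
    have b := (FTC' hcu (PP u c)).comp c (PP_hasDerivAt u c)
    refine (a.sub b).congr_deriv ?_
    simp only [id]
    rw [h, desc_eq hF1]; ring
  have hconst : ∀ c, r (u, c) - ∫ t in (0:ℝ)..(PP u c), desc r1 (u, t) =
      r (u, 0) - ∫ t in (0:ℝ)..(PP u 0), desc r1 (u, t) := fun c =>
    is_const_of_deriv_eq_zero (fun c => (hd c).differentiableAt) (fun c => (hd c).deriv) c 0
  have e : (fun v => desc r (u, v)) = fun v => r (u, 0) + ∫ t in (0:ℝ)..v, desc r1 (u, t) := by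
    funext v
    obtain ⟨c, rfl⟩ := exists_root u v
    rw [desc_eq hF]
    have := hconst c
    simp [PP] at this ⊢
    linarith
  rw [e]
  exact (FTC' hcu v).const_add _

theorem desc_du {r r1 S : R2 → ℝ} (hr : Sm r) (hF : FC r) (hS : Sm S) (hFS : FC S)
    (h : ∀ u c, fderiv ℝ r (u, c) (0, 1) = c * (3 * c + 2 * u) * r1 (u, c))
    (h' : ∀ u c, fderiv ℝ r (u, c) (1, 0) = S (u, c) + c ^ 2 * r1 (u, c)) (u v : ℝ) :
    HasDerivAt (fun u => desc r (u, v)) (desc S (u, v)) u := by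
  have hcS := desc_cont hS.continuous hFS
  have hcu : Continuous (fun w => desc S (w, v)) := by fun_prop
  have main : ∀ I : Set ℝ, IsOpen I → IsPreconnected I → (∀ c ∈ I, c ≠ 0) →
      (∀ u, ∃ c ∈ I, PP u c = v) → HasDerivAt (fun u => desc r (u, v)) (desc S (u, v)) u := by
    intro I hI hI' hI0 hIr
    let W : ℝ → ℝ := fun c => (v - c ^ 3) / c ^ 2
    have hPW : ∀ c, c ≠ 0 → PP (W c) c = v := by
      intro c hc; simp only [PP, W]; field_simp; ring
    have hW : ∀ c, c ≠ 0 → HasDerivAt W (-(c * (3 * c + 2 * W c)) / c ^ 2) c := by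
      intro c hc
      have := (((hasDerivAt_id c).pow 3).const_sub v).div ((hasDerivAt_id c).pow 2) (pow_ne_zero 2 hc)
      refine this.congr_deriv ?_
      simp [W]; field_simp; ring
    have hd : ∀ c ∈ I, HasDerivAt (fun c => r (W c, c) - ∫ t in (0:ℝ)..(W c), desc S (t, v)) 0 c := by
      intro c hcI
      have hc := hI0 c hcI
      have a := hasDerivAt_comp2 hr (hW c hc) (hasDerivAt_id c)
      have b := (FTC' hcu (W c)).comp c (hW c hc)
      refine (a.sub b).congr_deriv ?_
      simp only [id]
      have e : desc S (W c, v) = S (W c, c) := by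
        rw [← desc_eq hFS, hPW c hc]
      rw [h, h', e]; field_simp; ring
    obtain ⟨c0, hc0, -⟩ := hIr 0
    have hconst : ∀ c ∈ I, r (W c, c) - ∫ t in (0:ℝ)..(W c), desc S (t, v) =
        r (W c0, c0) - ∫ t in (0:ℝ)..(W c0), desc S (t, v) := fun c hc =>
      hI.is_const_of_deriv_eq_zero hI' (fun c hc => (hd c hc).differentiableAt.differentiableWithinAt)
        (fun c hc => (hd c hc).deriv) hc hc0
    have e : (fun u => desc r (u, v)) = fun u => (r (W c0, c0) - ∫ t in (0:ℝ)..(W c0), desc S (t, v))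
        + ∫ t in (0:ℝ)..u, desc S (t, v) := by
      funext u
      obtain ⟨c, hc, hcv⟩ := hIr u
      have hne := hI0 c hc
      have hu : W c = u := by
        simp only [W]; rw [← hcv]; unfold PP; field_simp; ring
      have := hconst c hc
      rw [hu] at this
      rw [← this, ← hcv, desc_eq hF]; ring
    rw [e]
    exact (FTC' hcu u).const_add _
  rcases lt_trichotomy v 0 with hv | hv | hv
  · exact main (Set.Iio 0) isOpen_Iio isPreconnected_Iio (fun c hc => ne_of_lt hc)
      (fun u => exists_neg_root u v hv)
  · have e : ∀ {q : R2 → ℝ}, FC q → ∀ u, desc q (u, v) = q (u, 0) := by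
      intro q hq u
      have : v = PP u 0 := by simp [PP, hv]
      rw [this, desc_eq hq]
    rw [show (fun u => desc r (u, v)) = fun u => r (u, 0) from funext fun u => e hF u, e hFS]
    have := hasDerivAt_comp2 hr (hasDerivAt_id u) (hasDerivAt_const u (0:ℝ))
    refine this.congr_deriv ?_
    simp [h']
  · exact main (Set.Ioi 0) isOpen_Ioi isPreconnected_Ioi (fun c hc => ne_of_gt hc)
      (fun u => exists_pos_root u v hv)

theorem desc_contDiff (n : ℕ) : ∀ r : R2 → ℝ, Sm r → FC r → ContDiff ℝ n (desc r) := by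
  induction n with
  | zero => intro r hr hF; exact contDiff_zero.2 (desc_cont hr.continuous hF)
  | succ n ih =>
    intro r hr hF
    obtain ⟨r1, S, h1, hS, hF1, hFS, e1, e2⟩ := desc_step hr hF
    have a := ih r1 h1 hF1
    have b := ih S hS hFS
    have ca := desc_cont h1.continuous hF1
    have cb := desc_cont hS.continuous hFS
    push_cast
    rw [contDiff_succ_iff_hasFDerivAt]
    let f1 : ℝ → ℝ → (ℝ →L[ℝ] ℝ) := fun u v => ContinuousLinearMap.toSpanSingleton ℝ (desc S (u, v))
    let f2 : ℝ → ℝ → (ℝ →L[ℝ] ℝ) := fun u v => ContinuousLinearMap.toSpanSingleton ℝ (desc r1 (u, v))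
    refine ⟨fun z => desc S z • ContinuousLinearMap.fst ℝ ℝ ℝ + desc r1 z • ContinuousLinearMap.snd ℝ ℝ ℝ,
      by fun_prop, fun z => ?_⟩
    have hh := hasStrictFDerivAt_uncurry_coprod (𝕜 := ℝ) (u := z) (f := fun u v => desc r (u, v))
      (f₁ := f1) (f₂ := f2)
      (Eventually.of_forall fun w => (desc_du hr hF hS hFS e1 e2 w.1 w.2).hasFDerivAt)
      (Eventually.of_forall fun w => (desc_dv hr hF h1 hF1 e1 w.1 w.2).hasFDerivAt)
      (by
        have : Continuous (fun z : R2 => ContinuousLinearMap.toSpanSingleton ℝ (desc S z)) :=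
          (ContinuousLinearMap.toSpanSingletonCLE (𝕜 := ℝ) (E := ℝ)).continuous.comp cb
        exact this.continuousAt)
      (by
        have : Continuous (fun z : R2 => ContinuousLinearMap.toSpanSingleton ℝ (desc r1 z)) :=
          (ContinuousLinearMap.toSpanSingletonCLE (𝕜 := ℝ) (E := ℝ)).continuous.comp ca
        exact this.continuousAt)
    refine HasFDerivAt.congr_fderiv hh.hasFDerivAt ?_
    apply ContinuousLinearMap.ext
    rintro ⟨x, y⟩
    simp [f1, f2, Function.HasUncurry.uncurry, mul_comm]

theorem descent {r : R2 → ℝ} (hr : Sm r) (hF : FC r) :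
    ∃ R : R2 → ℝ, Sm R ∧ ∀ u c, R (u, PP u c) = r (u, c) :=
  ⟨desc r, contDiff_infty.2 fun n => desc_contDiff n r hr hF, desc_eq hF⟩

end UM

namespace UM

theorem three_pts {A0 A1 A2 x y z : ℝ} (hxy : x ≠ y) (hxz : x ≠ z) (hyz : y ≠ z)
    (h1 : A0 + A1 * x + A2 * x ^ 2 = 0) (h2 : A0 + A1 * y + A2 * y ^ 2 = 0)
    (h3 : A0 + A1 * z + A2 * z ^ 2 = 0) : A0 = 0 ∧ A1 = 0 ∧ A2 = 0 := by
  have a : A1 + A2 * (x + y) = 0 := mul_left_cancel₀ (sub_ne_zero.2 hxy) (by linear_combination h1 - h2)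
  have b : A1 + A2 * (x + z) = 0 := mul_left_cancel₀ (sub_ne_zero.2 hxz) (by linear_combination h1 - h3)
  have c : A2 = 0 := mul_left_cancel₀ (sub_ne_zero.2 hyz) (by linear_combination a - b)
  subst c
  have d : A1 = 0 := by linarith
  subst d
  exact ⟨by linarith, rfl, rfl⟩

theorem FC_of_interp {H r0 r1 r2 : R2 → ℝ} (h0 : Continuous r0) (h1 : Continuous r1) (h2 : Continuous r2)
    (hc : ∀ u c, r0 (u, c) + r1 (u, c) * c + r2 (u, c) * c ^ 2 = H (u, c))
    (hx : ∀ u c x, x ^ 2 + (u + c) * x + c * (u + c) = 0 →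
      r0 (u, c) + r1 (u, c) * x + r2 (u, c) * x ^ 2 = H (u, x)) :
    FC r0 ∧ FC r1 ∧ FC r2 := by
  have gen : ∀ c c', c' ≠ 0 → c ≠ 0 → c ≠ c' → c + c' ≠ 0 → c ≠ -2 * c' → c ≠ - c' / 2 →
      r0 (UU c c', c) = r0 (UU c c', c') ∧ r1 (UU c c', c) = r1 (UU c c', c') ∧
      r2 (UU c c', c) = r2 (UU c c', c') := by
    intro c c' hc'0 hc0 hne hs h3 h4
    set u := UU c c' with hu
    have hus : u * (c + c') = -(c ^ 2 + c * c' + c' ^ 2) := by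
      rw [hu]; unfold UU; field_simp
    set x := -u - c - c' with hxdef
    have hxs : x * (c + c') = -(c * c') := by rw [hxdef]; linear_combination -hus
    have hxc : c ≠ x := by
      intro h
      rw [← h] at hxs
      have : c * (c + 2 * c') = 0 := by linear_combination hxs
      rcases mul_eq_zero.1 this with h | h
      · exact hc0 h
      · exact h3 (by linarith)
    have hxc' : c' ≠ x := by
      intro h
      rw [← h] at hxs
      have : c' * (2 * c + c') = 0 := by linear_combination hxs
      rcases mul_eq_zero.1 this with h | h
      · exact hc'0 h
      · exact h4 (by linarith)
    have q1 : c' ^ 2 + (u + c) * c' + c * (u + c) = 0 := by linear_combination hus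
    have q2 : c ^ 2 + (u + c') * c + c' * (u + c') = 0 := by linear_combination hus
    have q3 : x ^ 2 + (u + c) * x + c * (u + c) = 0 := by rw [hxdef]; linear_combination hus
    have q4 : x ^ 2 + (u + c') * x + c' * (u + c') = 0 := by rw [hxdef]; linear_combination hus
    have := three_pts (A0 := r0 (u, c) - r0 (u, c')) (A1 := r1 (u, c) - r1 (u, c'))
      (A2 := r2 (u, c) - r2 (u, c')) hne hxc hxc'
      (by linear_combination hc u c - hx u c' c q2) (by linear_combination hx u c c' q1 - hc u c')
      (by linear_combination hx u c x q3 - hx u c' x q4)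
    exact ⟨sub_eq_zero.1 this.1, sub_eq_zero.1 this.2.1, sub_eq_zero.1 this.2.2⟩
  have dens : ∀ q : R2 → ℝ, Continuous q → (∀ c c', c' ≠ 0 → c ≠ 0 → c ≠ c' → c + c' ≠ 0 →
      c ≠ -2 * c' → c ≠ - c' / 2 → q (UU c c', c) = q (UU c c', c')) → FC q := by
    intro q hq hgen
    have X : ∀ c c', c' ≠ 0 → c + c' ≠ 0 → q (UU c c', c) = q (UU c c', c') := by
      intro c c' hc' hs
      have hU : ContinuousAt (fun c => UU c c') c := (UU_hasDerivAt hs).continuousAt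
      refine eq_of_punctured (f := fun c => q (UU c c', c)) (g := fun c => q (UU c c', c'))
        (hq.continuousAt.comp (hU.prodMk continuousAt_id))
        (hq.continuousAt.comp (f := fun c => (UU c c', c')) (hU.prodMk continuousAt_const)) ?_
      filter_upwards [punct_ne c 0, punct_ne c c', punct_ne c (-c'), punct_ne c (-2 * c'),
        punct_ne c (-c' / 2)] with x a1 a2 a3 a4 a5
      exact hgen x c' hc' a1 a2 (fun h => a3 (by linarith)) a4 a5
    intro u c c' hP
    by_cases hne : c = c'
    · rw [hne]
    obtain ⟨hs, rfl⟩ := eq_UU hP hne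
    by_cases h0 : c' = 0
    · have := X c' c (by rintro rfl; exact hne h0.symm) (by rwa [add_comm])
      rw [UU_symm c' c] at this
      exact this.symm
    · exact X c c' h0 hs
  exact ⟨dens r0 h0 fun c c' a b d e f g => (gen c c' a b d e f g).1,
    dens r1 h1 fun c c' a b d e f g => (gen c c' a b d e f g).2.1,
    dens r2 h2 fun c c' a b d e f g => (gen c c' a b d e f g).2.2⟩

theorem preparation {H : R2 → ℝ} (hH : Sm H) :
    ∃ a0 a1 a2 : R2 → ℝ, Sm a0 ∧ Sm a1 ∧ Sm a2 ∧ ∀ u x,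
      H (u, x) = a0 (u, PP u x) + a1 (u, PP u x) * x + a2 (u, PP u x) * x ^ 2 := by
  let h : R3 → ℝ := fun z => ∫ s in (0:ℝ)..1,
    fderiv ℝ H (z.2.1, z.2.2 + s * (z.1 - (z.2.1 + z.2.2) / 2 - z.2.2)) (0, 1)
  have hh : Sm h := by
    refine sm_param (fun q : R3 × ℝ =>
      fderiv ℝ H (q.1.2.1, q.1.2.2 + q.2 * (q.1.1 - (q.1.2.1 + q.1.2.2) / 2 - q.1.2.2)) (0, 1)) ?_
    exact (sm_dir hH (0, 1)).comp (f := fun q : R3 × ℝ =>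
      (q.1.2.1, q.1.2.2 + q.2 * (q.1.1 - (q.1.2.1 + q.1.2.2) / 2 - q.1.2.2))) (by fun_prop)
  have hseg : ∀ u c x, H (u, x) = H (u, c) + (x - c) * h (x + (u + c) / 2, (u, c)) := by
    intro u c x
    have := segment_formula hH (u, c) (0, 1) (x - c)
    simp only [Prod.smul_mk, smul_eq_mul, mul_zero, mul_one, Prod.mk_add_mk, add_zero,
      add_sub_cancel] at this
    rw [this]
    simp only [h]
    congr 3
    funext s
    congr 3
    ring
  obtain ⟨a, b, ha, hb, hab⟩ := even_odd hh
  let δ : R2 → R3 := fun z => ((z.1 + z.2) * (z.1 - 3 * z.2) / 4, z)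
  have hδ : ContDiff ℝ (⊤ : ℕ∞) δ := by unfold δ; fun_prop
  let α : R2 → ℝ := fun z => a (δ z)
  let β : R2 → ℝ := fun z => b (δ z)
  have hα : Sm α := ha.comp hδ
  have hβ : Sm β := hb.comp hδ
  let r2 := β
  let r1 : R2 → ℝ := fun z => α z + ((z.1 + z.2) / 2 - z.2) * β z
  let r0 : R2 → ℝ := fun z => H z - z.2 * α z - z.2 * ((z.1 + z.2) / 2) * β z
  have s1 : Sm r1 := hα.add (ContDiff.mul (by fun_prop) hβ)
  have s0 : Sm r0 := (hH.sub (contDiff_snd.mul hα)).sub (ContDiff.mul (by fun_prop) hβ)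
  have hc : ∀ u c, r0 (u, c) + r1 (u, c) * c + r2 (u, c) * c ^ 2 = H (u, c) := by
    intro u c; simp only [r0, r1, r2]; ring
  have hx : ∀ u c x, x ^ 2 + (u + c) * x + c * (u + c) = 0 →
      r0 (u, c) + r1 (u, c) * x + r2 (u, c) * x ^ 2 = H (u, x) := by
    intro u c x hq
    have e : (x + (u + c) / 2) ^ 2 = (u + c) * (u - 3 * c) / 4 := by linear_combination hq
    have := hab (x + (u + c) / 2) (u, c) (by
      rw [e]; simp only; nlinarith [sq_nonneg (u + c), sq_nonneg u, sq_nonneg c])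
    rw [e] at this
    rw [hseg u c x, this]
    simp only [r0, r1, r2, α, β, δ]; ring
  obtain ⟨F0, F1, F2⟩ := FC_of_interp s0.continuous s1.continuous hβ.continuous hc hx
  obtain ⟨a0, ha0, e0⟩ := descent s0 F0
  obtain ⟨a1, ha1, e1⟩ := descent s1 F1
  obtain ⟨a2, ha2, e2⟩ := descent hβ F2
  refine ⟨a0, a1, a2, ha0, ha1, ha2, fun u x => ?_⟩
  rw [e0, e1, e2, ← hc u x]

end UM

namespace UM

theorem poly_step {A : ℝ} {g : ℝ → ℝ} (hg : ContinuousAt g 0)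
    (h : ∀ᶠ X in 𝓝[≠] (0:ℝ), A + X * g X = 0) : A = 0 ∧ ∀ᶠ X in 𝓝[≠] (0:ℝ), g X = 0 := by
  have hA : A = 0 := by
    have := eq_of_punctured (f := fun X => A + X * g X) (g := fun _ => 0) (a := 0)
      (continuousAt_const.add (continuousAt_id.mul hg)) continuousAt_const h
    simpa using this
  refine ⟨hA, ?_⟩
  filter_upwards [h, self_mem_nhdsWithin] with X hX h0
  rw [hA, zero_add] at hX
  exact (mul_eq_zero.1 hX).resolve_left h0

theorem poly_zero {A0 A1 A2 A3 A4 A5 : ℝ} {q : ℝ → ℝ} (hq : ContinuousAt q 0)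
    (h : ∀ᶠ X in 𝓝[≠] (0:ℝ), A0 + A1 * X + A2 * X ^ 2 + A3 * X ^ 3 + A4 * X ^ 4 + A5 * X ^ 5
      + X ^ 6 * q X = 0) :
    A0 = 0 ∧ A1 = 0 ∧ A2 = 0 ∧ A3 = 0 ∧ A4 = 0 ∧ A5 = 0 ∧ ∀ᶠ X in 𝓝[≠] (0:ℝ), q X = 0 := by
  have c5 : ContinuousAt (fun X => A5 + X * q X) 0 := continuousAt_const.add (continuousAt_id.mul hq)
  have c4 : ContinuousAt (fun X => A4 + X * (A5 + X * q X)) 0 :=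
    continuousAt_const.add (continuousAt_id.mul c5)
  have c3 : ContinuousAt (fun X => A3 + X * (A4 + X * (A5 + X * q X))) 0 :=
    continuousAt_const.add (continuousAt_id.mul c4)
  have c2 : ContinuousAt (fun X => A2 + X * (A3 + X * (A4 + X * (A5 + X * q X)))) 0 :=
    continuousAt_const.add (continuousAt_id.mul c3)
  have c1 : ContinuousAt (fun X => A1 + X * (A2 + X * (A3 + X * (A4 + X * (A5 + X * q X))))) 0 :=
    continuousAt_const.add (continuousAt_id.mul c2)
  obtain ⟨a0, h⟩ := poly_step (A := A0) c1 (h.mono fun X hX => by linear_combination hX)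
  obtain ⟨a1, h⟩ := poly_step c2 h
  obtain ⟨a2, h⟩ := poly_step c3 h
  obtain ⟨a3, h⟩ := poly_step c4 h
  obtain ⟨a4, h⟩ := poly_step c5 h
  obtain ⟨a5, h⟩ := poly_step hq h
  exact ⟨a0, a1, a2, a3, a4, a5, h⟩

theorem poly_zero4 {A0 A1 A2 A3 A4 : ℝ} {q : ℝ → ℝ} (hq : ContinuousAt q 0)
    (h : ∀ᶠ X in 𝓝[≠] (0:ℝ), A0 + A1 * X + A2 * X ^ 2 + A3 * X ^ 3 + A4 * X ^ 4
      + X ^ 5 * q X = 0) :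
    A0 = 0 ∧ A1 = 0 ∧ A2 = 0 ∧ A3 = 0 ∧ A4 = 0 := by
  have c4 : ContinuousAt (fun X => A4 + X * q X) 0 := continuousAt_const.add (continuousAt_id.mul hq)
  have c3 : ContinuousAt (fun X => A3 + X * (A4 + X * q X)) 0 :=
    continuousAt_const.add (continuousAt_id.mul c4)
  have c2 : ContinuousAt (fun X => A2 + X * (A3 + X * (A4 + X * q X))) 0 :=
    continuousAt_const.add (continuousAt_id.mul c3)
  have c1 : ContinuousAt (fun X => A1 + X * (A2 + X * (A3 + X * (A4 + X * q X)))) 0 :=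
    continuousAt_const.add (continuousAt_id.mul c2)
  obtain ⟨a0, h⟩ := poly_step (A := A0) c1 (h.mono fun X hX => by linear_combination hX)
  obtain ⟨a1, h⟩ := poly_step c2 h
  obtain ⟨a2, h⟩ := poly_step c3 h
  obtain ⟨a3, h⟩ := poly_step c4 h
  obtain ⟨a4, h⟩ := poly_step hq h
  exact ⟨a0, a1, a2, a3, a4⟩

noncomputable def Ap (u x : ℝ) : ℝ := PP u x * x + u ^ 2 / 9 * x ^ 2
noncomputable def Bp (u x : ℝ) : ℝ := (PP u x - 4 / 27 * u ^ 3) * x ^ 2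

theorem core {H : R2 → ℝ} (hH : Sm H)
    (hd0 : ∀ᶠ u in 𝓝 (0:ℝ), fderiv ℝ H (u, 0) (0, 1) = 0)
    (hd1 : ∀ᶠ u in 𝓝 (0:ℝ), fderiv ℝ H (u, -2 / 3 * u) (0, 1) = 0) :
    ∃ b0 b1 b2 : R2 → ℝ, Sm b0 ∧ Sm b1 ∧ Sm b2 ∧ ∀ᶠ u in 𝓝 (0:ℝ), ∀ x,
      H (u, x) = b0 (u, PP u x) + b1 (u, PP u x) * Ap u x + b2 (u, PP u x) * Bp u x := by
  obtain ⟨a0, a1, a2, ha0, ha1, ha2, e⟩ := preparation hH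
  have hder : ∀ u x, fderiv ℝ H (u, x) (0, 1) =
      x * (3 * x + 2 * u) * (fderiv ℝ a0 (u, PP u x) (0, 1) + fderiv ℝ a1 (u, PP u x) (0, 1) * x
        + fderiv ℝ a2 (u, PP u x) (0, 1) * x ^ 2) + a1 (u, PP u x) + 2 * x * a2 (u, PP u x) := by
    intro u x
    have k : ∀ {a : R2 → ℝ}, Sm a → HasDerivAt (fun x => a (u, PP u x))
        (x * (3 * x + 2 * u) * fderiv ℝ a (u, PP u x) (0, 1)) x := by
      intro a ha
      refine (hasDerivAt_comp2 ha (hasDerivAt_const x u) (PP_hasDerivAt u x)).congr_deriv ?_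
      ring
    have h1 := ((k ha0).add ((k ha1).mul (hasDerivAt_id x))).add
      ((k ha2).mul ((hasDerivAt_id x).pow 2))
    have h2 := hasDerivAt_comp2 hH (hasDerivAt_const x u) (hasDerivAt_id x)
    have h3 : (fun x => H (u, id x)) = (fun x => a0 (u, PP u x)) + (fun x => a1 (u, PP u x)) * id
        + (fun x => a2 (u, PP u x)) * id ^ 2 := by
      funext x; simp [e]
    rw [h3] at h2
    have h4 := h2.unique h1
    simp at h4
    rw [h4]; ring
  obtain ⟨b1, hb1, e1⟩ := hadamard_graph ha1 (φ := fun _ => 0) contDiff_const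
  simp only [sub_zero] at e1
  obtain ⟨b2, hb2, e2⟩ := hadamard_graph (f := fun z => a2 z - z.1 ^ 2 / 9 * b1 z)
    (ha2.sub (ContDiff.mul (by fun_prop) hb1)) (φ := fun u => 4 / 27 * u ^ 3)
    (contDiff_const.mul (contDiff_id.pow 3))
  have z1 : ∀ᶠ u in 𝓝 (0:ℝ), a1 (u, 0) = 0 := by
    filter_upwards [hd0] with u hu
    rw [hder] at hu
    simpa [PP] using hu
  have z2 : ∀ᶠ u in 𝓝[≠] (0:ℝ), a2 (u, 4 / 27 * u ^ 3) - u ^ 2 / 9 * b1 (u, 4 / 27 * u ^ 3) = 0 := by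
    filter_upwards [hd1.filter_mono nhdsWithin_le_nhds, z1.filter_mono nhdsWithin_le_nhds,
      self_mem_nhdsWithin] with u hu hz h0
    have h0 : u ≠ 0 := h0
    rw [hder] at hu
    have hP : PP u (-2 / 3 * u) = 4 / 27 * u ^ 3 := by unfold PP; ring
    rw [hP, show 3 * (-2 / 3 * u) + 2 * u = 0 by ring, e1, hz] at hu
    refine mul_left_cancel₀ h0 ?_
    linear_combination (-3 / 4) * hu
  have z2' : ∀ᶠ u in 𝓝 (0:ℝ), a2 (u, 4 / 27 * u ^ 3) - u ^ 2 / 9 * b1 (u, 4 / 27 * u ^ 3) = 0 := by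
    rw [eventually_nhdsWithin_iff] at z2
    have c2 := ha2.continuous
    have c1 := hb1.continuous
    have h0 := eq_of_punctured (f := fun u : ℝ => a2 (u, 4 / 27 * u ^ 3)
      - u ^ 2 / 9 * b1 (u, 4 / 27 * u ^ 3)) (g := fun _ => 0) (a := 0) (by fun_prop) continuousAt_const
      (by rw [eventually_nhdsWithin_iff]; exact z2)
    filter_upwards [z2] with u hu
    by_cases hu0 : u = 0
    · subst hu0; exact h0
    · exact hu hu0
  refine ⟨a0, b1, b2, ha0, hb1, hb2, ?_⟩
  filter_upwards [z1, z2'] with u h1 h2 x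
  have k1 := e1 u (PP u x)
  have k2 := e2 u (PP u x)
  rw [h1] at k1
  simp only at k2
  rw [h2] at k2
  rw [e, k1]
  unfold Ap Bp
  linear_combination x ^ 2 * k2

abbrev R4 := ℝ × ℝ × ℝ × ℝ

/-- the model components -/
noncomputable def mA (u x : ℝ) : ℝ := (3/4) * x ^ 4 + (2/3) * u * x ^ 3
noncomputable def mD (u x : ℝ) : ℝ := (1/2) * x ^ 6 + (2/5) * u * x ^ 5

theorem core2 {b0 b1 b2 : R2 → ℝ} (h0 : Sm b0) (h1 : Sm b1) (h2 : Sm b2) (hz : b2 (0, 0) = 0) :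
    ∃ Ψ : R4 → ℝ, ∃ β : ℝ → ℝ, Sm Ψ ∧ Sm β ∧ (∀ u, b2 (u, 0) = u * β u) ∧
      (∀ u x, Ψ (u, PP u x, mA u x, mD u x) =
        b0 (u, PP u x) + b1 (u, PP u x) * Ap u x + b2 (u, PP u x) * Bp u x) ∧
      fderiv ℝ Ψ 0 (0, 0, 1, 0) = 4 / 3 * b1 (0, 0) ∧ fderiv ℝ Ψ 0 (0, 0, 0, 1) = -5 / 3 * β 0 := by
  obtain ⟨β', hβ', e1⟩ := hadamard_graph h2 (φ := fun _ => 0) contDiff_const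
  obtain ⟨β, hβ, e2⟩ := hadamard1 (f := fun u => b2 (u, 0)) (h2.comp (contDiff_id.prodMk contDiff_const))
  simp only [sub_zero] at e1
  rw [hz] at e2
  simp only [zero_add] at e2
  let A' : R4 → ℝ := fun z => (4/3) * z.2.2.1 + z.1 * z.2.1 / 9
  let W1 : R4 → ℝ := fun z => (5/6) * (z.2.1 ^ 2 - 2 * z.2.2.2 + (1/5) * z.1 ^ 2 * A' z
    - (1/5) * z.1 ^ 3 * z.2.1)
  let W2 : R4 → ℝ := fun z => A' z ^ 2 - (2/9) * z.1 ^ 2 * z.2.1 ^ 2 + z.1 ^ 5 * z.2.1 / 81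
    - (z.1 ^ 4 / 81) * A' z + (2/27) * z.1 ^ 2 * W1 z
  have sA : ContDiff ℝ (⊤ : ℕ∞) A' := by unfold A'; fun_prop
  have sW1 : ContDiff ℝ (⊤ : ℕ∞) W1 := by unfold W1; fun_prop
  have sW2 : ContDiff ℝ (⊤ : ℕ∞) W2 := by unfold W2; fun_prop
  let pr : R4 → R2 := fun z => (z.1, z.2.1)
  have spr : ContDiff ℝ (⊤ : ℕ∞) pr := by unfold pr; fun_prop
  let Ψ : R4 → ℝ := fun z => b0 (pr z) + b1 (pr z) * A' z + β z.1 * W1 z + β' (pr z) * W2 z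
  have sΨ : Sm Ψ := (((h0.comp spr).add ((h1.comp spr).mul sA)).add
    ((hβ.comp contDiff_fst).mul sW1)).add ((hβ'.comp spr).mul sW2)
  have dline : ∀ (v : R4) (d : ℝ), HasDerivAt (fun t : ℝ => Ψ (t • v)) d 0 → fderiv ℝ Ψ 0 v = d := by
    intro v d hd
    have a : HasDerivAt (fun t : ℝ => t • v) v 0 := by
      simpa using (hasDerivAt_id (0:ℝ)).smul_const v
    have b := (sΨ.hasFDerivAt ((0:ℝ) • v)).comp_hasDerivAt 0 a
    rw [zero_smul] at b
    exact b.unique hd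
  refine ⟨Ψ, β, sΨ, hβ, e2, ?_, ?_, ?_⟩
  · intro u x
    have hA : A' (u, PP u x, mA u x, mD u x) = Ap u x := by
      simp only [A', Ap, PP, mA]; ring
    have hW1 : W1 (u, PP u x, mA u x, mD u x) = u * Bp u x := by
      simp only [W1]; rw [hA]; simp only [Ap, Bp, PP, mD]; ring
    have hW2 : W2 (u, PP u x, mA u x, mD u x) = PP u x * Bp u x := by
      simp only [W2]; rw [hA, hW1]; simp only [Ap, Bp, PP]; ring
    simp only [Ψ]
    rw [hA, hW1, hW2]
    have := e1 u (PP u x)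
    rw [e2] at this
    simp only [pr]
    rw [this]; ring
  · refine dline _ _ ?_
    have : (fun t : ℝ => Ψ (t • ((0, 0, 1, 0) : R4))) =
        fun t => b0 (0, 0) + b1 (0, 0) * (4 / 3 * t) + β' (0, 0) * (16 / 9 * t ^ 2) := by
      funext t
      simp [Ψ, pr, W1, W2, A']
      left; ring
    rw [this]
    have := (((hasDerivAt_id (0:ℝ)).const_mul (4/3)).const_mul (b1 (0,0))).const_add (b0 (0, 0)) |>.add
      ((((hasDerivAt_id (0:ℝ)).pow 2).const_mul (16/9)).const_mul (β' (0,0)))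
    refine this.congr_deriv ?_
    simp; ring
  · refine dline _ _ ?_
    have : (fun t : ℝ => Ψ (t • ((0, 0, 0, 1) : R4))) = fun t => b0 (0, 0) + β 0 * (-5 / 3 * t) := by
      funext t
      simp [Ψ, pr, W1, W2, A']; ring
    rw [this]
    have := (((hasDerivAt_id (0:ℝ)).const_mul (-5/3)).const_mul (β 0)).const_add (b0 (0, 0))
    refine this.congr_deriv ?_
    simp; ring

/-- components 3 and ≥ 5 -/
theorem factor3 {H : R2 → ℝ} (hH : Sm H)
    (hd0 : ∀ᶠ u in 𝓝 (0:ℝ), fderiv ℝ H (u, 0) (0, 1) = 0)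
    (hd1 : ∀ᶠ u in 𝓝 (0:ℝ), fderiv ℝ H (u, -2 / 3 * u) (0, 1) = 0)
    {κ : ℝ} {q : ℝ → ℝ} (hq : ContinuousAt q 0)
    (hX : ∀ᶠ X in 𝓝 (0:ℝ), H (0, X) = κ * X ^ 4 + X ^ 6 * q X) :
    ∃ Ψ : R4 → ℝ, Sm Ψ ∧ (∀ᶠ u in 𝓝 (0:ℝ), ∀ x, H (u, x) = Ψ (u, PP u x, mA u x, mD u x)) ∧
      fderiv ℝ Ψ 0 (0, 0, 1, 0) = 4 / 3 * κ := by
  obtain ⟨b0, b1, b2, h0, h1, h2, e⟩ := core hH hd0 hd1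
  obtain ⟨c0, hc0, k0⟩ := hadamard_graph h0 (φ := fun _ => 0) contDiff_const
  obtain ⟨c00, hc00, k00⟩ := hadamard_graph hc0 (φ := fun _ => 0) contDiff_const
  obtain ⟨c1, hc1, k1⟩ := hadamard_graph h1 (φ := fun _ => 0) contDiff_const
  obtain ⟨c2, hc2, k2⟩ := hadamard_graph h2 (φ := fun _ => 0) contDiff_const
  simp only [sub_zero] at k0 k00 k1 k2
  have s00 := hc00.continuous
  have s1 := hc1.continuous
  have s2 := hc2.continuous
  have hp := poly_zero (A0 := b0 (0,0)) (A1 := 0) (A2 := 0) (A3 := c0 (0, 0)) (A4 := b1 (0, 0) - κ)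
    (A5 := b2 (0, 0)) (q := fun X => c00 (0, X ^ 3) + X * c1 (0, X ^ 3) + X ^ 2 * c2 (0, X ^ 3) - q X)
    (ContinuousAt.sub (by fun_prop) hq) (by
      refine Filter.Eventually.filter_mono nhdsWithin_le_nhds ?_
      filter_upwards [hX] with X hX
      have h := e.self_of_nhds X
      have p : PP 0 X = X ^ 3 := by simp [PP]
      have a : Ap 0 X = X ^ 4 := by simp [Ap, PP]; ring
      have b : Bp 0 X = X ^ 5 := by simp [Bp, PP]; ring
      rw [hX, p, a, b, k0 0 (X ^ 3), k00 0 (X ^ 3), k1 0 (X ^ 3), k2 0 (X ^ 3)] at h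
      linear_combination -h)
  obtain ⟨-, -, -, -, q4, q5, -⟩ := hp
  obtain ⟨Ψ, β, hΨ, -, -, eΨ, d1, -⟩ := core2 h0 h1 h2 q5
  refine ⟨Ψ, hΨ, ?_, ?_⟩
  · filter_upwards [e] with u hu x
    rw [hu, eΨ]
  · rw [d1, sub_eq_zero.1 q4]

/-- component 4 -/
theorem factor4 {H : R2 → ℝ} (hH : Sm H)
    (hd0 : ∀ᶠ u in 𝓝 (0:ℝ), fderiv ℝ H (u, 0) (0, 1) = 0)
    (hd1 : ∀ᶠ u in 𝓝 (0:ℝ), fderiv ℝ H (u, -2 / 3 * u) (0, 1) = 0)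
    {q : ℝ → ℝ} (hq : ContinuousAt q 0) (hq0 : q 0 ≠ 0)
    (hX : ∀ᶠ X in 𝓝 (0:ℝ), H (0, X) = X ^ 6 * q X)
    (hK : ∀ᶠ u in 𝓝 (0:ℝ), ∃ k : ℝ → ℝ, ContinuousAt k 0 ∧
      ∀ᶠ X in 𝓝 (0:ℝ), H (u, X) = X ^ 5 * k X) :
    ∃ Ψ : R4 → ℝ, Sm Ψ ∧ (∀ᶠ u in 𝓝 (0:ℝ), ∀ x, H (u, x) = Ψ (u, PP u x, mA u x, mD u x)) ∧
      fderiv ℝ Ψ 0 (0, 0, 1, 0) = 0 ∧ fderiv ℝ Ψ 0 (0, 0, 0, 1) ≠ 0 := by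
  obtain ⟨b0, b1, b2, h0, h1, h2, e⟩ := core hH hd0 hd1
  obtain ⟨c0, hc0, k0⟩ := hadamard_graph h0 (φ := fun _ => 0) contDiff_const
  obtain ⟨c00, hc00, k00⟩ := hadamard_graph hc0 (φ := fun _ => 0) contDiff_const
  obtain ⟨c1, hc1, k1⟩ := hadamard_graph h1 (φ := fun _ => 0) contDiff_const
  obtain ⟨c2, hc2, k2⟩ := hadamard_graph h2 (φ := fun _ => 0) contDiff_const
  obtain ⟨d00, hd00, m00⟩ := hadamard_graph hc00 (φ := fun _ => 0) contDiff_const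
  obtain ⟨d1, hd1, m1⟩ := hadamard_graph hc1 (φ := fun _ => 0) contDiff_const
  obtain ⟨d2, hd2, m2⟩ := hadamard_graph hc2 (φ := fun _ => 0) contDiff_const
  simp only [sub_zero] at k0 k00 k1 k2 m00 m1 m2
  have s00 := hc00.continuous
  have s1 := hc1.continuous
  have s2 := hc2.continuous
  have t00 := hd00.continuous
  have t1 := hd1.continuous
  have t2 := hd2.continuous
  have hp := poly_zero (A0 := b0 (0,0)) (A1 := 0) (A2 := 0) (A3 := c0 (0, 0)) (A4 := b1 (0, 0))
    (A5 := b2 (0, 0)) (q := fun X => c00 (0, X ^ 3) + X * c1 (0, X ^ 3) + X ^ 2 * c2 (0, X ^ 3) - q X)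
    (ContinuousAt.sub (by fun_prop) hq) (by
      refine Filter.Eventually.filter_mono nhdsWithin_le_nhds ?_
      filter_upwards [hX] with X hX
      have h := e.self_of_nhds X
      have p : PP 0 X = X ^ 3 := by simp [PP]
      have a : Ap 0 X = X ^ 4 := by simp [Ap, PP]; ring
      have b : Bp 0 X = X ^ 5 := by simp [Bp, PP]; ring
      rw [hX, p, a, b, k0 0 (X ^ 3), k00 0 (X ^ 3), k1 0 (X ^ 3), k2 0 (X ^ 3)] at h
      linear_combination -h)
  obtain ⟨-, -, -, -, q4, q5, q6⟩ := hp
  have hf2 : c00 (0, 0) = q 0 := by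
    have := eq_of_punctured (f := fun X => c00 (0, X ^ 3) + X * c1 (0, X ^ 3) + X ^ 2 * c2 (0, X ^ 3) - q X)
      (g := fun _ => 0) (a := 0) (ContinuousAt.sub (by fun_prop) hq) continuousAt_const q6
    simp at this
    linarith
  obtain ⟨Ψ, β, hΨ, hβ, eβ, eΨ, D1, D2⟩ := core2 h0 h1 h2 q5
  have hβ0 : β 0 = -6 / 5 * c00 (0, 0) := by
    have cβ := hβ.continuous
    have := eq_of_punctured (f := β) (a := 0)
      (g := fun u => -6 / 5 * (c00 (u, 0) + u / 9 * c1 (u, 0) - 4 / 27 * u ^ 2 * c2 (u, 0)))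
      cβ.continuousAt (by fun_prop) (by
        filter_upwards [hK.filter_mono nhdsWithin_le_nhds, e.filter_mono nhdsWithin_le_nhds,
          self_mem_nhdsWithin] with u hK e hu
        have hu : u ≠ 0 := hu
        obtain ⟨k, hKc, hKe⟩ := hK
        have hp := poly_zero4 (A0 := b0 (u, 0)) (A1 := 0)
          (A2 := u * c0 (u, 0) + u ^ 2 / 9 * b1 (u, 0) - 4 / 27 * u ^ 3 * b2 (u, 0))
          (A3 := c0 (u, 0) + u * b1 (u, 0))
          (A4 := u ^ 2 * c00 (u, 0) + b1 (u, 0) + u * b2 (u, 0) + u ^ 3 / 9 * c1 (u, 0)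
            - 4 / 27 * u ^ 4 * c2 (u, 0))
          (q := fun X => ((2 * u + X) * c00 (u, 0) + X * (X + u) ^ 3 * d00 (u, PP u X)
            + ((X + u) ^ 2 + u ^ 2 / 9) * c1 (u, 0)
            + X * (X + u) ^ 2 * (X * (X + u) + u ^ 2 / 9) * d1 (u, PP u X)
            + b2 (u, 0) + (X * (X + u) ^ 2 - 4 / 27 * u ^ 3) * c2 (u, 0)
            + X * (X + u) ^ 2 * (X ^ 2 * (X + u) - 4 / 27 * u ^ 3) * d2 (u, PP u X)) - k X)
          (ContinuousAt.sub (by unfold PP; fun_prop) hKc) ?_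
        · obtain ⟨-, -, a2, a3, a4⟩ := hp
          rw [eβ] at a2 a4
          have g0 : b1 (u, 0) = -(u / 6) * (u * β u) := by
            refine mul_left_cancel₀ (pow_ne_zero 2 hu) ?_
            linear_combination (-9/8) * (a2 - u * a3)
          rw [g0] at a4
          refine mul_left_cancel₀ (pow_ne_zero 2 hu) ?_
          linear_combination (6/5) * a4
        · refine Filter.Eventually.filter_mono nhdsWithin_le_nhds ?_
          filter_upwards [hKe] with X hX
          have h := e X
          rw [hX, k0 u (PP u X), k00 u (PP u X), k1 u (PP u X), k2 u (PP u X), m00 u (PP u X),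
            m1 u (PP u X), m2 u (PP u X)] at h
          generalize d00 (u, PP u X) = D00 at *
          generalize d1 (u, PP u X) = D1 at *
          generalize d2 (u, PP u X) = D2 at *
          simp only [Ap, Bp, PP] at h
          linear_combination -h)
    simpa using this
  refine ⟨Ψ, hΨ, ?_, ?_, ?_⟩
  · filter_upwards [e] with u hu x
    rw [hu, eΨ]
  · rw [D1, q4, mul_zero]
  · rw [D2, hβ0, hf2]
    intro h
    apply hq0
    linarith

end UM

namespace UM

theorem globalize {E F : Type} [NormedAddCommGroup E] [NormedSpace ℝ E] [FiniteDimensional ℝ E]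
    [NormedAddCommGroup F] [NormedSpace ℝ F] {f : E → F} {a : E}
    (hf : ∀ᶠ y in 𝓝 a, ContDiffAt ℝ (⊤ : ℕ∞) f y) :
    ∃ g : E → F, Sm g ∧ g =ᶠ[𝓝 a] f := by
  obtain ⟨ε, hε, hb⟩ := Metric.eventually_nhds_iff_ball.1 hf
  let χ : ContDiffBump a := ⟨ε / 4, ε / 2, by positivity, by linarith⟩
  refine ⟨fun y => χ y • f y, ?_, ?_⟩
  · refine contDiff_iff_contDiffAt.2 ?_
    intro y
    by_cases hy : y ∈ Metric.ball a ε
    · exact χ.contDiffAt.smul (hb y hy)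
    · have : (fun y => χ y • f y) =ᶠ[𝓝 y] fun _ => 0 := by
        have hy' : ε ≤ dist y a := by simpa using hy
        have : ∀ᶠ z in 𝓝 y, ε / 2 < dist z a :=
          (continuous_id.dist continuous_const).continuousAt.eventually_const_lt (by simp; linarith)
        filter_upwards [this] with z hz
        rw [χ.zero_of_le_dist hz.le, zero_smul]
      exact contDiffAt_const.congr_of_eventuallyEq this
  · filter_upwards [χ.eventuallyEq_one] with y hy
    rw [hy]; simp

theorem local_inverse {E : Type} [NormedAddCommGroup E] [NormedSpace ℝ E] [FiniteDimensional ℝ E]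
    {f : E → E} (hf : Sm f) (a : E) (hinj : ∀ v, fderiv ℝ f a v = 0 → v = 0) :
    ∃ g : E → E, Sm g ∧ g (f a) = a ∧ (∀ᶠ x in 𝓝 a, g (f x) = x) ∧
      ∀ᶠ y in 𝓝 (f a), f (g y) = y := by
  haveI : CompleteSpace E := FiniteDimensional.complete ℝ E
  have hi : Function.Injective (fderiv ℝ f a : E →ₗ[ℝ] E) :=
    (injective_iff_map_eq_zero _).2 hinj
  let f' : E ≃L[ℝ] E := (LinearEquiv.ofInjectiveEndo _ hi).toContinuousLinearEquiv
  have hf'e : (f' : E →L[ℝ] E) = fderiv ℝ f a := by ext x; rfl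
  have hd : HasFDerivAt f (f' : E →L[ℝ] E) a := by rw [hf'e]; exact hf.hasFDerivAt a
  have hn : ((⊤ : ℕ∞) : WithTop ℕ∞) ≠ 0 := by simp
  let Φ := hf.contDiffAt.toOpenPartialHomeomorph f hd hn
  have hΦ : (Φ : E → E) = f := hf.contDiffAt.toOpenPartialHomeomorph_coe hd hn
  have ha : a ∈ Φ.source := hf.contDiffAt.mem_toOpenPartialHomeomorph_source hd hn
  have hfa : f a ∈ Φ.target := hf.contDiffAt.image_mem_toOpenPartialHomeomorph_target hd hn
  have hsa : Φ.symm (f a) = a := by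
    have := Φ.left_inv ha
    rwa [hΦ] at this
  have hinv : ∀ᶠ x in 𝓝 a, fderiv ℝ f x ∈ Set.range ((↑) : (E ≃L[ℝ] E) → E →L[ℝ] E) := by
    have c : ContinuousAt (fderiv ℝ f) a := (hf.continuous_fderiv (by simp)).continuousAt
    have := f'.nhds
    rw [hf'e] at this
    exact c this
  have hsm : ∀ᶠ y in 𝓝 (f a), ContDiffAt ℝ (⊤ : ℕ∞) Φ.symm y := by
    have c : ContinuousAt Φ.symm (f a) := Φ.continuousAt_symm hfa
    have c' : Tendsto Φ.symm (𝓝 (f a)) (𝓝 a) := by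
      have := c.tendsto; rwa [hsa] at this
    filter_upwards [Φ.open_target.mem_nhds hfa, c'.eventually hinv] with y hy hy2
    obtain ⟨e, he⟩ := hy2
    refine Φ.contDiffAt_symm (f₀' := e) hy ?_ ?_
    · rw [hΦ, he]; exact hf.hasFDerivAt _
    · rw [hΦ]; exact hf.contDiffAt
  obtain ⟨g, hg, hge⟩ := globalize hsm
  refine ⟨g, hg, hge.self_of_nhds.trans hsa, ?_, ?_⟩
  · filter_upwards [hf.continuous.continuousAt.tendsto.eventually hge, Φ.open_source.mem_nhds ha] with x h1 h2
    rw [h1]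
    have := Φ.left_inv h2
    rwa [hΦ] at this
  · filter_upwards [hge, Φ.open_target.mem_nhds hfa] with y h1 h2
    rw [h1]
    have := Φ.right_inv h2
    rwa [hΦ] at this

theorem local_inverse1 {f : ℝ → ℝ} (hf : Sm f) (a : ℝ) (h : deriv f a ≠ 0) :
    ∃ g : ℝ → ℝ, Sm g ∧ g (f a) = a ∧ (∀ᶠ x in 𝓝 a, g (f x) = x) ∧
      ∀ᶠ y in 𝓝 (f a), f (g y) = y := by
  refine local_inverse hf a fun v hv => ?_
  have : fderiv ℝ f a v = v * deriv f a := by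
    rw [fderiv_eq_smul_deriv]; rfl
  rw [this] at hv
  exact (mul_eq_zero.1 hv).resolve_right h

/-- directional derivative criterion -/
theorem fderiv_eq_of_line {E F : Type} [NormedAddCommGroup E] [NormedSpace ℝ E]
    [NormedAddCommGroup F] [NormedSpace ℝ F] {Ψ : E → F} (hΨ : Sm Ψ) (a v : E) {d : F}
    (hd : HasDerivAt (fun t : ℝ => Ψ (a + t • v)) d 0) : fderiv ℝ Ψ a v = d := by
  have h : HasDerivAt (fun t : ℝ => a + t • v) v 0 := by
    simpa using ((hasDerivAt_id (0:ℝ)).smul_const v).const_add a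
  have b := (hΨ.hasFDerivAt (a + (0:ℝ) • v)).comp_hasDerivAt 0 h
  rw [zero_smul, add_zero] at b
  exact b.unique hd

theorem germEquiv_of {E F : Type} [NormedAddCommGroup E] [NormedSpace ℝ E] [FiniteDimensional ℝ E]
    [NormedAddCommGroup F] [NormedSpace ℝ F] [FiniteDimensional ℝ F]
    {f g : E → F} {σ : E → E} {Λ : F → F} (hσ : Sm σ) (hΛ : Sm Λ) (σ0 : σ 0 = 0)
    (hg0 : g 0 = 0) (hσi : ∀ v, fderiv ℝ σ 0 v = 0 → v = 0) (hΛi : ∀ v, fderiv ℝ Λ 0 v = 0 → v = 0)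
    (hg : ContinuousAt g 0) (h : ∀ᶠ p in 𝓝 (0:E), f p = Λ (g (σ p))) : GermEquiv f 0 g 0 := by
  obtain ⟨σ', s1, s2, s3, s4⟩ := local_inverse hσ 0 hσi
  obtain ⟨τ, t1, t2, t3, t4⟩ := local_inverse hΛ 0 hΛi
  have hf0 : f 0 = Λ 0 := by rw [h.self_of_nhds, σ0, hg0]
  rw [σ0] at s2 s4
  refine ⟨σ, σ', τ, Λ, σ0, by rw [hf0, t2, hg0], hσ.contDiffAt, s1.contDiffAt, t1.contDiffAt,
    hΛ.contDiffAt, s3, s4, ?_, ?_, ?_⟩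
  · rw [hf0]; exact t4
  · rw [hg0]; exact t3
  · have c : Tendsto (fun p => g (σ p)) (𝓝 0) (𝓝 0) := by
      have c1 : Tendsto σ (𝓝 0) (𝓝 0) := by
        have := hσ.continuous.tendsto 0; rwa [σ0] at this
      have c2 : Tendsto g (𝓝 0) (𝓝 0) := by
        have := hg.tendsto; rwa [hg0] at this
      exact c2.comp c1
    filter_upwards [h, c.eventually t3] with p hp h3
    rw [hp, h3]

end UM

namespace UM

theorem taylor2 {e : ℝ → ℝ} (he : Sm e) : ∃ Q : R2 → ℝ, Sm Q ∧ ∀ x u,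
    e u = e x + (u - x) * deriv e x + (u - x) ^ 2 * Q (x, u) := by
  obtain ⟨g, hg, e1⟩ := hadamard_graph (f := fun z => e z.2) (he.comp contDiff_snd)
    (φ := fun x => x) contDiff_id
  obtain ⟨Q, hQ, e2⟩ := hadamard_graph hg (φ := fun x => x) contDiff_id
  refine ⟨Q, hQ, fun x u => ?_⟩
  have hgx : deriv e x = g (x, x) := by
    have h : HasDerivAt e (g (x, x)) x := by
      have : e = fun c => e x + (c - x) * g (x, c) := by
        funext c; exact e1 x c
      rw [this]
      have hd : HasDerivAt (fun c => g (x, c)) _ x :=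
        hasDerivAt_comp2 hg (hasDerivAt_const x x) (hasDerivAt_id x)
      refine ((((hasDerivAt_id x).sub_const x).mul hd).const_add (e x)).congr_deriv ?_
      simp
    exact h.deriv
  have k1 := e1 x u
  have k2 := e2 x u
  simp only at k1 k2
  rw [hgx, k1, k2]; ring

theorem sm_deriv {e : ℝ → ℝ} (he : Sm e) : Sm (deriv e) := by
  have : deriv e = fun x => fderiv ℝ e x 1 := by funext x; simp
  rw [this]
  exact sm_dir he 1

theorem cube_root {e : ℝ → ℝ} (he : Sm e) (e0 : e 0 = 1) :
    ∃ ε : ℝ → ℝ, Sm ε ∧ ε 0 = 1 ∧ ∀ᶠ u in 𝓝 (0:ℝ), ε u ^ 3 = e u := by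
  obtain ⟨g, hg, g1, -, g3⟩ := local_inverse1 (f := fun w : ℝ => w ^ 3) (contDiff_id.pow 3) 1 (by simp)
  simp only [one_pow] at g1 g3
  refine ⟨fun u => g (e u), hg.comp he, by simp [e0, g1], ?_⟩
  have c : Tendsto e (𝓝 0) (𝓝 1) := by
    have := he.continuous.tendsto 0; rwa [e0] at this
  exact c.eventually g3

theorem implicit_fun {K : R3 → ℝ} (hK : Sm K) {r0 : ℝ} (h0 : K (0, 0, r0) = 0)
    {d : ℝ} (hd : HasDerivAt (fun r => K (0, 0, r)) d r0) (hd0 : d ≠ 0) :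
    ∃ r : R2 → ℝ, Sm r ∧ r (0, 0) = r0 ∧ ∀ᶠ z in 𝓝 (0 : R2), K (z.1, z.2, r z) = 0 := by
  have hf : Sm (fun z : R3 => ((z.1, z.2.1, K z) : R3)) :=
    contDiff_fst.prodMk ((contDiff_fst.comp contDiff_snd).prodMk hK)
  obtain ⟨g, hg, g1, -, g3⟩ := local_inverse hf (0, 0, r0) (by
    rintro ⟨a, b, c⟩ hv
    have hF : HasFDerivAt (fun z : R3 => ((z.1, z.2.1, K z) : R3))
        ((ContinuousLinearMap.fst ℝ ℝ R2).prod
          (((ContinuousLinearMap.fst ℝ ℝ ℝ).comp (ContinuousLinearMap.snd ℝ ℝ R2)).prod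
            (fderiv ℝ K (0, 0, r0)))) (0, 0, r0) :=
      hasFDerivAt_fst.prodMk ((hasFDerivAt_fst.comp _ hasFDerivAt_snd).prodMk (hK.hasFDerivAt _))
    rw [hF.fderiv] at hv
    simp at hv
    obtain ⟨rfl, rfl, hv⟩ := hv
    have hl : fderiv ℝ K (0, 0, r0) ((0, 0, c) : R3) = c * d := by
      refine fderiv_eq_of_line hK _ _ ?_
      have h1 : HasDerivAt (fun t : ℝ => r0 + t * c) c 0 := by
        simpa using ((hasDerivAt_id (0:ℝ)).mul_const c).const_add r0
      have hd' : HasDerivAt (fun r => K (0, 0, r)) d (r0 + 0 * c) := by simpa using hd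
      have h2 := hd'.comp (0:ℝ) h1
      rw [mul_comm d c] at h2
      refine h2.congr_of_eventuallyEq (Eventually.of_forall fun t => ?_)
      simp [Function.comp]
    rw [hl] at hv
    simp [(mul_eq_zero.1 hv).resolve_right hd0])
  simp only [h0] at g1 g3
  refine ⟨fun z => (g (z.1, z.2, 0)).2.2, ?_, by simp [g1], ?_⟩
  · have : ContDiff ℝ (⊤ : ℕ∞) (fun z : R2 => ((z.1, z.2, 0) : R3)) := by fun_prop
    exact (contDiff_snd.comp contDiff_snd).comp (hg.comp this)
  · have c : Tendsto (fun z : R2 => ((z.1, z.2, 0) : R3)) (𝓝 0) (𝓝 (0, 0, 0)) := by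
      have : Continuous (fun z : R2 => ((z.1, z.2, 0) : R3)) := by fun_prop
      exact this.tendsto 0
    filter_upwards [c.eventually g3] with z hz
    generalize g (z.1, z.2, 0) = w at *
    obtain ⟨w1, w2, w3⟩ := w
    simp only [Prod.mk.injEq] at hz
    obtain ⟨rfl, rfl, hz⟩ := hz
    exact hz

noncomputable def mm (ε : ℝ → ℝ) (u : ℝ) : ℝ := -3 / 2 * (u * ε u)
noncomputable def sig (ε : ℝ → ℝ) (r : R2 → ℝ) (z : R2) : R2 :=
  (mm ε z.1, z.2 * (ε z.1 + (z.2 - z.1) * r z))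

theorem normalize {e : ℝ → ℝ} (he : Sm e) (e0 : e 0 = 1) :
    ∃ (ε : ℝ → ℝ) (r : R2 → ℝ), Sm ε ∧ Sm r ∧ ε 0 = 1 ∧ r (0, 0) = deriv e 0 / 2 ∧
      ∀ᶠ z in 𝓝 (0 : R2), PP (sig ε r z).1 (sig ε r z).2 =
        -1 / 2 * (z.2 ^ 3 * e z.2 + (z.1 - z.2) * (3 * z.2 ^ 2 * e z.2 + z.2 ^ 3 * deriv e z.2)) := by
  obtain ⟨ε, hε, ε0, hε3⟩ := cube_root he e0
  obtain ⟨Q, hQ, eQ⟩ := taylor2 he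
  have he' : ContDiff ℝ (⊤ : ℕ∞) (deriv e) := sm_deriv he
  let K : R3 → ℝ := fun z => -6 * ε z.1 ^ 2 * z.2.2 + (3 * z.1 - 6 * z.2.1) * ε z.1 * z.2.2 ^ 2
    + 2 * z.2.1 * (z.1 - z.2.1) * z.2.2 ^ 3 + 3 * deriv e z.2.1 + (3 * z.1 - 2 * z.2.1) * Q (z.2.1, z.1)
  have hK : ContDiff ℝ (⊤ : ℕ∞) K := by
    have hε' : ContDiff ℝ (⊤ : ℕ∞) ε := hε
    have hQ' : ContDiff ℝ (⊤ : ℕ∞) Q := hQ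
    unfold K; fun_prop
  obtain ⟨r, hr, r0, hr0⟩ := implicit_fun (K := K) hK (r0 := deriv e 0 / 2) (by simp [K, ε0]; ring) (d := -6)
    (by
      have : (fun r => K (0, 0, r)) = fun r => -6 * r + 3 * deriv e 0 := by
        funext r; simp [K, ε0]
      rw [this]
      simpa using ((hasDerivAt_id (deriv e 0 / 2)).const_mul (-6)).add_const (3 * deriv e 0)) (by norm_num)
  refine ⟨ε, r, hε, hr, ε0, r0, ?_⟩
  have c : Tendsto (fun z : R2 => z.1) (𝓝 0) (𝓝 0) := continuous_fst.tendsto 0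
  filter_upwards [hr0, c.eventually hε3] with z hz h3
  have h1 := eQ z.2 z.1
  rw [← h3] at h1
  simp only [K] at hz
  simp only [PP, sig, mm]
  linear_combination (-1/2 * z.2 ^ 2 * (z.1 - z.2) ^ 2) * hz
    + (-1/2 * z.2 ^ 2 * (3 * z.1 - 2 * z.2)) * h1

theorem transfer {ε : ℝ → ℝ} {r : R2 → ℝ} (hε : Sm ε) (hr : Sm r) (ε0 : ε 0 = 1) :
    Sm (sig ε r) ∧ sig ε r 0 = 0 ∧ (∀ v, fderiv ℝ (sig ε r) 0 v = 0 → v = 0) ∧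
    ∃ (S : R2 → R2) (μ : ℝ → ℝ), Sm S ∧ Sm μ ∧ S 0 = 0 ∧ μ 0 = 0 ∧ deriv μ 0 ≠ 0 ∧
      (∀ᶠ z in 𝓝 (0 : R2), S (sig ε r z) = z) ∧ (∀ᶠ z in 𝓝 (0 : R2), sig ε r (S z) = z) ∧
      (∀ᶠ u in 𝓝 (0 : ℝ), μ (mm ε u) = u) ∧ (∀ᶠ v in 𝓝 (0 : ℝ), mm ε (μ v) = v) := by
  have hε' : ContDiff ℝ (⊤ : ℕ∞) ε := hε
  have hr' : ContDiff ℝ (⊤ : ℕ∞) r := hr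
  have hm : ContDiff ℝ (⊤ : ℕ∞) (mm ε) := by unfold mm; fun_prop
  have hs : ContDiff ℝ (⊤ : ℕ∞) (sig ε r) := by unfold sig; fun_prop
  have m0 : mm ε 0 = 0 := by simp [mm]
  have s0 : sig ε r 0 = 0 := by simp [sig, m0]
  have dm : HasDerivAt (mm ε) (-3/2) 0 := by
    have h := ((hasDerivAt_id (0:ℝ)).mul (hε.differentiable (by simp) 0).hasDerivAt).const_mul (-3/2)
    refine h.congr_deriv ?_
    simp [ε0]
  have hinj : ∀ v, fderiv ℝ (sig ε r) 0 v = 0 → v = 0 := by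
    rintro ⟨a, b⟩ hv
    have hl : fderiv ℝ (sig ε r) 0 (a, b) = (-3/2 * a, b) := by
      refine fderiv_eq_of_line hs _ _ ?_
      have h1 : HasDerivAt (fun t : ℝ => t * a) a 0 := by
        simpa using (hasDerivAt_id (0:ℝ)).mul_const a
      have h1b : HasDerivAt (fun t : ℝ => t * b) b 0 := by
        simpa using (hasDerivAt_id (0:ℝ)).mul_const b
      have dm' : HasDerivAt (mm ε) (-3/2) (0 * a) := by simpa using dm
      have h2 := dm'.comp (0:ℝ) h1
      have hG : ContDiff ℝ (⊤ : ℕ∞) (fun t : ℝ => ε (t * a) + (t * b - t * a) * r (t * a, t * b)) := by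
        fun_prop
      have h3 := h1b.mul (hG.differentiable (by simp) 0).hasDerivAt
      have h4 := h2.prodMk h3
      refine (h4.congr_of_eventuallyEq (Eventually.of_forall fun t => ?_)).congr_deriv ?_
      · simp [sig]
      · simp [ε0]
    rw [hl] at hv
    simp at hv
    simp [hv]
  obtain ⟨S, hS, S0, S1, S2⟩ := local_inverse hs 0 hinj
  obtain ⟨μ, hμ, μ0, μ1, μ2⟩ := local_inverse1 hm 0 (by rw [dm.deriv]; norm_num)
  rw [s0] at S0 S2
  rw [m0] at μ0 μ2
  refine ⟨hs, s0, hinj, S, μ, hS, hμ, S0, μ0, ?_, S1, S2, μ1, μ2⟩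
  intro h
  have d1 := (hμ.differentiable (by simp) 0).hasDerivAt
  have dm' : HasDerivAt (mm ε) (-3/2) (μ 0) := by rw [μ0]; exact dm
  have d2 := dm'.comp 0 d1
  have d3 : HasDerivAt (mm ε ∘ μ) 1 0 := (hasDerivAt_id (0:ℝ)).congr_of_eventuallyEq μ2
  have := d2.unique d3
  rw [h] at this
  simp at this

end UM

namespace UM

noncomputable def FF (c : ℝ → ℝ) (z : R2) : ℝ := c z.2 + (z.1 - z.2) * deriv c z.2

theorem sm_FF {c : ℝ → ℝ} (hc : Sm c) : Sm (FF c) := by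
  have h1 : ContDiff ℝ (⊤ : ℕ∞) c := hc
  have h2 : ContDiff ℝ (⊤ : ℕ∞) (deriv c) := sm_deriv hc
  have : ContDiff ℝ (⊤ : ℕ∞) (FF c) := by unfold FF; fun_prop
  exact this

theorem diag_tendsto (k : ℝ) : Tendsto (fun u : ℝ => ((u, k * u) : R2)) (𝓝 0) (𝓝 0) := by
  have : Continuous (fun u : ℝ => ((u, k * u) : R2)) := by fun_prop
  have h := this.tendsto 0
  simp only [mul_zero] at h
  exact h

theorem crit {ε : ℝ → ℝ} {r : R2 → ℝ} (hε : Sm ε) (hr : Sm r) (ε0 : ε 0 = 1) {H : R2 → ℝ} (hH : Sm H)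
    {c : ℝ → ℝ} (hc : Sm c) (e : ∀ᶠ z in 𝓝 (0 : R2), H (sig ε r z) = FF c z) :
    ∀ᶠ z in 𝓝 (0 : R2), (z.1 - z.2) * deriv (deriv c) z.2 = 0 →
      fderiv ℝ H (sig ε r z) (0, 1) = 0 := by
  have hε' : ContDiff ℝ (⊤ : ℕ∞) ε := hε
  have hr' : ContDiff ℝ (⊤ : ℕ∞) r := hr
  have hX : Sm (fun z : R2 => z.2 * (ε z.1 + (z.2 - z.1) * r z)) := by
    have : ContDiff ℝ (⊤ : ℕ∞) (fun z : R2 => z.2 * (ε z.1 + (z.2 - z.1) * r z)) := by fun_prop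
    exact this
  set Xf := fun z : R2 => z.2 * (ε z.1 + (z.2 - z.1) * r z) with hXf
  have hD : Continuous fun z => fderiv ℝ Xf z (0, 1) := (sm_dir hX (0, 1)).continuous
  have hD0 : fderiv ℝ Xf 0 (0, 1) = 1 := by
    refine fderiv_eq_of_line hX _ _ ?_
    have hG : ContDiff ℝ (⊤ : ℕ∞) (fun t : ℝ => 1 + t * r (0, t)) := by fun_prop
    have h3 := (hasDerivAt_id (0:ℝ)).mul (hG.differentiable (by simp) 0).hasDerivAt
    refine (h3.congr_of_eventuallyEq (Eventually.of_forall fun t => ?_)).congr_deriv ?_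
    · simp [Xf, ε0]
    · simp
  have hne : ∀ᶠ z in 𝓝 (0 : R2), fderiv ℝ Xf z (0, 1) ≠ 0 :=
    hD.continuousAt.eventually_ne (by rw [hD0]; norm_num)
  filter_upwards [hne, eventually_eventually_nhds.2 e] with z hz hez h0
  obtain ⟨u, x⟩ := z
  have d1 : HasDerivAt (fun x => Xf (u, x)) (fderiv ℝ Xf (u, x) (0, 1)) x := by
    refine (hasDerivAt_comp2 hX (hasDerivAt_const x u) (hasDerivAt_id x)).congr_deriv ?_
    simp
  have d2 := hasDerivAt_comp2 hH (hasDerivAt_const x (mm ε u)) d1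
  have d3 : HasDerivAt (fun x => FF c (u, x)) ((u - x) * deriv (deriv c) x) x := by
    have k1 := (hc.differentiable (by simp) x).hasDerivAt
    have k2 := ((sm_deriv hc).differentiable (by simp) x).hasDerivAt
    refine (k1.add (((hasDerivAt_id x).const_sub u).mul k2)).congr_deriv ?_
    simp
  have ct : Tendsto (fun x => ((u, x) : R2)) (𝓝 x) (𝓝 (u, x)) := by
    have : Continuous (fun x => ((u, x) : R2)) := by fun_prop
    exact this.tendsto x
  have d4 := d3.congr_of_eventuallyEq (ct.eventually hez)
  have := d2.unique d4
  simp only [] at h0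
  rw [h0] at this
  simp only [zero_mul, zero_add] at this
  exact (mul_eq_zero.1 this).resolve_left hz

/-- the local data of the normalization -/
structure Dat (ε : ℝ → ℝ) (r : R2 → ℝ) (S : R2 → R2) (μ : ℝ → ℝ) : Prop where
  hε : Sm ε
  hr : Sm r
  ε0 : ε 0 = 1
  hS : Sm S
  hμ : Sm μ
  S0 : S 0 = 0
  μ0 : μ 0 = 0
  e1 : ∀ᶠ z in 𝓝 (0 : R2), S (sig ε r z) = z
  e2 : ∀ᶠ z in 𝓝 (0 : R2), sig ε r (S z) = z
  e3 : ∀ᶠ u in 𝓝 (0 : ℝ), μ (mm ε u) = u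
  e4 : ∀ᶠ v in 𝓝 (0 : ℝ), mm ε (μ v) = v

section
variable {ε : ℝ → ℝ} {r : R2 → ℝ} {S : R2 → R2} {μ : ℝ → ℝ}

theorem Dat.He (D : Dat ε r S μ) (c : ℝ → ℝ) :
    ∀ᶠ z in 𝓝 (0 : R2), (fun w => FF c (S w)) (sig ε r z) = FF c z :=
  D.e1.mono fun z hz => by simp only [hz]

theorem Dat.smH (D : Dat ε r S μ) {c : ℝ → ℝ} (hc : Sm c) : Sm (fun w => FF c (S w)) :=
  (sm_FF hc).comp D.hS

theorem Dat.tμ (D : Dat ε r S μ) : Tendsto μ (𝓝 0) (𝓝 0) := by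
  have := D.hμ.continuous.tendsto 0; rwa [D.μ0] at this

theorem Dat.hd0 (D : Dat ε r S μ) {c : ℝ → ℝ} (hc : Sm c) (hc2 : deriv (deriv c) 0 = 0) :
    ∀ᶠ u in 𝓝 (0:ℝ), fderiv ℝ (fun w => FF c (S w)) (u, 0) (0, 1) = 0 := by
  have h := crit D.hε D.hr D.ε0 (D.smH hc) hc (D.He c)
  filter_upwards [((diag_tendsto 0).comp D.tμ).eventually h, D.e4] with v hv h4
  have h5 := hv (by simp [hc2])
  simpa [sig, h4] using h5

theorem Dat.hd1 (D : Dat ε r S μ) {c : ℝ → ℝ} (hc : Sm c) :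
    ∀ᶠ u in 𝓝 (0:ℝ), fderiv ℝ (fun w => FF c (S w)) (u, -2 / 3 * u) (0, 1) = 0 := by
  have h := crit D.hε D.hr D.ε0 (D.smH hc) hc (D.He c)
  filter_upwards [((diag_tendsto 1).comp D.tμ).eventually h, D.e4] with v hv h4
  have h5 := hv (by simp)
  have h6 : sig ε r ((fun u : ℝ => ((u, 1 * u) : R2)) (μ v)) = (v, -2 / 3 * v) := by
    simp only [sig, h4, one_mul, sub_self, zero_mul, add_zero, Prod.mk.injEq, true_and]
    rw [← h4]
    simp only [mm]
    rw [show -3 / 2 * (μ v * ε (μ v)) = mm ε (μ v) from rfl, h4]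
    have : mm ε (μ v) = v := h4
    simp only [mm] at this
    linarith
  rw [Function.comp, h6] at h5
  exact h5

theorem Dat.axis (D : Dat ε r S μ) : ∃ η : ℝ → ℝ, Sm η ∧ η 0 = 1 ∧
    ∀ᶠ X in 𝓝 (0:ℝ), S (0, X) = (0, X * η X) ∧ X = X * η X * (1 + X * η X * r (0, X * η X)) := by
  have hr' := D.hr.continuous
  obtain ⟨η, hη, e⟩ := hadamard1 (f := fun X => (S (0, X)).2)
    (contDiff_snd.comp (D.hS.comp (contDiff_const.prodMk contDiff_id)))
  have hη' := hη.continuous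
  have hS0 : S (0, 0) = 0 := D.S0
  simp only [hS0, Prod.snd_zero, zero_add] at e
  have ct : Tendsto (fun X : ℝ => ((0, X) : R2)) (𝓝 0) (𝓝 0) := by
    have : Continuous (fun x : ℝ => ((0, x) : R2)) := by fun_prop
    exact this.tendsto 0
  have cS : Tendsto (fun X : ℝ => (S (0, X)).1) (𝓝 0) (𝓝 0) := by
    have c := D.hS.continuous
    have : Continuous (fun x : ℝ => (S (0, x)).1) := by fun_prop
    have h := this.tendsto 0
    rwa [hS0] at h
  have key : ∀ᶠ X in 𝓝 (0:ℝ), S (0, X) = (0, X * η X) ∧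
      X = X * η X * (1 + X * η X * r (0, X * η X)) := by
    filter_upwards [ct.eventually D.e2, cS.eventually D.e3] with X h1 h2
    have h3 : (S (0, X)).1 = 0 := by
      have := congrArg Prod.fst h1
      simp only [sig] at this
      rw [this, D.μ0] at h2
      exact h2.symm
    have h4 : S (0, X) = (0, X * η X) := Prod.ext h3 (e X)
    refine ⟨h4, ?_⟩
    have := congrArg Prod.snd h1
    rw [h4] at this
    simp only [sig, D.ε0, sub_zero] at this
    exact this.symm
  refine ⟨η, hη, ?_, key⟩
  have := eq_of_punctured (f := fun X => η X * (1 + X * η X * r (0, X * η X))) (g := fun _ => 1) (a := 0)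
    (by fun_prop) continuousAt_const (by
      filter_upwards [key.filter_mono nhdsWithin_le_nhds, self_mem_nhdsWithin] with X h h0
      have h0 : X ≠ 0 := h0
      refine mul_left_cancel₀ h0 ?_
      linear_combination -h.2)
  simpa using this

theorem deriv_pow6 {h : ℝ → ℝ} (hh : Sm h) (x : ℝ) :
    deriv (fun x => x ^ 6 * h x) x = x ^ 5 * (6 * h x + x * deriv h x) := by
  have := ((hasDerivAt_id x).pow 6).mul (hh.differentiable (by simp) x).hasDerivAt
  have h2 : HasDerivAt (fun x => x ^ 6 * h x) _ x := this
  rw [h2.deriv]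
  simp; ring

theorem deriv_c3 {h : ℝ → ℝ} (hh : Sm h) (a x : ℝ) :
    deriv (fun x => x ^ 4 + a * x ^ 5 + x ^ 6 * h x) x =
      4 * x ^ 3 + 5 * a * x ^ 4 + x ^ 5 * (6 * h x + x * deriv h x) := by
  have h1 := ((hasDerivAt_id x).pow 6).mul (hh.differentiable (by simp) x).hasDerivAt
  have h3 := (((hasDerivAt_id x).pow 4).add (((hasDerivAt_id x).pow 5).const_mul a)).add h1
  have h2 : HasDerivAt (fun x => x ^ 4 + a * x ^ 5 + x ^ 6 * h x) _ x := h3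
  rw [h2.deriv]
  simp; ring

theorem dd0 {k : ℝ → ℝ} (hk : Sm k) : deriv (fun x => x ^ 2 * k x) 0 = 0 := by
  have := ((hasDerivAt_id (0:ℝ)).pow 2).mul (hk.differentiable (by simp) 0).hasDerivAt
  have h2 : HasDerivAt (fun x => x ^ 2 * k x) _ 0 := this
  rw [h2.deriv]
  simp

theorem Dat.axis6 (D : Dat ε r S μ) {h : ℝ → ℝ} (hh : Sm h) :
    ∃ q : ℝ → ℝ, ContinuousAt q 0 ∧ q 0 = -5 * h 0 ∧
      ∀ᶠ X in 𝓝 (0:ℝ), FF (fun x => x ^ 6 * h x) (S (0, X)) = X ^ 6 * q X := by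
  obtain ⟨η, hη, η0, he⟩ := D.axis
  have c1 := hη.continuous
  have c2 := hh.continuous
  have c3 := (sm_deriv hh).continuous
  refine ⟨fun X => η X ^ 6 * (-5 * h (X * η X) - X * η X * deriv h (X * η X)), by fun_prop,
    by simp [η0], ?_⟩
  filter_upwards [he] with X hX
  rw [hX.1]
  simp only [FF, deriv_pow6 hh]
  ring

theorem Dat.axis3 (D : Dat ε r S μ) {a : ℝ} {h : ℝ → ℝ} (hh : Sm h) (hr0 : r (0, 0) = a / 3) :
    ∃ q : ℝ → ℝ, ContinuousAt q 0 ∧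
      ∀ᶠ X in 𝓝 (0:ℝ), FF (fun x => x ^ 4 + a * x ^ 5 + x ^ 6 * h x) (S (0, X)) =
        -3 * X ^ 4 + X ^ 6 * q X := by
  obtain ⟨η, hη, η0, he⟩ := D.axis
  obtain ⟨r1, hr1, er⟩ := hadamard1 (f := fun x => r (0, x)) (D.hr.comp (contDiff_const.prodMk contDiff_id))
  simp only [hr0] at er
  have c1 := hη.continuous
  have c2 := hh.continuous
  have c3 := (sm_deriv hh).continuous
  have c4 := hr1.continuous
  let ρ : ℝ → ℝ := fun x => a / 3 + x * r1 x
  have cρ : Continuous ρ := by unfold ρ; fun_prop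
  let W : ℝ → ℝ := fun x => -5 * h x - x * deriv h x
    + 3 * (4 * r1 x + 6 * ρ x ^ 2 + 4 * x * ρ x ^ 3 + x ^ 2 * ρ x ^ 4)
  have cW : Continuous W := by unfold W; fun_prop
  refine ⟨fun X => η X ^ 6 * W (X * η X), by fun_prop, ?_⟩
  filter_upwards [he] with X hX
  obtain ⟨h1, h2⟩ := hX
  rw [h1]
  simp only [FF, deriv_c3 hh]
  rw [er] at h2
  have h3 : X ^ 4 = (X * η X) ^ 4 * (1 + X * η X * ρ (X * η X)) ^ 4 := by
    rw [← mul_pow, ← h2]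
  have h4 : X ^ 6 * (η X ^ 6 * W (X * η X)) = (X * η X) ^ 6 * W (X * η X) := by ring
  rw [h4, h3]
  generalize X * η X = x
  simp only [W, ρ]
  ring

theorem Dat.K4 (D : Dat ε r S μ) {h : ℝ → ℝ} (hh : Sm h) :
    ∀ᶠ u in 𝓝 (0:ℝ), ∃ k : ℝ → ℝ, ContinuousAt k 0 ∧
      ∀ᶠ X in 𝓝 (0:ℝ), FF (fun x => x ^ 6 * h x) (S (u, X)) = X ^ 5 * k X := by
  filter_upwards [((diag_tendsto 0).comp D.tμ).eventually D.e1, D.e4] with v h1 h4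
  have hS : (S (v, 0)).2 = 0 := by
    have : sig ε r (μ v, 0) = (v, 0) := by simp [sig, h4]
    simp only [Function.comp, zero_mul, this] at h1
    rw [h1]
  obtain ⟨η, hη, e⟩ := hadamard1 (f := fun X => (S (v, X)).2)
    (contDiff_snd.comp (D.hS.comp (contDiff_const.prodMk contDiff_id)))
  simp only [hS, zero_add] at e
  have c0 := D.hS.continuous
  have c1 := hη.continuous
  have c2 := hh.continuous
  have c3 := (sm_deriv hh).continuous
  refine ⟨fun X => η X ^ 5 * (X * η X * h (X * η X) + ((S (v, X)).1 - X * η X) *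
    (6 * h (X * η X) + X * η X * deriv h (X * η X))), by fun_prop, Eventually.of_forall fun X => ?_⟩
  simp only [FF, deriv_pow6 hh]
  rw [e]; ring

end

noncomputable def md (z : R2) : R4 := (z.1, PP z.1 z.2, mA z.1 z.2, mD z.1 z.2)

theorem local_form {e h3 h4 : ℝ → ℝ} {a : ℝ} (he : Sm e) (e0 : e 0 = 1) (he1 : deriv e 0 = 2 / 3 * a)
    (hh3 : Sm h3) (hh4 : Sm h4) (h40 : h4 0 ≠ 0) :
    ∃ (sg : R2 → R2) (μ : ℝ → ℝ), Sm sg ∧ sg 0 = 0 ∧ (∀ v, fderiv ℝ sg 0 v = 0 → v = 0) ∧ Sm μ ∧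
      deriv μ 0 ≠ 0 ∧ (∀ᶠ z in 𝓝 (0 : R2), z.1 = μ (sg z).1) ∧
      (∀ᶠ z in 𝓝 (0 : R2), FF (fun x => x ^ 3 * e x) z = -2 * PP (sg z).1 (sg z).2) ∧
      (∃ Ψ : R4 → ℝ, Sm Ψ ∧ fderiv ℝ Ψ 0 (0, 0, 1, 0) ≠ 0 ∧
        ∀ᶠ z in 𝓝 (0 : R2), FF (fun x => x ^ 4 + a * x ^ 5 + x ^ 6 * h3 x) z = Ψ (md (sg z))) ∧
      (∃ Ψ : R4 → ℝ, Sm Ψ ∧ fderiv ℝ Ψ 0 (0, 0, 1, 0) = 0 ∧ fderiv ℝ Ψ 0 (0, 0, 0, 1) ≠ 0 ∧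
        ∀ᶠ z in 𝓝 (0 : R2), FF (fun x => x ^ 6 * h4 x) z = Ψ (md (sg z))) ∧
      (∀ h : ℝ → ℝ, Sm h → ∃ Ψ : R4 → ℝ, Sm Ψ ∧
        ∀ᶠ z in 𝓝 (0 : R2), FF (fun x => x ^ 6 * h x) z = Ψ (md (sg z))) := by
  obtain ⟨ε, r, hε, hr, ε0, r0, hP⟩ := normalize he e0
  obtain ⟨hs, s0, hinj, S, μ, hS, hμ, S0, μ0, dμ, e1, e2, e3, e4⟩ := transfer hε hr ε0
  have D : Dat ε r S μ := ⟨hε, hr, ε0, hS, hμ, S0, μ0, e1, e2, e3, e4⟩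
  have cfst : Tendsto (fun z : R2 => z.1) (𝓝 0) (𝓝 0) := continuous_fst.tendsto 0
  have csg : Tendsto (fun z : R2 => (sig ε r z).1) (𝓝 0) (𝓝 0) := by
    have h : Tendsto (fun z : R2 => (sig ε r z).1) (𝓝 0) (𝓝 (sig ε r 0).1) :=
      (continuous_fst.comp hs.continuous).tendsto 0
    rwa [s0] at h
  have fin : ∀ {c : ℝ → ℝ} {Ψ : R4 → ℝ}, (∀ᶠ u in 𝓝 (0:ℝ), ∀ x, FF c (S (u, x)) =
      Ψ (u, PP u x, mA u x, mD u x)) → ∀ᶠ z in 𝓝 (0 : R2), FF c z = Ψ (md (sig ε r z)) := by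
    intro c Ψ h
    filter_upwards [csg.eventually h, e1] with z h1 h2
    have := h1 (sig ε r z).2
    rw [Prod.mk.eta, h2] at this
    rw [this]; rfl
  have sm6 : ∀ {h : ℝ → ℝ}, Sm h → Sm (fun x => x ^ 6 * h x) := fun hh => (contDiff_id.pow 6).mul hh
  have dd6 : ∀ {h : ℝ → ℝ}, Sm h → deriv (deriv (fun x => x ^ 6 * h x)) 0 = 0 := by
    intro h hh
    have : deriv (fun x => x ^ 6 * h x) = fun x => x ^ 2 * (x ^ 3 * (6 * h x + x * deriv h x)) := by
      funext x; rw [deriv_pow6 hh]; ring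
    rw [this]
    have k1 : ContDiff ℝ (⊤ : ℕ∞) h := hh
    have k2 : ContDiff ℝ (⊤ : ℕ∞) (deriv h) := sm_deriv hh
    have k3 : ContDiff ℝ (⊤ : ℕ∞) (fun x => x ^ 3 * (6 * h x + x * deriv h x)) := by fun_prop
    exact dd0 k3
  refine ⟨sig ε r, μ, hs, s0, hinj, hμ, dμ, ?_, ?_, ?_, ?_, ?_⟩
  · filter_upwards [cfst.eventually e3] with z hz
    exact hz.symm
  · filter_upwards [hP] with z hz
    rw [hz]
    have hd : deriv (fun x => x ^ 3 * e x) z.2 = 3 * z.2 ^ 2 * e z.2 + z.2 ^ 3 * deriv e z.2 := by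
      have := ((hasDerivAt_id z.2).pow 3).mul (he.differentiable (by simp) z.2).hasDerivAt
      have h2 : HasDerivAt (fun x => x ^ 3 * e x) _ z.2 := this
      rw [h2.deriv]
      simp
    simp only [FF, hd]
    ring
  · have hc : Sm (fun x => x ^ 4 + a * x ^ 5 + x ^ 6 * h3 x) :=
      ((contDiff_id.pow 4).add (contDiff_const.mul (contDiff_id.pow 5))).add (sm6 hh3)
    obtain ⟨q, hq, eq⟩ := D.axis3 (a := a) hh3 (by rw [r0, he1]; ring)
    have hdd : deriv (deriv (fun x => x ^ 4 + a * x ^ 5 + x ^ 6 * h3 x)) 0 = 0 := by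
      have : deriv (fun x => x ^ 4 + a * x ^ 5 + x ^ 6 * h3 x) =
          fun x => x ^ 2 * (4 * x + 5 * a * x ^ 2 + x ^ 3 * (6 * h3 x + x * deriv h3 x)) := by
        funext x; rw [deriv_c3 hh3]; ring
      rw [this]
      have k1 : ContDiff ℝ (⊤ : ℕ∞) h3 := hh3
      have k2 : ContDiff ℝ (⊤ : ℕ∞) (deriv h3) := sm_deriv hh3
      have k3 : ContDiff ℝ (⊤ : ℕ∞)
        (fun x => 4 * x + 5 * a * x ^ 2 + x ^ 3 * (6 * h3 x + x * deriv h3 x)) := by fun_prop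
      exact dd0 k3
    obtain ⟨Ψ, hΨ, e, d⟩ := factor3 (D.smH hc) (D.hd0 hc hdd) (D.hd1 hc) hq eq
    refine ⟨Ψ, hΨ, ?_, fin e⟩
    rw [d]; norm_num
  · obtain ⟨q, hq, q0, eq⟩ := D.axis6 hh4
    obtain ⟨Ψ, hΨ, e, d, d'⟩ := factor4 (D.smH (sm6 hh4)) (D.hd0 (sm6 hh4) (dd6 hh4)) (D.hd1 (sm6 hh4)) hq
      (by rw [q0]; simpa using h40) eq (D.K4 hh4)
    exact ⟨Ψ, hΨ, d, d', fin e⟩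
  · intro h hh
    obtain ⟨q, hq, q0, eq⟩ := D.axis6 hh
    obtain ⟨Ψ, hΨ, e, d⟩ := factor3 (κ := 0) (D.smH (sm6 hh)) (D.hd0 (sm6 hh) (dd6 hh)) (D.hd1 (sm6 hh)) hq
      (eq.mono fun X hX => by simp only [hX]; ring)
    exact ⟨Ψ, hΨ, fin e⟩

end UM

namespace UM

theorem line_hasDerivAt {E F : Type} [NormedAddCommGroup E] [NormedSpace ℝ E]
    [NormedAddCommGroup F] [NormedSpace ℝ F] {Ψ : E → F} (hΨ : Sm Ψ) (v : E) :
    HasDerivAt (fun t : ℝ => Ψ (t • v)) (fderiv ℝ Ψ 0 v) 0 := by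
  have h : HasDerivAt (fun t : ℝ => t • v) v 0 := by
    simpa using ((hasDerivAt_id (0:ℝ)).smul_const v)
  have b := (hΨ.hasFDerivAt ((0:ℝ) • v)).comp_hasDerivAt 0 h
  rw [zero_smul] at b
  exact b

/-- scaling of the second and third components -/
theorem rescale {e k : ℝ → ℝ} (he : Sm e) (hk : Sm k) (e0 : e 0 ≠ 0) (k0 : k 0 ≠ 0) :
    ∃ (e' h : ℝ → ℝ) (a α β δ : ℝ), Sm e' ∧ Sm h ∧ e' 0 = 1 ∧ deriv e' 0 = 2 / 3 * a ∧ α ≠ 0 ∧ δ ≠ 0 ∧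
      (∀ x, x ^ 3 * e x = α * (x ^ 3 * e' x) + β * (x ^ 4 + a * x ^ 5 + x ^ 6 * h x)) ∧
      (∀ x, x ^ 4 * k x = δ * (x ^ 4 + a * x ^ 5 + x ^ 6 * h x)) := by
  obtain ⟨k1, hk1, ek⟩ := hadamard1 hk
  obtain ⟨k2, hk2, ek1⟩ := hadamard1 hk1
  let a := k1 0 / k 0
  let κ := 2 / 3 * a - deriv e 0 / e 0
  have hk' : ContDiff ℝ (⊤ : ℕ∞) k := hk
  have he' : ContDiff ℝ (⊤ : ℕ∞) e := he
  have hk2' : ContDiff ℝ (⊤ : ℕ∞) k2 := hk2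
  have s1 : ContDiff ℝ (⊤ : ℕ∞) (fun x => (e 0)⁻¹ * e x + κ * (k 0)⁻¹ * (x * k x)) := by fun_prop
  have s2 : ContDiff ℝ (⊤ : ℕ∞) (fun x => (k 0)⁻¹ * k2 x) := by fun_prop
  have key : ∀ x, x ^ 4 * k x = k 0 * (x ^ 4 + a * x ^ 5 + x ^ 6 * ((k 0)⁻¹ * k2 x)) := by
    intro x
    have h1 : k x = k 0 + x * (k1 0 + x * k2 x) := by rw [ek x, ek1 x]
    rw [h1]
    simp only [a]
    field_simp
    ring
  refine ⟨_, _, a, e 0, -(e 0 * κ), k 0, s1, s2, ?_, ?_, e0, k0, ?_, key⟩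
  · simp [e0]
  · have h1 := (he.differentiable (by simp) 0).hasDerivAt.const_mul (e 0)⁻¹
    have h2 := ((hasDerivAt_id (0:ℝ)).mul (hk.differentiable (by simp) 0).hasDerivAt).const_mul (κ * (k 0)⁻¹)
    have h3 : HasDerivAt (fun x => (e 0)⁻¹ * e x + κ * (k 0)⁻¹ * (x * k x)) _ 0 := h1.add h2
    rw [h3.deriv]
    simp only [κ]
    simp
    field_simp
    ring
  · intro x
    have h1 := key x
    have h2 : x ^ 4 + a * x ^ 5 + x ^ 6 * ((k 0)⁻¹ * k2 x) = (k 0)⁻¹ * (x ^ 4 * k x) := by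
      rw [h1]; field_simp
    rw [h2]
    field_simp
    ring

noncomputable def modelMap (m : ℕ) (p : ℝ × ℝ) (i : Fin m) : ℝ :=
  if (i : ℕ) = 0 then p.1
  else if (i : ℕ) = 1 then p.2 ^ 3 + p.1 * p.2 ^ 2
  else if (i : ℕ) = 2 then (3/4) * p.2 ^ 4 + (2/3) * p.1 * p.2 ^ 3
  else if (i : ℕ) = 3 then (1/2) * p.2 ^ 6 + (2/5) * p.1 * p.2 ^ 5
  else 0

theorem FF_lin {c c1 c2 : ℝ → ℝ} {α β : ℝ} (h1 : Sm c1) (h2 : Sm c2)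
    (h : ∀ x, c x = α * c1 x + β * c2 x) (z : R2) : FF c z = α * FF c1 z + β * FF c2 z := by
  have : c = fun x => α * c1 x + β * c2 x := funext h
  have hd : deriv c z.2 = α * deriv c1 z.2 + β * deriv c2 z.2 := by
    rw [this]
    exact (((h1.differentiable (by simp) z.2).hasDerivAt.const_mul α).add
      ((h2.differentiable (by simp) z.2).hasDerivAt.const_mul β)).deriv
  simp only [FF]
  rw [hd, h]; ring

theorem coords {m : ℕ} (hm : 4 ≤ m) {c : Fin m → ℝ → ℝ}
    (c0 : ∀ᶠ x in 𝓝 (0:ℝ), c ⟨0, by omega⟩ x = x)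
    {e k h4 : ℝ → ℝ} (he : Sm e) (hk : Sm k) (hh4 : Sm h4) (e0 : e 0 ≠ 0) (k0 : k 0 ≠ 0) (h40 : h4 0 ≠ 0)
    (c1 : c ⟨1, by omega⟩ = fun x => x ^ 3 * e x) (c2 : c ⟨2, by omega⟩ = fun x => x ^ 4 * k x)
    (c3 : c ⟨3, by omega⟩ = fun x => x ^ 6 * h4 x)
    (cj : ∀ i : Fin m, 4 ≤ (i : ℕ) → ∃ h, Sm h ∧ c i = fun x => x ^ 6 * h x) :
    ∃ (sg : R2 → R2) (Θ : (Fin m → ℝ) → (Fin m → ℝ)), Sm sg ∧ sg 0 = 0 ∧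
      (∀ v, fderiv ℝ sg 0 v = 0 → v = 0) ∧ Sm Θ ∧ (∀ v, fderiv ℝ Θ 0 v = 0 → v = 0) ∧
      ∀ᶠ z in 𝓝 (0 : R2), (fun i => FF (c i) z) = Θ (modelMap m (sg z)) := by
  obtain ⟨e', h, a, α, β, δ, he', hh, e0', de', hα, hδ, ee, kk⟩ := rescale he hk e0 k0
  obtain ⟨sg, μ, hsg, sg0, sgi, hμ, dμ, hz1, hz2, ⟨Ψ3, hΨ3, d3, hz3⟩, ⟨Ψ4, hΨ4, d4, d4', hz4⟩, hzj⟩ :=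
    local_form he' e0' de' hh hh4 h40
  choose! hj hj1 hj2 using cj
  choose! Ψ hΨ ePsi using hzj
  have i0 : 0 < m := by omega
  have i1 : 1 < m := by omega
  have i2 : 2 < m := by omega
  have i3 : 3 < m := by omega
  let ζ : (Fin m → ℝ) →L[ℝ] R4 :=
    (ContinuousLinearMap.proj (⟨0, i0⟩ : Fin m)).prod ((ContinuousLinearMap.proj (⟨1, i1⟩ : Fin m)).prod
      ((ContinuousLinearMap.proj (⟨2, i2⟩ : Fin m)).prod (ContinuousLinearMap.proj (⟨3, i3⟩ : Fin m))))
  have hζ : ∀ w, ζ w = (w ⟨0, i0⟩, w ⟨1, i1⟩, w ⟨2, i2⟩, w ⟨3, i3⟩) := fun w => rfl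
  have hζm : ∀ z, ζ (modelMap m z) = md z := by
    intro z; rw [hζ]; simp [modelMap, md, PP, mA, mD]
  let Θ : (Fin m → ℝ) → (Fin m → ℝ) := fun w i =>
    if (i : ℕ) = 0 then μ (w ⟨0, i0⟩)
    else if (i : ℕ) = 1 then α * (-2 * w ⟨1, i1⟩) + β * Ψ3 (ζ w)
    else if (i : ℕ) = 2 then δ * Ψ3 (ζ w)
    else if (i : ℕ) = 3 then Ψ4 (ζ w)
    else w i + Ψ (hj i) (ζ w)
  have hΘ : Sm Θ := by
    refine contDiff_pi.2 fun i => ?_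
    have t0 : ContDiff ℝ (⊤ : ℕ∞) (fun w : Fin m → ℝ => μ (w ⟨0, i0⟩)) := hμ.comp (contDiff_apply ℝ ℝ _)
    have t3 : ContDiff ℝ (⊤ : ℕ∞) (fun w : Fin m → ℝ => Ψ3 (ζ w)) := hΨ3.comp ζ.contDiff
    have t4 : ContDiff ℝ (⊤ : ℕ∞) (fun w : Fin m → ℝ => Ψ4 (ζ w)) := hΨ4.comp ζ.contDiff
    simp only [Θ]
    split_ifs with q0 q1 q2 q3
    · exact t0
    · exact (contDiff_const.mul (contDiff_const.mul (contDiff_apply ℝ ℝ _))).add (contDiff_const.mul t3)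
    · exact contDiff_const.mul t3
    · exact t4
    · have q : 4 ≤ (i : ℕ) := by omega
      have tj : ContDiff ℝ (⊤ : ℕ∞) (fun w : Fin m → ℝ => Ψ (hj i) (ζ w)) :=
        (hΨ _ (hj1 i q)).comp ζ.contDiff
      exact (contDiff_apply ℝ ℝ _).add tj
  refine ⟨sg, Θ, hsg, sg0, sgi, hΘ, ?_, ?_⟩
  · intro w hw
    have hl := line_hasDerivAt hΘ w
    rw [hw, hasDerivAt_pi] at hl
    have lin : ∀ i : Fin m, HasDerivAt (fun t : ℝ => (t • w) i) (w i) 0 := fun i => by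
      simpa using (hasDerivAt_id (0:ℝ)).mul_const (w i)
    have lΨ : ∀ {F : R4 → ℝ}, Sm F → HasDerivAt (fun t : ℝ => F (ζ (t • w))) (fderiv ℝ F 0 (ζ w)) 0 := by
      intro F hF
      have := line_hasDerivAt hF (ζ w)
      simpa only [map_smul] using this
    have w0 : w ⟨0, i0⟩ = 0 := by
      have h1 := hl ⟨0, i0⟩
      simp only [Θ, if_true] at h1
      have dm : HasDerivAt μ (deriv μ 0) (((0:ℝ) • w) ⟨0, i0⟩) := by
        simpa using (hμ.differentiable (by simp) 0).hasDerivAt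
      have := (dm.comp (0:ℝ) (lin ⟨0, i0⟩)).unique h1
      exact (mul_eq_zero.1 this).resolve_left dμ
    have p3 : fderiv ℝ Ψ3 0 (ζ w) = 0 := by
      have h1 := hl ⟨2, i2⟩
      simp only [Θ] at h1
      norm_num at h1
      have := ((lΨ hΨ3).const_mul δ).unique h1
      exact (mul_eq_zero.1 this).resolve_left hδ
    have p4 : fderiv ℝ Ψ4 0 (ζ w) = 0 := by
      have h1 := hl ⟨3, i3⟩
      simp only [Θ] at h1
      norm_num at h1
      exact (lΨ hΨ4).unique h1
    have w1 : w ⟨1, i1⟩ = 0 := by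
      have h1 := hl ⟨1, i1⟩
      simp only [Θ, one_ne_zero, if_false, if_true, Pi.zero_apply] at h1
      have := ((((lin ⟨1, i1⟩).const_mul (-2)).const_mul α).add ((lΨ hΨ3).const_mul β)).unique h1
      rw [p3] at this
      simpa [hα] using this
    have hζw : ζ w = w ⟨2, i2⟩ • ((0, 0, 1, 0) : R4) + w ⟨3, i3⟩ • ((0, 0, 0, 1) : R4) := by
      rw [hζ, w0, w1]; simp
    have w3 : w ⟨3, i3⟩ = 0 := by
      rw [hζw, map_add, map_smul, map_smul, d4] at p4
      simpa [d4'] using p4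
    have w2 : w ⟨2, i2⟩ = 0 := by
      rw [hζw, w3, zero_smul, add_zero, map_smul] at p3
      simpa [d3] using p3
    have hζ0 : ζ w = 0 := by rw [hζ, w0, w1, w2, w3]; rfl
    funext i
    by_cases q0 : (i : ℕ) = 0
    · have : i = ⟨0, i0⟩ := Fin.ext q0
      rw [this]; exact w0
    by_cases q1 : (i : ℕ) = 1
    · have : i = ⟨1, i1⟩ := Fin.ext q1
      rw [this]; exact w1
    by_cases q2 : (i : ℕ) = 2
    · have : i = ⟨2, i2⟩ := Fin.ext q2
      rw [this]; exact w2
    by_cases q3 : (i : ℕ) = 3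
    · have : i = ⟨3, i3⟩ := Fin.ext q3
      rw [this]; exact w3
    have h1 := hl i
    simp only [Θ, q0, q1, q2, q3, if_false, Pi.zero_apply] at h1
    have := ((lin i).add (lΨ (hΨ _ (hj1 i (by omega))))).unique h1
    rw [hζ0] at this
    simpa using this
  · have hall : ∀ᶠ z in 𝓝 (0 : R2), ∀ i : Fin m, FF (c i) z = Θ (modelMap m (sg z)) i := by
      rw [eventually_all]
      intro i
      have s1 : Sm (fun x => x ^ 3 * e' x) := (contDiff_id.pow 3).mul he'
      have s2 : Sm (fun x => x ^ 4 + a * x ^ 5 + x ^ 6 * h x) :=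
        ((contDiff_id.pow 4).add (contDiff_const.mul (contDiff_id.pow 5))).add ((contDiff_id.pow 6).mul hh)
      by_cases q0 : (i : ℕ) = 0
      · obtain rfl : i = ⟨0, i0⟩ := Fin.ext q0
        have csnd : Tendsto (fun z : R2 => z.2) (𝓝 0) (𝓝 0) := continuous_snd.tendsto 0
        filter_upwards [hz1, csnd.eventually (eventually_eventually_nhds.2 c0)] with z h1 h2
        have hd : deriv (c ⟨0, i0⟩) z.2 = 1 := by
          have : c ⟨0, i0⟩ =ᶠ[𝓝 z.2] id := h2
          rw [this.deriv_eq]; simp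
        simp only [FF, hd, Θ, modelMap, if_true]
        rw [h2.self_of_nhds, ← h1]; ring
      by_cases q1 : (i : ℕ) = 1
      · obtain rfl : i = ⟨1, i1⟩ := Fin.ext q1
        filter_upwards [hz2, hz3] with z h2 h3
        rw [c1, FF_lin s1 s2 ee z, h2, h3]
        simp only [Θ, one_ne_zero, if_true, if_false, hζm]
        simp [modelMap, PP]
      by_cases q2 : (i : ℕ) = 2
      · obtain rfl : i = ⟨2, i2⟩ := Fin.ext q2
        filter_upwards [hz3] with z h3
        rw [c2, FF_lin (α := δ) (β := 0) s2 s2 (fun x => by rw [kk]; ring) z, h3]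
        simp [Θ, hζm]
      by_cases q3 : (i : ℕ) = 3
      · obtain rfl : i = ⟨3, i3⟩ := Fin.ext q3
        filter_upwards [hz4] with z h3
        rw [c3, h3]
        simp [Θ, hζm]
      have q : 4 ≤ (i : ℕ) := by omega
      filter_upwards [ePsi _ (hj1 i q)] with z hz
      rw [hj2 i q, hz]
      simp only [Θ, q0, q1, q2, q3, if_false, hζm]
      simp [modelMap, q0, q1, q2, q3]
    filter_upwards [hall] with z hz
    funext i
    exact hz i

end UM

namespace UM

theorem iterD_pow (n : ℕ) : ∀ {h : ℝ → ℝ}, Sm h →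
    iteratedDeriv n (fun x => x ^ n * h x) 0 = (n.factorial : ℝ) * h 0 := by
  induction n with
  | zero => intro h _; simp
  | succ n ih =>
    intro h hh
    have hd : deriv (fun x => x ^ (n + 1) * h x) = fun x => x ^ n * ((n + 1 : ℝ) * h x + x * deriv h x) := by
      funext x
      have h1 : HasDerivAt (fun x => x ^ (n + 1) * h x) _ x :=
        ((hasDerivAt_id x).pow (n + 1)).mul (hh.differentiable (by simp) x).hasDerivAt
      rw [h1.deriv]
      simp
      ring
    have k1 : ContDiff ℝ (⊤ : ℕ∞) h := hh
    have k2 : ContDiff ℝ (⊤ : ℕ∞) (deriv h) := sm_deriv hh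
    have k3 : ContDiff ℝ (⊤ : ℕ∞) (fun x => (n + 1 : ℝ) * h x + x * deriv h x) := by fun_prop
    rw [iteratedDeriv_succ', hd, ih k3]
    simp only [zero_mul, add_zero, Nat.factorial_succ]
    push_cast; ring

theorem vanish_factor (n : ℕ) {f : ℝ → ℝ} (hf : Sm f) (h : ∀ k < n, iteratedDeriv k f 0 = 0) :
    ∃ g : ℝ → ℝ, Sm g ∧ (∀ x, f x = x ^ n * g x) ∧ iteratedDeriv n f 0 = (n.factorial : ℝ) * g 0 := by
  have key : ∃ g : ℝ → ℝ, Sm g ∧ (∀ x, f x = x ^ n * g x) := by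
    induction n with
    | zero => exact ⟨f, hf, by simp⟩
    | succ n ih =>
      obtain ⟨g, hg, e⟩ := ih fun k hk => h k (by omega)
      have h0 : g 0 = 0 := by
        have := h n (by omega)
        rw [show f = fun x => x ^ n * g x from funext e, iterD_pow n hg] at this
        exact (mul_eq_zero.1 this).resolve_left (by exact_mod_cast n.factorial_ne_zero)
      obtain ⟨g', hg', e'⟩ := hadamard1 hg
      refine ⟨g', hg', fun x => ?_⟩
      rw [e, e', h0]; ring
  obtain ⟨g, hg, e⟩ := key
  refine ⟨g, hg, e, ?_⟩
  rw [show f = fun x => x ^ n * g x from funext e, iterD_pow n hg]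

theorem reparam {m : ℕ} (hm : 4 ≤ m) {g : Fin m → ℝ → ℝ} (hg : ∀ i, Sm (g i))
    (g00 : g ⟨0, by omega⟩ 0 = 0) (g01 : deriv (g ⟨0, by omega⟩) 0 ≠ 0)
    {e k h4 : ℝ → ℝ} (he : Sm e) (hk : Sm k) (hh4 : Sm h4) (e0 : e 0 ≠ 0) (k0 : k 0 ≠ 0) (h40 : h4 0 ≠ 0)
    (c1 : ∀ x, g ⟨1, by omega⟩ x = x ^ 3 * e x) (c2 : ∀ x, g ⟨2, by omega⟩ x = x ^ 4 * k x)
    (c3 : ∀ x, g ⟨3, by omega⟩ x = x ^ 6 * h4 x)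
    (cj : ∀ i : Fin m, 4 ≤ (i : ℕ) → ∃ h, Sm h ∧ ∀ x, g i x = x ^ 6 * h x) :
    ∃ (σ : R2 → R2) (Θ : (Fin m → ℝ) → (Fin m → ℝ)), Sm σ ∧ σ 0 = 0 ∧
      (∀ v, fderiv ℝ σ 0 v = 0 → v = 0) ∧ Sm Θ ∧ (∀ v, fderiv ℝ Θ 0 v = 0 → v = 0) ∧
      ∀ᶠ p in 𝓝 (0 : R2), (fun i => g i p.2 + p.1 * deriv (g i) p.2) = Θ (modelMap m (σ p)) := by
  have i0 : 0 < m := by omega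
  set y := g ⟨0, i0⟩ with hy
  have sy : Sm y := hg _
  obtain ⟨θ, hθ, θ0, θ1, θ2⟩ := local_inverse1 sy 0 g01
  rw [g00] at θ0 θ2
  obtain ⟨w, hw, ew⟩ := hadamard1 hθ
  obtain ⟨y1, hy1, ey⟩ := hadamard1 sy
  simp only [θ0, g00, zero_add] at ew ey
  have w0 : w 0 ≠ 0 := by
    have a1 := hw.continuous
    have a2 := hy1.continuous
    have a3 := hθ.continuous
    have := eq_of_punctured (f := fun x => w x * y1 (θ x)) (g := fun _ => 1) (a := 0)
      (by fun_prop) continuousAt_const (by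
        filter_upwards [θ2.filter_mono nhdsWithin_le_nhds, self_mem_nhdsWithin] with x hx h0
        have h0 : x ≠ 0 := h0
        refine mul_left_cancel₀ h0 ?_
        rw [ey] at hx
        calc x * (w x * y1 (θ x)) = θ x * y1 (θ x) := by rw [ew x]; ring
          _ = x * 1 := by rw [hx, mul_one])
    intro h
    simp [h] at this
  have comp_s : ∀ {f : ℝ → ℝ} (n : ℕ), Sm f → Sm (fun x => w x ^ n * f (θ x)) := fun n hf =>
    (hw.pow n).mul (hf.comp hθ)
  obtain ⟨sg, Θ, hsg, sg0, sgi, hΘ, hΘi, hev⟩ := coords hm (c := fun i x => g i (θ x)) θ2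
    (comp_s 3 he) (comp_s 4 hk) (comp_s 6 hh4) (by simp [θ0, w0, e0]) (by simp [θ0, w0, k0])
    (by simp [θ0, w0, h40]) (by funext x; simp only [c1]; rw [ew x]; ring)
    (by funext x; simp only [c2]; rw [ew x]; ring) (by funext x; simp only [c3]; rw [ew x]; ring)
    (by
      intro i hi
      obtain ⟨h, hh, eh⟩ := cj i hi
      refine ⟨_, comp_s 6 hh, ?_⟩
      funext x; simp only [eh]; rw [ew x]; ring)
  let φ : R2 → R2 := fun p => (y p.2 + p.1 * deriv y p.2, y p.2)
  have hφ : ContDiff ℝ (⊤ : ℕ∞) φ := by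
    have k1 : ContDiff ℝ (⊤ : ℕ∞) y := sy
    have k2 : ContDiff ℝ (⊤ : ℕ∞) (deriv y) := sm_deriv sy
    unfold φ; fun_prop
  have φ0 : φ 0 = 0 := by simp [φ, g00]
  have hφi : ∀ v, fderiv ℝ φ 0 v = 0 → v = 0 := by
    rintro ⟨a, b⟩ hv
    have hl : fderiv ℝ φ 0 (a, b) = (b * deriv y 0 + a * deriv y 0, b * deriv y 0) := by
      refine fderiv_eq_of_line hφ _ _ ?_
      have h1 : HasDerivAt (fun t : ℝ => t * b) b 0 := by
        simpa using (hasDerivAt_id (0:ℝ)).mul_const b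
      have h1a : HasDerivAt (fun t : ℝ => t * a) a 0 := by
        simpa using (hasDerivAt_id (0:ℝ)).mul_const a
      have dy : HasDerivAt y (deriv y 0) (0 * b) := by
        simpa using (sy.differentiable (by simp) 0).hasDerivAt
      have ddy : HasDerivAt (deriv y) (deriv (deriv y) 0) (0 * b) := by
        simpa using ((sm_deriv sy).differentiable (by simp) 0).hasDerivAt
      have h2 := dy.comp (0:ℝ) h1
      have h3 := h1a.mul (ddy.comp (0:ℝ) h1)
      have h4 := (h2.add h3).prodMk h2
      refine (h4.congr_of_eventuallyEq (Eventually.of_forall fun t => ?_)).congr_deriv ?_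
      · simp [φ]
      · simp; ring
    rw [hl, Prod.mk_eq_zero] at hv
    obtain ⟨q1, q2⟩ := hv
    have hb := (mul_eq_zero.1 q2).resolve_right g01
    rw [hb, zero_mul, zero_add] at q1
    have ha := (mul_eq_zero.1 q1).resolve_right g01
    rw [ha, hb]; rfl
  refine ⟨fun p => sg (φ p), Θ, hsg.comp hφ, by simp only [φ0, sg0], ?_, hΘ, hΘi, ?_⟩
  · intro v hv
    have h1 := (hsg.hasFDerivAt (φ 0)).comp 0 (hφ.differentiable (by simp) 0).hasFDerivAt
    have h2 : HasFDerivAt (fun p => sg (φ p)) _ 0 := h1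
    rw [h2.fderiv, φ0] at hv
    exact hφi v (sgi _ hv)
  · have tφ : Tendsto φ (𝓝 0) (𝓝 0) := by
      have := hφ.continuous.tendsto 0; rwa [φ0] at this
    have csnd : Tendsto (fun z : R2 => z.2) (𝓝 0) (𝓝 0) := continuous_snd.tendsto 0
    filter_upwards [tφ.eventually hev, csnd.eventually (eventually_eventually_nhds.2 θ1)] with p h1 h2
    rw [← h1]
    funext i
    have s1 := (hg i).comp hθ
    have hd1 : HasDerivAt (fun x => g i (θ x)) (deriv (fun x => g i (θ x)) (y p.2)) (y p.2) :=
      (s1.differentiable (by simp) (y p.2)).hasDerivAt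
    have hd2 := hd1.comp p.2 (sy.differentiable (by simp) p.2).hasDerivAt
    have hd3 : HasDerivAt (g i) (deriv (fun x => g i (θ x)) (y p.2) * deriv y p.2) p.2 := by
      refine hd2.congr_of_eventuallyEq ?_
      filter_upwards [h2] with t ht
      simp only [Function.comp, ht]
    simp only [FF, φ]
    rw [hd3.deriv, h2.self_of_nhds]
    ring

end UM

namespace UM

theorem basis_ext {m : ℕ} (hm : 4 ≤ m) {v : Fin 4 → (Fin m → ℝ)} (hv : LinearIndependent ℝ v) :
    ∃ b : Module.Basis (Fin m) ℝ (Fin m → ℝ), ∀ i : Fin 4, b ⟨i, by omega⟩ = v i := by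
  classical
  let B := Module.Basis.sumExtend hv
  have hB : ∀ i, B (Sum.inl i) = v i := by
    intro i
    simp only [B, Module.Basis.sumExtend, Module.Basis.reindex_apply, Module.Basis.coe_extend, Equiv.symm_symm]
    rfl
  haveI : Fintype (Fin 4 ⊕ Module.Basis.sumExtendIndex hv) := FiniteDimensional.fintypeBasisIndex B
  haveI : Fintype (Module.Basis.sumExtendIndex hv) :=
    Fintype.ofInjective (Sum.inr : _ → Fin 4 ⊕ Module.Basis.sumExtendIndex hv) Sum.inr_injective
  have hc : Fintype.card (Module.Basis.sumExtendIndex hv) = m - 4 := by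
    have h1 := Module.finrank_eq_card_basis B
    have h2 : Fintype.card (Fin 4 ⊕ Module.Basis.sumExtendIndex hv) = 4 + Fintype.card (Module.Basis.sumExtendIndex hv) := by
      rw [← Nat.card_eq_fintype_card, ← Nat.card_eq_fintype_card, Nat.card_sum, Nat.card_fin]
    rw [h2] at h1
    simp at h1
    simp [← Nat.card_eq_fintype_card] at h1 ⊢
    omega
  let eq1 : Module.Basis.sumExtendIndex hv ≃ Fin (m - 4) := Fintype.equivFinOfCardEq hc
  let E : Fin 4 ⊕ Module.Basis.sumExtendIndex hv ≃ Fin m :=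
    ((Equiv.sumCongr (Equiv.refl _) eq1).trans finSumFinEquiv).trans (finCongr (by omega))
  refine ⟨B.reindex E, fun i => ?_⟩
  rw [Module.Basis.reindex_apply, ← hB]
  congr 1
  rw [Equiv.symm_apply_eq]
  ext; simp [E]

theorem iterD_clm {F : Type} [NormedAddCommGroup F] [NormedSpace ℝ F] (L : F →L[ℝ] ℝ) (k : ℕ) :
    ∀ {f : ℝ → F}, Sm f → iteratedDeriv k (fun t => L (f t)) 0 = L (iteratedDeriv k f 0) := by
  induction k with
  | zero => intro f _; simp
  | succ k ih =>
    intro f hf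
    have hd : deriv (fun t => L (f t)) = fun t => L (deriv f t) := by
      funext t
      exact (L.hasFDerivAt.comp_hasDerivAt t (hf.differentiable (by simp) t).hasDerivAt).deriv
    have hs : Sm (deriv f) := by
      have h : ContDiff ℝ ((⊤ : ℕ∞) + 1) f := hf
      exact (contDiff_succ_iff_deriv.1 h).2.2
    rw [iteratedDeriv_succ', iteratedDeriv_succ', hd, ih hs]

theorem type_indep {V : Type} [AddCommGroup V] [Module ℝ V] [FiniteDimensional ℝ V]
    {D1 D2 D3 D4 D5 D6 : V}
    (h2 : D2 ∈ Submodule.span ℝ ({D1} : Set V))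
    (h4 : Module.finrank ℝ ↥(Submodule.span ℝ ({D1, D2, D3, D4} : Set V)) = 3)
    (h5 : Module.finrank ℝ ↥(Submodule.span ℝ ({D1, D2, D3, D4, D5} : Set V)) = 3)
    (h6 : Module.finrank ℝ ↥(Submodule.span ℝ ({D1, D2, D3, D4, D5, D6} : Set V)) = 4) :
    LinearIndependent ℝ ![D1, D3, D4, D6] ∧ D5 ∈ Submodule.span ℝ ({D1, D3, D4} : Set V) := by
  have hle : Submodule.span ℝ ({D1, D2, D3, D4} : Set V) ≤ Submodule.span ℝ ({D1, D3, D4} : Set V) := by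
    rw [Submodule.span_le]
    rintro x (rfl | rfl | rfl | rfl)
    · exact Submodule.subset_span (by simp)
    · exact Submodule.span_mono (by simp) h2
    · exact Submodule.subset_span (by simp)
    · exact Submodule.subset_span (by simp)
  have h45 : Submodule.span ℝ ({D1, D2, D3, D4} : Set V) = Submodule.span ℝ ({D1, D2, D3, D4, D5} : Set V) := by
    apply Submodule.eq_of_le_of_finrank_eq
    · apply Submodule.span_mono
      intro x hx
      simp only [Set.mem_insert_iff, Set.mem_singleton_iff] at hx ⊢
      tauto
    · rw [h4, h5]
  have h5m : D5 ∈ Submodule.span ℝ ({D1, D3, D4} : Set V) := by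
    apply hle
    rw [h45]
    exact Submodule.subset_span (by simp)
  refine ⟨?_, h5m⟩
  rw [linearIndependent_iff_card_le_finrank_span]
  have hr : Set.range ![D1, D3, D4, D6] = {D1, D3, D4, D6} := by
    ext x
    simp [Fin.exists_fin_succ, eq_comm]
    tauto
  have h6le : Submodule.span ℝ ({D1, D2, D3, D4, D5, D6} : Set V) ≤ Submodule.span ℝ ({D1, D3, D4, D6} : Set V) := by
    rw [Submodule.span_le]
    rintro x (rfl | rfl | rfl | rfl | rfl | rfl)
    · exact Submodule.subset_span (by simp)
    · exact Submodule.span_mono (by simp) h2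
    · exact Submodule.subset_span (by simp)
    · exact Submodule.subset_span (by simp)
    · refine Submodule.span_mono ?_ h5m
      intro x hx
      simp only [Set.mem_insert_iff, Set.mem_singleton_iff] at hx ⊢
      tauto
    · exact Submodule.subset_span (by simp)
  rw [hr, Set.finrank, Fintype.card_fin]
  change 4 ≤ _
  rw [← h6]
  exact Submodule.finrank_mono h6le

theorem final (m : ℕ) (hm : 4 ≤ m) (γ : ℝ → Fin m → ℝ) (hγ : ContDiff ℝ (⊤ : ℕ∞) γ)
    {b : Module.Basis (Fin m) ℝ (Fin m → ℝ)}
    (b0 : b ⟨0, by omega⟩ = iteratedDeriv 1 γ 0) (b1 : b ⟨1, by omega⟩ = iteratedDeriv 3 γ 0)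
    (b2 : b ⟨2, by omega⟩ = iteratedDeriv 4 γ 0) (b3 : b ⟨3, by omega⟩ = iteratedDeriv 6 γ 0)
    (h2 : iteratedDeriv 2 γ 0 ∈ Submodule.span ℝ ({iteratedDeriv 1 γ 0} : Set (Fin m → ℝ)))
    (h5 : iteratedDeriv 5 γ 0 ∈ Submodule.span ℝ ({iteratedDeriv 1 γ 0, iteratedDeriv 3 γ 0, iteratedDeriv 4 γ 0} : Set (Fin m → ℝ))) :
    GermEquiv (fun p : ℝ × ℝ => γ p.2 + p.1 • deriv γ p.2) (0 : ℝ × ℝ) (modelMap m) (0 : ℝ × ℝ) := by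
  let L : Fin m → ((Fin m → ℝ) →L[ℝ] ℝ) := fun i => LinearMap.toContinuousLinearMap (b.coord i)
  have Lb : ∀ i j, L i (b j) = if j = i then 1 else 0 := by
    intro i j
    simp [L, Finsupp.single_apply]
  let g : Fin m → ℝ → ℝ := fun i t => L i (γ t - γ 0)
  have hs : ContDiff ℝ (⊤ : ℕ∞) (fun t => γ t - γ 0) := hγ.sub contDiff_const
  have hg : ∀ i, Sm (g i) := fun i => (L i).contDiff.comp hs
  have g0 : ∀ i, g i 0 = 0 := fun i => by simp [g]
  have hD : ∀ i k, iteratedDeriv (k + 1) (g i) 0 = L i (iteratedDeriv (k + 1) γ 0) := by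
    intro i k
    rw [show g i = fun t => L i ((fun t => γ t - γ 0) t) from rfl, iterD_clm (L i) (k + 1) hs]
    congr 1
    rw [iteratedDeriv_succ', iteratedDeriv_succ']
    congr 1
    funext t
    simp
  have hder : ∀ i t, deriv (g i) t = L i (deriv γ t) := by
    intro i t
    have hd : HasDerivAt (fun t => γ t - γ 0) (deriv γ t) t :=
      (hγ.differentiable (by simp) t).hasDerivAt.sub_const _
    exact ((L i).hasFDerivAt.comp_hasDerivAt t hd).deriv
  have k1 : ∀ i : Fin m, iteratedDeriv 1 (g i) 0 = if (i : ℕ) = 0 then 1 else 0 := by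
    intro i; rw [hD i 0, zero_add, ← b0, Lb]; simp [Fin.ext_iff, eq_comm]
  have k3 : ∀ i : Fin m, iteratedDeriv 3 (g i) 0 = if (i : ℕ) = 1 then 1 else 0 := by
    intro i; rw [hD i 2, ← b1, Lb]; simp [Fin.ext_iff, eq_comm]
  have k4 : ∀ i : Fin m, iteratedDeriv 4 (g i) 0 = if (i : ℕ) = 2 then 1 else 0 := by
    intro i; rw [hD i 3, ← b2, Lb]; simp [Fin.ext_iff, eq_comm]
  have k6 : ∀ i : Fin m, iteratedDeriv 6 (g i) 0 = if (i : ℕ) = 3 then 1 else 0 := by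
    intro i; rw [hD i 5, ← b3, Lb]; simp [Fin.ext_iff, eq_comm]
  have k2 : ∀ i : Fin m, (i : ℕ) ≠ 0 → iteratedDeriv 2 (g i) 0 = 0 := by
    intro i hi
    have hk := k1 i
    rw [hD i 0, if_neg hi] at hk
    rw [hD i 1]
    obtain ⟨a, ha⟩ := Submodule.mem_span_singleton.1 h2
    rw [← ha, map_smul]
    simp only [zero_add] at hk
    rw [hk, smul_zero]
  have k5 : ∀ i : Fin m, 3 ≤ (i : ℕ) → iteratedDeriv 5 (g i) 0 = 0 := by
    intro i hi
    have q1 := k1 i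
    have q3 := k3 i
    have q4 := k4 i
    rw [hD i 0, if_neg (by omega)] at q1
    rw [hD i 2, if_neg (by omega)] at q3
    rw [hD i 3, if_neg (by omega)] at q4
    rw [hD i 4]
    have hle : Submodule.span ℝ ({iteratedDeriv 1 γ 0, iteratedDeriv 3 γ 0, iteratedDeriv 4 γ 0} : Set (Fin m → ℝ)) ≤ LinearMap.ker (L i : (Fin m → ℝ) →ₗ[ℝ] ℝ) := by
      rw [Submodule.span_le]
      rintro x (rfl | rfl | rfl)
      · exact q1
      · exact q3
      · exact q4
    exact hle h5
  obtain ⟨e, he, c1, e0⟩ := vanish_factor 3 (hg ⟨1, by omega⟩) (by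
    intro k hk
    interval_cases k
    · simpa using g0 _
    · simp [k1]
    · exact k2 _ (by simp))
  obtain ⟨kk, hkk, c2, kk0⟩ := vanish_factor 4 (hg ⟨2, by omega⟩) (by
    intro k hk
    interval_cases k
    · simpa using g0 _
    · simp [k1]
    · exact k2 _ (by simp)
    · simp [k3])
  have six : ∀ i : Fin m, 3 ≤ (i : ℕ) → ∀ k < 6, iteratedDeriv k (g i) 0 = 0 := by
    intro i hi k hk
    interval_cases k
    · simpa using g0 _
    · rw [k1, if_neg (by omega)]
    · exact k2 _ (by omega)
    · rw [k3, if_neg (by omega)]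
    · rw [k4, if_neg (by omega)]
    · exact k5 _ hi
  obtain ⟨h4, hh4, c3, h40⟩ := vanish_factor 6 (hg ⟨3, by omega⟩) (six _ (by simp))
  rw [k3] at e0
  rw [k4] at kk0
  rw [k6] at h40
  have g01 : deriv (g ⟨0, by omega⟩) 0 ≠ 0 := by
    rw [← iteratedDeriv_one, k1]; simp
  obtain ⟨σ, Θ, sσ, σ0, σi, sΘ, Θi, hev⟩ := reparam hm hg (g0 _) g01 he hkk hh4
    (by intro h; rw [h] at e0; simp at e0) (by intro h; rw [h] at kk0; simp at kk0)
    (by intro h; rw [h] at h40; simp at h40) c1 c2 c3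
    (by
      intro i hi
      obtain ⟨h, a1, a2, _⟩ := vanish_factor 6 (hg i) (six i (by omega))
      exact ⟨h, a1, a2⟩)
  let S : (Fin m → ℝ) ≃L[ℝ] (Fin m → ℝ) := b.equivFun.symm.toContinuousLinearEquiv
  have hΛ : ContDiff ℝ (⊤ : ℕ∞) (fun z => γ 0 + S (Θ z)) :=
    contDiff_const.add (S.contDiff.comp sΘ)
  refine germEquiv_of (σ := σ) (Λ := fun z => γ 0 + S (Θ z)) sσ hΛ σ0 ?_ σi ?_ ?_ ?_
  · funext i; simp [modelMap]
  · intro v hv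
    have hd : HasFDerivAt (fun z => γ 0 + S (Θ z)) ((S : (Fin m → ℝ) →L[ℝ] (Fin m → ℝ)).comp (fderiv ℝ Θ 0)) 0 :=
      (S.hasFDerivAt.comp (0 : Fin m → ℝ) (sΘ.differentiable (by simp) 0).hasFDerivAt).const_add _
    rw [hd.fderiv] at hv
    apply Θi
    exact S.injective (by simpa using hv)
  · refine Continuous.continuousAt (continuous_pi fun i => ?_)
    unfold modelMap
    split_ifs <;> fun_prop
  · filter_upwards [hev] with p hp
    show _ = γ 0 + S (Θ (modelMap m (σ p)))
    rw [← hp]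
    have hS : S (fun i => g i p.2 + p.1 * deriv (g i) p.2) = γ p.2 - γ 0 + p.1 • deriv γ p.2 := by
      show b.equivFun.symm _ = _
      rw [LinearEquiv.symm_apply_eq]
      funext i
      rw [hder]
      simp [g, L]
    rw [hS]
    abel

end UM

/-- In `ℝ^m`, `m ≥ 4`, the tangent variety to a finite-type curve `γ` of type
`(1,3,4,6,a₅,…,a_m)` at `0` is locally diffeomorphic to the unfurled Mond surface
`(u, x) ↦ (u, x³ + ux², (3/4)x⁴ + (2/3)ux³, (1/2)x⁶ + (2/5)ux⁵, 0, …, 0)`;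
in particular the diffeomorphism class of such a tangent variety is unique. -/
theorem tangent_variety_type_1346_unfurled_Mond_surface
    (m : ℕ) (hm : 4 ≤ m)
    (γ : ℝ → Fin m → ℝ) (hγ : ContDiff ℝ (⊤ : ℕ∞) γ)
    (hfin : Submodule.span ℝ
      (Set.range fun k : ℕ => iteratedDeriv (k + 1) γ 0) = (⊤ : Submodule ℝ (Fin m → ℝ)))
    (h1 : deriv γ 0 ≠ 0)
    (h2 : iteratedDeriv 2 γ 0 ∈ Submodule.span ℝ ({iteratedDeriv 1 γ 0} : Set (Fin m → ℝ)))
    (h3 : Module.finrank ℝ ↥(Submodule.span ℝ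
      ({iteratedDeriv 1 γ 0, iteratedDeriv 2 γ 0, iteratedDeriv 3 γ 0} : Set (Fin m → ℝ))) = 2)
    (h4 : Module.finrank ℝ ↥(Submodule.span ℝ
      ({iteratedDeriv 1 γ 0, iteratedDeriv 2 γ 0, iteratedDeriv 3 γ 0,
        iteratedDeriv 4 γ 0} : Set (Fin m → ℝ))) = 3)
    (h5 : Module.finrank ℝ ↥(Submodule.span ℝ
      ({iteratedDeriv 1 γ 0, iteratedDeriv 2 γ 0, iteratedDeriv 3 γ 0,
        iteratedDeriv 4 γ 0, iteratedDeriv 5 γ 0} : Set (Fin m → ℝ))) = 3)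
    (h6 : Module.finrank ℝ ↥(Submodule.span ℝ
      ({iteratedDeriv 1 γ 0, iteratedDeriv 2 γ 0, iteratedDeriv 3 γ 0,
        iteratedDeriv 4 γ 0, iteratedDeriv 5 γ 0, iteratedDeriv 6 γ 0} : Set (Fin m → ℝ))) = 4) :
    GermEquiv (fun p : ℝ × ℝ => γ p.2 + p.1 • deriv γ p.2) (0 : ℝ × ℝ)
      (fun p : ℝ × ℝ => fun i : Fin m =>
        if (i : ℕ) = 0 then p.1
        else if (i : ℕ) = 1 then p.2 ^ 3 + p.1 * p.2 ^ 2
        else if (i : ℕ) = 2 then (3/4) * p.2 ^ 4 + (2/3) * p.1 * p.2 ^ 3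
        else if (i : ℕ) = 3 then (1/2) * p.2 ^ 6 + (2/5) * p.1 * p.2 ^ 5
        else 0) (0 : ℝ × ℝ) := by
  obtain ⟨hv, h5m⟩ := UM.type_indep h2 h4 h5 h6
  obtain ⟨b, hb⟩ := UM.basis_ext hm hv
  exact UM.final m hm γ hγ (hb 0) (hb 1) (hb 2) (hb 3) h2 h5m
end

section
/- Let N ≥ 1 and let a₁ < a₂ < … < a_{N+1} be strictly increasing positive integers such that ∑_{i=1}^{N+1} (a_i − i) ≤ N·(a₁ − 1) + 1. Then the sequence (a₁, …, a_{N+1}) is one of: (1, 2, …, N, N+1), (1, 2, …, N, N+2), or (2, 3, …, N+1, N+2). (This is the combinatorial content of the classification of types of generic tangent-framed curves.) -/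
/-- A strictly increasing sequence of positive integers `a₁ < … < a_{N+1}` with
`∑ (a_i − i) ≤ N(a₁ − 1) + 1` is `(1, …, N, N+1)`, `(1, …, N, N+2)` or
`(2, 3, …, N+1, N+2)`: the types of generic tangent-framed curves. -/
theorem generic_tangent_framed_types (N : ℕ) (hN : 1 ≤ N) (a : ℕ → ℕ)
    (hpos : 1 ≤ a 1)
    (hmono : ∀ i, 1 ≤ i → i ≤ N → a i < a (i + 1))
    (hsum : ∑ i ∈ Finset.Icc 1 (N + 1), (a i - i) ≤ N * (a 1 - 1) + 1) :
    (∀ i, 1 ≤ i → i ≤ N + 1 → a i = i) ∨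
    ((∀ i, 1 ≤ i → i ≤ N → a i = i) ∧ a (N + 1) = N + 2) ∨
    (∀ i, 1 ≤ i → i ≤ N + 1 → a i = i + 1) := by
  have key : ∀ i, 1 ≤ i → ∀ j, i ≤ j → j ≤ N + 1 → a i + j ≤ a j + i := by
    intro i hi j hij
    induction j, hij using Nat.le_induction with
    | base => intro _; omega
    | succ j hj ih =>
      intro h
      have h1 := ih (by omega)
      have h2 := hmono j (by omega) (by omega)
      omega
  obtain ⟨M, rfl⟩ : ∃ M, N = M + 1 := ⟨N - 1, by omega⟩
  rw [Finset.sum_Icc_succ_top (by omega), Finset.sum_Icc_succ_top (by omega)] at hsum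
  have hlow : M * (a 1 - 1) ≤ ∑ i ∈ Finset.Icc 1 M, (a i - i) := by
    have h := Finset.card_nsmul_le_sum (Finset.Icc 1 M) (fun i => a i - i) (a 1 - 1) (by
      intro i hi
      rw [Finset.mem_Icc] at hi
      have := key 1 le_rfl i hi.1 (by omega)
      show a 1 - 1 ≤ a i - i
      omega)
    simpa using h
  rw [Nat.add_mul] at hsum
  have k1 := key 1 le_rfl (M + 1) (by omega) (by omega)
  have k2 := key (M + 1) (by omega) (M + 1 + 1) (by omega) (by omega)
  by_cases hm : a 1 = 1
  · have hMl : a (M + 1) = M + 1 := by omega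
    have hall : ∀ i, 1 ≤ i → i ≤ M + 1 → a i = i := by
      intro i h1 h2
      have u1 := key 1 le_rfl i h1 (by omega)
      have u2 := key i h1 (M + 1) h2 (by omega)
      omega
    by_cases hl : a (M + 1 + 1) = M + 1 + 1
    · left
      intro i h1 h2
      rcases Nat.lt_or_ge i (M + 1 + 1) with h | h
      · exact hall i h1 (by omega)
      · obtain rfl : i = M + 1 + 1 := by omega
        exact hl
    · right; left
      exact ⟨hall, by omega⟩
  · right; right
    intro i h1 h2
    have u1 := key 1 le_rfl i h1 h2
    have u2 := key i h1 (M + 1 + 1) h2 le_rfl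
    omega
end

section
/- Let N ≥ 2 and let a₁ < a₂ < … < a_{N+1} be strictly increasing positive integers such that ∑_{i=2}^{N+1} (a_i − i) ≤ (N−1)·(a₂ − 2) + 1. Then the sequence (a₁, …, a_{N+1}) is one of: (1, 2, …, N, N+1), (1, 2, …, N, N+2), (1, 3, 4, …, N+1, N+2), or (2, 3, 4, …, N+1, N+2). (This is the combinatorial content of the classification of types of generic tangent-principal-normal-framed curves.) -/
/-- A strictly increasing sequence of positive integers `a₁ < … < a_{N+1}` with
`∑_{i=2}^{N+1} (a_i − i) ≤ (N−1)(a₂ − 2) + 1` is `(1, …, N, N+1)`, `(1, …, N, N+2)`,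
`(1, 3, 4, …, N+1, N+2)` or `(2, 3, …, N+1, N+2)`:
the types of generic tangent-principal-normal-framed curves. -/
theorem generic_tpn_framed_types (N : ℕ) (hN : 2 ≤ N) (a : ℕ → ℕ)
    (hpos : 1 ≤ a 1)
    (hmono : ∀ i, 1 ≤ i → i ≤ N → a i < a (i + 1))
    (hsum : ∑ i ∈ Finset.Icc 2 (N + 1), (a i - i) ≤ (N - 1) * (a 2 - 2) + 1) :
    (∀ i, 1 ≤ i → i ≤ N + 1 → a i = i) ∨
    ((∀ i, 1 ≤ i → i ≤ N → a i = i) ∧ a (N + 1) = N + 2) ∨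
    (a 1 = 1 ∧ ∀ i, 2 ≤ i → i ≤ N + 1 → a i = i + 1) ∨
    (∀ i, 1 ≤ i → i ≤ N + 1 → a i = i + 1) := by
  have hm : ∀ i k, 1 ≤ i → i + k ≤ N + 1 → a i + k ≤ a (i + k) := by
    intro i k hi
    induction k with
    | zero => intro _; simp
    | succ k ih =>
      intro h
      have h1 := ih (by omega)
      have h2 := hmono (i + k) (by omega) (by omega)
      have h3 : i + (k + 1) = i + k + 1 := by ring
      rw [h3]
      omega
  have hmm : ∀ i j, 1 ≤ i → i ≤ j → j ≤ N + 1 → a i + (j - i) ≤ a j := by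
    intro i j hi hij hj
    have h := hm i (j - i) hi (by omega)
    rwa [Nat.add_sub_cancel' hij] at h
  rw [Finset.sum_Icc_succ_top (by omega)] at hsum
  have hlow : (N - 1) * (a 2 - 2) ≤ ∑ i ∈ Finset.Icc 2 N, (a i - i) := by
    have h := Finset.card_nsmul_le_sum (Finset.Icc 2 N) (fun i => a i - i) (a 2 - 2) (by
      intro i hi
      rw [Finset.mem_Icc] at hi
      have := hmm 2 i (by omega) hi.1 (by omega)
      show a 2 - 2 ≤ a i - i
      omega)
    have hc : (Finset.Icc 2 N).card = N - 1 := by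
      rw [Nat.card_Icc]
      omega
    rwa [hc, smul_eq_mul] at h
  have hN' : a N - N ≤ ∑ i ∈ Finset.Icc 2 N, (a i - i) :=
    Finset.single_le_sum (f := fun i => a i - i) (fun _ _ => Nat.zero_le _)
      (Finset.mem_Icc.2 ⟨hN, le_rfl⟩)
  have hlast : a (N + 1) - (N + 1) ≤ 1 := by omega
  have h12 := hmm 1 2 (by omega) (by omega) (by omega)
  have h2l := hmm 2 (N + 1) (by omega) (by omega) (by omega)
  rcases Nat.lt_or_ge 2 (a 2) with h3 | h3
  · have hall : ∀ i, 2 ≤ i → i ≤ N + 1 → a i = i + 1 := by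
      intro i h1 h2
      have := hmm 2 i (by omega) h1 h2
      have := hmm i (N + 1) (by omega) h2 (by omega)
      omega
    have h22 := hall 2 (by omega) (by omega)
    rcases Nat.lt_or_ge 1 (a 1) with h4 | h4
    · right; right; right
      intro i h1 h2
      rcases Nat.lt_or_ge 1 i with h5 | h5
      · exact hall i h5 h2
      · obtain rfl : i = 1 := by omega
        omega
    · right; right; left
      exact ⟨by omega, hall⟩
  · have hd : a 2 - 2 = 0 := by omega
    rw [hd, Nat.mul_zero] at hsum
    have hNN := hmm N (N + 1) (by omega) (by omega) (by omega)
    have hall : ∀ i, 1 ≤ i → i ≤ N → a i = i := by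
      intro i h1 h2
      have := hmm 1 i (by omega) h1 (by omega)
      have := hmm i N h1 h2 (by omega)
      omega
    have h1N := hmm 1 (N + 1) (by omega) (by omega) (by omega)
    rcases Nat.lt_or_ge (N + 1) (a (N + 1)) with h4 | h4
    · right; left
      exact ⟨hall, by omega⟩
    · left
      intro i h1 h2
      rcases Nat.lt_or_ge N i with h5 | h5
      · obtain rfl : i = N + 1 := by omega
        omega
      · exact hall i h1 h5
end

section
/- Let m ≥ 2, let x₁, …, x_m : ℝ → ℝ, α : ℝ → ℝ, and ξ₁, …, ξ_m : ℝ → ℝ be C^∞ functions satisfying x_i'(t) = α(t)·ξ_i(t) for all t and all i. Define f_i : ℝ² → ℝ by f_i(s,t) = x_i(t) + s·ξ_i(t), and for i, j define the Wronskian W_{ij}(t) = x_i'(t)·x_j''(t) − x_i''(t)·x_j'(t). Then for every i with 1 ≤ i ≤ m and every (s,t) ∈ ℝ², the total differentials satisfy W₁₂(t)·df_i(s,t) = W_{i2}(t)·df₁(s,t) + W_{1i}(t)·df₂(s,t) as linear maps ℝ² → ℝ; equivalently, W₁₂(t)·∂f_i/∂s = W_{i2}(t)·∂f₁/∂s + W_{1i}(t)·∂f₂/∂s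 and W₁₂(t)·∂f_i/∂t = W_{i2}(t)·∂f₁/∂t + W_{1i}(t)·∂f₂/∂t at every (s,t). -/
/-- The Wronskian identity for the tangent variety to a curve: if `x_i' = α · ξ_i` and
`f_i(s,t) = x_i(t) + s·ξ_i(t)`, then with `W_{ij} = x_i' x_j'' − x_i'' x_j'` one has
`W₁₂ · df_i = W_{i2} · df₁ + W_{1i} · df₂` at every point. -/
theorem wronskian_tangent_identity
    (m : ℕ) (hm : 2 ≤ m)
    (x ξ : ℕ → ℝ → ℝ) (α : ℝ → ℝ)
    (hx : ∀ i, 1 ≤ i → i ≤ m → ContDiff ℝ (⊤ : ℕ∞) (x i))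
    (hξ : ∀ i, 1 ≤ i → i ≤ m → ContDiff ℝ (⊤ : ℕ∞) (ξ i))
    (hα : ContDiff ℝ (⊤ : ℕ∞) α)
    (hder : ∀ i, 1 ≤ i → i ≤ m → ∀ t, deriv (x i) t = α t * ξ i t) :
    ∀ i, 1 ≤ i → i ≤ m → ∀ s t : ℝ,
      (deriv (x 1) t * iteratedDeriv 2 (x 2) t - iteratedDeriv 2 (x 1) t * deriv (x 2) t) •
          fderiv ℝ (fun p : ℝ × ℝ => x i p.2 + p.1 * ξ i p.2) (s, t)
        = (deriv (x i) t * iteratedDeriv 2 (x 2) t - iteratedDeriv 2 (x i) t * deriv (x 2) t) •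
            fderiv ℝ (fun p : ℝ × ℝ => x 1 p.2 + p.1 * ξ 1 p.2) (s, t)
          + (deriv (x 1) t * iteratedDeriv 2 (x i) t - iteratedDeriv 2 (x 1) t * deriv (x i) t) •
            fderiv ℝ (fun p : ℝ × ℝ => x 2 p.2 + p.1 * ξ 2 p.2) (s, t) := by
  have hxd : ∀ j, 1 ≤ j → j ≤ m → ∀ t, HasDerivAt (x j) (α t * ξ j t) t := by
    intro j h1 h2 t
    rw [← hder j h1 h2 t]
    exact (((hx j h1 h2).differentiable (by simp)) t).hasDerivAt
  have hξd : ∀ j, 1 ≤ j → j ≤ m → ∀ t, HasDerivAt (ξ j) (deriv (ξ j) t) t := by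
    intro j h1 h2 t
    exact (((hξ j h1 h2).differentiable (by simp)) t).hasDerivAt
  have hαd : ∀ t, HasDerivAt α (deriv α t) t := fun t =>
    ((hα.differentiable (by simp)) t).hasDerivAt
  have h2d : ∀ j, 1 ≤ j → j ≤ m → ∀ t,
      iteratedDeriv 2 (x j) t = deriv α t * ξ j t + α t * deriv (ξ j) t := by
    intro j h1 h2 t
    have e : deriv (x j) = fun t => α t * ξ j t := funext (hder j h1 h2)
    rw [iteratedDeriv_succ, iteratedDeriv_one, e]
    exact ((hαd t).mul (hξd j h1 h2 t)).deriv
  have hf : ∀ j, 1 ≤ j → j ≤ m → ∀ s t : ℝ, ∀ v : ℝ × ℝ,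
      fderiv ℝ (fun p : ℝ × ℝ => x j p.2 + p.1 * ξ j p.2) (s, t) v
        = ξ j t * v.1 + (α t * ξ j t + s * deriv (ξ j) t) * v.2 := by
    intro j h1 h2 s t v
    have hs : HasFDerivAt (fun p : ℝ × ℝ => p.2) (ContinuousLinearMap.snd ℝ ℝ ℝ) (s, t) :=
      hasFDerivAt_snd
    have hfst : HasFDerivAt (fun p : ℝ × ℝ => p.1) (ContinuousLinearMap.fst ℝ ℝ ℝ) (s, t) :=
      hasFDerivAt_fst
    have a := HasDerivAt.comp_hasFDerivAt (s, t) (hxd j h1 h2 t) hs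
    have b := HasDerivAt.comp_hasFDerivAt (s, t) (hξd j h1 h2 t) hs
    have c := (a.add (hfst.mul b)).fderiv
    have c' := congrArg (fun L : ℝ × ℝ →L[ℝ] ℝ => L v) c
    refine Eq.trans c' ?_
    simp
    ring
  intro i h1 h2 s t
  have l1 : 1 ≤ m := by omega
  ext1 <;> ext1 <;>
  · simp only [ContinuousLinearMap.comp_apply, ContinuousLinearMap.add_apply,
      ContinuousLinearMap.smul_apply, smul_eq_mul, hf i h1 h2, hf 1 le_rfl l1,
      hf 2 one_le_two hm, h2d i h1 h2, h2d 1 le_rfl l1, h2d 2 one_le_two hm,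
      hder i h1 h2, hder 1 le_rfl l1, hder 2 one_le_two hm]
    ring
end

section
/- Let λ, μ, ν : ℝ → ℝ be C^∞ functions satisfying μ'(t) = ν(t)·λ'(t) − λ(t)·ν'(t) for all t (i.e. the curve (λ, μ, ν) is integral for the contact form dμ − ν dλ + λ dν). Then for every t, the determinant of the 3×3 matrix with rows (λ'(t), μ'(t), ν'(t)), (λ''(t), μ''(t), ν''(t)), (λ'''(t), μ'''(t), ν'''(t)) equals (λ'(t)·ν''(t) − λ''(t)·ν'(t))². -/
/-- For a contact-integral curve `(λ, μ, ν)` in `ℝ³` (i.e. `μ' = νλ' − λν'`), the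
determinant of the matrix of the first three derivatives equals `(λ'ν'' − λ''ν')²`. -/
theorem contact_integral_det_identity
    (l μ ν : ℝ → ℝ)
    (hl : ContDiff ℝ (⊤ : ℕ∞) l) (hμ : ContDiff ℝ (⊤ : ℕ∞) μ) (hν : ContDiff ℝ (⊤ : ℕ∞) ν)
    (hcontact : ∀ t, deriv μ t = ν t * deriv l t - l t * deriv ν t) :
    ∀ t : ℝ,
      Matrix.det !![deriv l t, deriv μ t, deriv ν t;
                    iteratedDeriv 2 l t, iteratedDeriv 2 μ t, iteratedDeriv 2 ν t;
                    iteratedDeriv 3 l t, iteratedDeriv 3 μ t, iteratedDeriv 3 ν t]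
        = (deriv l t * iteratedDeriv 2 ν t - iteratedDeriv 2 l t * deriv ν t) ^ 2 := by
  have hd : ∀ f : ℝ → ℝ, ContDiff ℝ (⊤ : ℕ∞) f → ∀ (n : ℕ) (t : ℝ),
      HasDerivAt (iteratedDeriv n f) (iteratedDeriv (n + 1) f t) t := by
    intro f hf n t
    rw [iteratedDeriv_succ]
    exact ((hf.differentiable_iteratedDeriv n (by exact_mod_cast ENat.coe_lt_top n)) t).hasDerivAt
  have l0 := hd l hl 0
  have l1 := hd l hl 1
  have l2 := hd l hl 2
  have n0 := hd ν hν 0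
  have n1 := hd ν hν 1
  have n2 := hd ν hν 2
  simp only [iteratedDeriv_zero, iteratedDeriv_one, zero_add, Nat.reduceAdd] at l0 l1 l2 n0 n1 n2
  have m1 : deriv μ = fun t => ν t * deriv l t - l t * deriv ν t := funext hcontact
  have m2 : iteratedDeriv 2 μ =
      fun t => ν t * iteratedDeriv 2 l t - l t * iteratedDeriv 2 ν t := by
    funext t
    rw [iteratedDeriv_succ, iteratedDeriv_one, m1]
    refine (((n0 t).mul (l1 t)).sub ((l0 t).mul (n1 t))).deriv.trans ?_
    ring
  have m3 : ∀ t, iteratedDeriv 3 μ t =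
      ν t * iteratedDeriv 3 l t - l t * iteratedDeriv 3 ν t
        + (deriv ν t * iteratedDeriv 2 l t - deriv l t * iteratedDeriv 2 ν t) := by
    intro t
    rw [iteratedDeriv_succ, m2]
    refine (((n0 t).mul (l2 t)).sub ((l0 t).mul (n2 t))).deriv.trans ?_
    ring
  intro t
  rw [Matrix.det_fin_three]
  simp [m3, m2, hcontact]
  ring
end

section
/- Let n ≥ 1 and let λ = (λ₁, …, λ_n) : ℝⁿ → ℝⁿ, ν = (ν₁, …, ν_n) : ℝⁿ → ℝⁿ and μ : ℝⁿ → ℝ be C^∞ maps satisfying the Legendre condition ∂μ/∂u_j = ∑_{i=1}^n (ν_i · ∂λ_i/∂u_j − λ_i · ∂ν_i/∂u_j) on ℝⁿ for every j. Define Λ_i, N_i : ℝⁿ × ℝⁿ → ℝ and M : ℝⁿ × ℝⁿ → ℝ by Λ_i(u,s) = λ_i(u) + ∑_j s_j · ∂λ_i/∂u_j(u), N_i(u,s) = ν_i(u) + ∑_j s_j · ∂ν_i/∂u_j(u), M(u,s) = μ(u) + ∑_j s_j · ∂μ/∂u_j(u). Then at every point (u,s) ∈ ℝⁿ × ℝⁿ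 the total differentials satisfy dM = ∑_{i=1}^n (ν_i(u) · dΛ_i − λ_i(u) · dN_i), i.e. ∂M/∂u_k = ∑_i (ν_i(u)·∂Λ_i/∂u_k − λ_i(u)·∂N_i/∂u_k) and ∂M/∂s_k = ∑_i (ν_i(u)·∂Λ_i/∂s_k − λ_i(u)·∂N_i/∂s_k) for every k. -/
/-- Partial derivative of a function on `ℝⁿ` in the `j`-th coordinate direction. -/
noncomputable def pd {n : ℕ} (f : (Fin n → ℝ) → ℝ) (j : Fin n) (u : Fin n → ℝ) : ℝ :=
  fderiv ℝ f u (Pi.single j 1)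

theorem sum_pd_eq {n : ℕ} (f : (Fin n → ℝ) → ℝ) (u s : Fin n → ℝ) :
    ∑ j, s j * pd f j u = fderiv ℝ f u s := by
  conv_rhs => rw [pi_eq_sum_univ' s, map_sum]
  refine Finset.sum_congr rfl fun j _ => ?_
  rw [map_smul, smul_eq_mul, pd]

theorem fderiv_tangent {n : ℕ} (f : (Fin n → ℝ) → ℝ) (hf : ContDiff ℝ (⊤ : ℕ∞) f)
    (p w : (Fin n → ℝ) × (Fin n → ℝ)) :
    fderiv ℝ (fun q : (Fin n → ℝ) × (Fin n → ℝ) => f q.1 + ∑ j, q.2 j * pd f j q.1) p w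
      = fderiv ℝ f p.1 w.1 + (fderiv ℝ f p.1 w.2 + fderiv ℝ (fderiv ℝ f) p.1 w.1 p.2) := by
  simp only [sum_pd_eq]
  have h1 : HasFDerivAt f (fderiv ℝ f p.1) p.1 :=
    (hf.differentiable (by simp) p.1).hasFDerivAt
  have h2 : HasFDerivAt (fderiv ℝ f) (fderiv ℝ (fderiv ℝ f) p.1) p.1 :=
    ((hf.fderiv_right (m := ((⊤ : ℕ∞) : WithTop ℕ∞)) (by rfl)).differentiable
      (by simp) p.1).hasFDerivAt
  have hfst : HasFDerivAt (Prod.fst : (Fin n → ℝ) × (Fin n → ℝ) → _) _ p := hasFDerivAt_fst (𝕜 := ℝ)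
  have hsnd : HasFDerivAt (Prod.snd : (Fin n → ℝ) × (Fin n → ℝ) → _) _ p := hasFDerivAt_snd (𝕜 := ℝ)
  have h3 := (h1.comp p hfst).add ((h2.comp p hfst).clm_apply hsnd)
  have h4 := h3.fderiv
  have h5 := congrArg (fun L => L w) h4
  refine Eq.trans h5 ?_
  simp

/-- If `(λ, μ, ν)` satisfies the Legendre condition
`∂μ/∂u_j = ∑ᵢ (νᵢ ∂λᵢ/∂u_j − λᵢ ∂νᵢ/∂u_j)`, then the components
`Λᵢ(u,s) = λᵢ + ∑ⱼ sⱼ ∂λᵢ/∂u_j`, `Nᵢ(u,s) = νᵢ + ∑ⱼ sⱼ ∂νᵢ/∂u_j`,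
`M(u,s) = μ + ∑ⱼ sⱼ ∂μ/∂u_j` of the tangent map satisfy
`dM = ∑ᵢ (νᵢ(u) dΛᵢ − λᵢ(u) dNᵢ)` at every point; hence the tangent variety of a
Legendre immersion is frontal. -/
theorem legendre_tangent_frontal_identity (n : ℕ) (hn : 1 ≤ n)
    (l v : Fin n → (Fin n → ℝ) → ℝ) (μ : (Fin n → ℝ) → ℝ)
    (hl : ∀ i, ContDiff ℝ (⊤ : ℕ∞) (l i)) (hv : ∀ i, ContDiff ℝ (⊤ : ℕ∞) (v i)) (hμ : ContDiff ℝ (⊤ : ℕ∞) μ)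
    (hLeg : ∀ (j : Fin n) (u : Fin n → ℝ),
      pd μ j u = ∑ i, (v i u * pd (l i) j u - l i u * pd (v i) j u)) :
    ∀ p : (Fin n → ℝ) × (Fin n → ℝ),
      fderiv ℝ (fun q : (Fin n → ℝ) × (Fin n → ℝ) => μ q.1 + ∑ j, q.2 j * pd μ j q.1) p
        = ∑ i,
            (v i p.1 • fderiv ℝ
                (fun q : (Fin n → ℝ) × (Fin n → ℝ) => l i q.1 + ∑ j, q.2 j * pd (l i) j q.1) p
              - l i p.1 • fderiv ℝ
                (fun q : (Fin n → ℝ) × (Fin n → ℝ) => v i q.1 + ∑ j, q.2 j * pd (v i) j q.1) p) := by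
  intro p
  have hd : ∀ f : (Fin n → ℝ) → ℝ, ContDiff ℝ (⊤ : ℕ∞) f → ∀ u, HasFDerivAt f (fderiv ℝ f u) u :=
    fun f hf u => (hf.differentiable (by simp) u).hasFDerivAt
  have hdd : ∀ f : (Fin n → ℝ) → ℝ, ContDiff ℝ (⊤ : ℕ∞) f →
      ∀ u, HasFDerivAt (fderiv ℝ f) (fderiv ℝ (fderiv ℝ f) u) u :=
    fun f hf u => ((hf.fderiv_right (m := ((⊤ : ℕ∞) : WithTop ℕ∞)) (by rfl)).differentiable
      (by simp) u).hasFDerivAt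
  have hsymm : ∀ f : (Fin n → ℝ) → ℝ, ContDiff ℝ (⊤ : ℕ∞) f → ∀ u a b,
      fderiv ℝ (fderiv ℝ f) u a b = fderiv ℝ (fderiv ℝ f) u b a :=
    fun f hf u a b => second_derivative_symmetric (hd f hf) (hdd f hf u) a b
  have hL : fderiv ℝ μ = fun u => ∑ i, (v i u • fderiv ℝ (l i) u - l i u • fderiv ℝ (v i) u) := by
    funext u
    ext s
    rw [← sum_pd_eq]
    simp only [hLeg, sum_apply, sub_apply,
      smul_apply, ← sum_pd_eq, smul_eq_mul, Finset.mul_sum,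
      ← Finset.sum_sub_distrib]
    rw [Finset.sum_comm]
    refine Finset.sum_congr rfl fun i _ => Finset.sum_congr rfl fun j _ => ?_
    ring
  have hL2 : ∀ u a b, fderiv ℝ (fderiv ℝ μ) u a b =
      ∑ i, ((v i u * fderiv ℝ (fderiv ℝ (l i)) u a b + fderiv ℝ (v i) u a * fderiv ℝ (l i) u b)
        - (l i u * fderiv ℝ (fderiv ℝ (v i)) u a b + fderiv ℝ (l i) u a * fderiv ℝ (v i) u b)) := by
    intro u a b
    have h := HasFDerivAt.fun_sum (u := Finset.univ) fun i (_ : i ∈ Finset.univ) =>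
      ((hd _ (hv i) u).smul (hdd _ (hl i) u)).sub ((hd _ (hl i) u).smul (hdd _ (hv i) u))
    have h' := congrArg (fun L => L a b) h.fderiv
    rw [hL]
    refine Eq.trans h' ?_
    simp
  have key : ∀ u a b, fderiv ℝ (fderiv ℝ μ) u a b =
      ∑ i, (v i u * fderiv ℝ (fderiv ℝ (l i)) u a b
        - l i u * fderiv ℝ (fderiv ℝ (v i)) u a b) := by
    intro u a b
    have e : fderiv ℝ (fderiv ℝ μ) u a b + fderiv ℝ (fderiv ℝ μ) u b a =
      2 * ∑ i, (v i u * fderiv ℝ (fderiv ℝ (l i)) u a b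
        - l i u * fderiv ℝ (fderiv ℝ (v i)) u a b) := by
      rw [hL2, hL2, ← Finset.sum_add_distrib, Finset.mul_sum]
      refine Finset.sum_congr rfl fun i _ => ?_
      rw [hsymm _ (hl i) u b a, hsymm _ (hv i) u b a]
      ring
    rw [hsymm _ hμ u b a] at e
    linarith
  refine ContinuousLinearMap.ext fun w => ?_
  rw [fderiv_tangent μ hμ, key, hL]
  simp only [sum_apply, sub_apply,
    smul_apply, smul_eq_mul, fderiv_tangent _ (hl _), fderiv_tangent _ (hv _),
    ← Finset.sum_add_distrib]
  refine Finset.sum_congr rfl fun i _ => ?_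
  ring
end
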